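/- arXiv:2604.01846 — 4 statements merged into one kernel-verified Lean document; each statement's English description precedes it below -/
import Mathlib

section
/- Suppose g, g' ∈ GL_n(E) are both non-critical of type S₀. If p_ref,u(Z_{S₀}gB) = p_ref,u(Z_{S₀}g'B) for every u ∈ W_n^{S₀} and p_cr(Z_{S₀}gB) = p_cr(Z_{S₀}g'B), then Z_{S₀}gB = Z_{S₀}g'B. Equivalently, the map (p_ref, p_cr) : Φ_nc(S₀) → ∏_{u ∈ W_n^{S₀}} Z_{S₀(u)}\L_{S₀(u)}/L_{S₀(u)}^B × T_s\GL_s(E)/B_s is injective. (This is the paper's flag-variety reformulation of its main theorem that a non-critical semistable (φ,Γ)-module is determined by its Steinberg subquotient data together with its maximal crystalline quotient.) -/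
/-!
Statement 0: the flag-variety reformulation of the main theorem: the map
`(p_ref, p_cr) : Φ_nc(S₀) → ∏_{u ∈ W_n^{S₀}} Z_{S₀(u)}\L_{S₀(u)}/L_{S₀(u)}^B × T_s\GL_s(E)/B_s`
is injective.  All indexing is 0-based: the simple root `i ∈ {0,…,n-2}` couples the
positions `i` and `i+1` of `Fin n`.
-/

open scoped Classical

noncomputable section

namespace Stmt0

/-- The permutation matrix `[u]`, characterized by `[u] · eⱼ = e_{u j}`. -/
def permMat (E : Type*) [Field E] {n : ℕ} (u : Equiv.Perm (Fin n)) :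
    Matrix (Fin n) (Fin n) E :=
  Matrix.of fun i j => if i = u j then 1 else 0

/-- The antidiagonal permutation matrix `w₀` (longest Weyl element). -/
def w0Mat (E : Type*) [Field E] (n : ℕ) : Matrix (Fin n) (Fin n) E :=
  Matrix.of fun i j => if (i : ℕ) + (j : ℕ) + 1 = n then 1 else 0

variable {E : Type*} [Field E]

/-- Membership in the Borel subgroup `B` of invertible upper triangular matrices. -/
def IsBorel {n : ℕ} (b : Matrix (Fin n) (Fin n) E) : Prop :=
  IsUnit b ∧ ∀ i j : Fin n, j < i → b i j = 0

/-- Upper triangular unipotent matrices (the group `N`). -/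
def IsUniUpper {n : ℕ} (m : Matrix (Fin n) (Fin n) E) : Prop :=
  (∀ i j : Fin n, j < i → m i j = 0) ∧ ∀ i : Fin n, m i i = 1

/-- Membership in the big Bruhat cell `B w₀ B`. -/
def InBigCell {n : ℕ} (g : Matrix (Fin n) (Fin n) E) : Prop :=
  ∃ b b' : Matrix (Fin n) (Fin n) E, IsBorel b ∧ IsBorel b' ∧ g = b * w0Mat E n * b'

/-- `u ∈ W_n^{S₀}`: `u` is increasing on every pair coupled by `S₀` (0-based). -/
def WminRep {n : ℕ} (S0 : Set ℕ) (u : Equiv.Perm (Fin n)) : Prop :=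
  ∀ i j : Fin n, (j : ℕ) = (i : ℕ) + 1 → (i : ℕ) ∈ S0 → u i < u j

/-- `g ∈ GL_n(E)` is non-critical of type `S₀`: `[u]g ∈ B w₀ B` for all `u ∈ W_n^{S₀}`. -/
def NonCritical {n : ℕ} (S0 : Set ℕ) (g : Matrix (Fin n) (Fin n) E) : Prop :=
  IsUnit g ∧ ∀ u : Equiv.Perm (Fin n), WminRep S0 u → InBigCell (permMat E u * g)

/-- The set `S₀(u) = { i : u⁻¹(i+1) = u⁻¹(i)+1 and u⁻¹(i) ∈ S₀ }` (0-based). -/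
def S0ofu {n : ℕ} (S0 : Set ℕ) (u : Equiv.Perm (Fin n)) : Set ℕ :=
  { i | ∃ a b : Fin n, (a : ℕ) = i ∧ (b : ℕ) = i + 1 ∧
      (u.symm b : ℕ) = (u.symm a : ℕ) + 1 ∧ ((u.symm a : ℕ) ∈ S0) }

/-- `p` and `q` lie in the same `J`-block. -/
def SameBlock {n : ℕ} (J : Set ℕ) (p q : Fin n) : Prop :=
  ∀ k : ℕ, min (p : ℕ) (q : ℕ) ≤ k → k < max (p : ℕ) (q : ℕ) → k ∈ J

/-- Membership in the standard Levi subgroup `L_J` (block-diagonal invertible matrices). -/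
def InLevi {n : ℕ} (J : Set ℕ) (g : Matrix (Fin n) (Fin n) E) : Prop :=
  IsUnit g ∧ ∀ p q : Fin n, ¬ SameBlock J p q → g p q = 0

/-- Membership in the centre `Z_J` of `L_J` (invertible diagonal, constant on `J`-blocks). -/
def InCenterLevi {n : ℕ} (J : Set ℕ) (g : Matrix (Fin n) (Fin n) E) : Prop :=
  IsUnit g ∧ (∀ p q : Fin n, p ≠ q → g p q = 0) ∧
    ∀ p q : Fin n, SameBlock J p q → g p p = g q q

/-- Membership in `L_J^B = L_J ∩ B`. -/
def InLeviB {n : ℕ} (J : Set ℕ) (g : Matrix (Fin n) (Fin n) E) : Prop :=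
  InLevi J g ∧ ∀ i j : Fin n, j < i → g i j = 0

/-- The first index of the `J`-block containing `p`. -/
def blockStart (J : Set ℕ) (p : ℕ) : ℕ :=
  sInf {m : ℕ | m ≤ p ∧ ∀ k, m ≤ k → k < p → k ∈ J}

/-- The last index of the `J`-block containing `p`. -/
def blockEnd (n : ℕ) (J : Set ℕ) (p : ℕ) : ℕ :=
  sSup {m : ℕ | m < n ∧ ∀ k, p ≤ k → k < m → k ∈ J}

/-- The permutation matrix `w_{0,J}` reversing every `J`-block. -/
def w0Blk (E : Type*) [Field E] (n : ℕ) (J : Set ℕ) : Matrix (Fin n) (Fin n) E :=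
  Matrix.of fun i j =>
    if (i : ℕ) + (j : ℕ) = blockStart J (j : ℕ) + blockEnd n J (j : ℕ) then 1 else 0

/-- `π_J(m)`: the block-diagonal part of `m`. -/
def blockPart {n : ℕ} (J : Set ℕ) (m : Matrix (Fin n) (Fin n) E) :
    Matrix (Fin n) (Fin n) E :=
  Matrix.of fun i j => if SameBlock J i j then m i j else 0

/-- Equality of the classes of `x`, `y` in the double-coset space `Z_J \ L_J / L_J^B`. -/
def LeviCosetEq {n : ℕ} (J : Set ℕ) (x y : Matrix (Fin n) (Fin n) E) : Prop :=
  ∃ z c : Matrix (Fin n) (Fin n) E, InCenterLevi J z ∧ InLeviB J c ∧ y = z * x * c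

/-- Invertible diagonal matrices (the torus `T_s`). -/
def IsTorus {s : ℕ} (t : Matrix (Fin s) (Fin s) E) : Prop :=
  IsUnit t ∧ ∀ i j : Fin s, i ≠ j → t i j = 0

/-- Equality of the classes of `x`, `y` in the double-coset space `T_s \ GL_s(E) / B_s`. -/
def CrCosetEq {s : ℕ} (x y : Matrix (Fin s) (Fin s) E) : Prop :=
  ∃ t c : Matrix (Fin s) (Fin s) E, IsTorus t ∧ IsBorel c ∧ y = t * x * c

/-- The bottom-right `s × s` corner of an `n × n` matrix. -/
def corner {n : ℕ} (s : ℕ) (m : Matrix (Fin n) (Fin n) E) : Matrix (Fin s) (Fin s) E :=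
  Matrix.of fun i j =>
    if h : n - s + (i : ℕ) < n ∧ n - s + (j : ℕ) < n then
      m ⟨n - s + (i : ℕ), h.1⟩ ⟨n - s + (j : ℕ), h.2⟩
    else 0

/-- Characterization of the special element `u₀ ∈ W_n^{S₀}`: it is increasing on block-end
positions (`p ∉ S₀`), increasing on the other positions, and sends every non-end position
below every block-end position; equivalently `u₀(t_r) = n-s+r` for `1 ≤ r ≤ s` and `u₀` is
increasing on the complement of `{t₁,…,t_s}`. -/
def IsU0 {n : ℕ} (S0 : Set ℕ) (u : Equiv.Perm (Fin n)) : Prop :=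
  (∀ p q : Fin n, p < q → (p : ℕ) ∉ S0 → (q : ℕ) ∉ S0 → u p < u q) ∧
  (∀ p q : Fin n, p < q → (p : ℕ) ∈ S0 → (q : ℕ) ∈ S0 → u p < u q) ∧
  (∀ p q : Fin n, (p : ℕ) ∈ S0 → (q : ℕ) ∉ S0 → u p < u q)

theorem SameBlock.symm {n : ℕ} {J : Set ℕ} {p q : Fin n} (h : SameBlock J p q) :
    SameBlock J q p := by
  intro k h1 h2
  exact h k (by rwa [min_comm]) (by rwa [max_comm])

theorem SameBlock.refl {n : ℕ} (J : Set ℕ) (p : Fin n) : SameBlock J p p := by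
  intro k h1 h2
  simp at h1 h2
  omega

theorem SameBlock.trans {n : ℕ} {J : Set ℕ} {p q r : Fin n} (h : SameBlock J p q)
    (h' : SameBlock J q r) : SameBlock J p r := by
  intro k h1 h2
  by_cases hk : min (p : ℕ) q ≤ k ∧ k < max (p : ℕ) q
  · exact h k hk.1 hk.2
  · exact h' k (by omega) (by omega)

theorem sameBlock_succ {n : ℕ} {J : Set ℕ} {p q : Fin n} (h : (q : ℕ) = p + 1)
    (hp : (p : ℕ) ∈ J) : SameBlock J p q := by
  intro k h1 h2
  obtain rfl : k = p := by omega
  exact hp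

/-- A set of indices whose intersection with every `S₀`-block is a final segment of it. -/
def IsUpSet {n : ℕ} (S0 : Set ℕ) (T : Finset (Fin n)) : Prop :=
  ∀ i j : Fin n, (j : ℕ) = i + 1 → (i : ℕ) ∈ S0 → i ∈ T → j ∈ T

theorem IsUpSet.mem_of_le {n : ℕ} {S0 : Set ℕ} {T : Finset (Fin n)} (hT : IsUpSet S0 T)
    {i j : Fin n} (hi : i ∈ T) (hij : i ≤ j) (hb : SameBlock S0 i j) : j ∈ T := by
  have key : ∀ d : ℕ, ∀ hd : (i : ℕ) + d < n, (i : ℕ) + d ≤ j → (⟨i + d, hd⟩ : Fin n) ∈ T := by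
    intro d
    induction d with
    | zero => intro _ _; exact hi
    | succ d ih =>
      intro hd hle
      refine hT ⟨i + d, by omega⟩ _ rfl (hb _ ?_ ?_) (ih (by omega) (by omega))
      · simp
      · simp
        omega
  have := key (j - i) (by omega) (by omega)
  convert this using 1
  ext
  simp
  omega

theorem IsUpSet.exists_top {n : ℕ} {S0 : Set ℕ} {T : Finset (Fin n)} (hT : IsUpSet S0 T)
    {m : Fin n} (hm : m ∉ T) :
    ∃ p, p ∉ T ∧ SameBlock S0 m p ∧ IsUpSet S0 (insert p T) := by
  have hne : (Finset.univ.filter fun x => SameBlock S0 m x ∧ x ∉ T).Nonempty :=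
    ⟨m, by simp [hm, SameBlock.refl]⟩
  obtain ⟨p, hp, hmax⟩ := Finset.exists_max_image _ id hne
  simp only [Finset.mem_filter, Finset.mem_univ, true_and, id] at hp hmax
  refine ⟨p, hp.2, hp.1, fun i j hij hi hiT => ?_⟩
  rw [Finset.mem_insert] at hiT ⊢
  rcases hiT with rfl | hiT
  · by_contra hj
    push Not at hj
    have := hmax j ⟨hp.1.trans (sameBlock_succ hij hi), hj.2⟩
    rw [Fin.le_def] at this
    omega
  · exact Or.inr (hT i j hij hi hiT)

theorem exists_perm_lt_iff {n : ℕ} (key : Fin n → ℕ) (hkey : Function.Injective key) :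
    ∃ u : Equiv.Perm (Fin n), ∀ i j, u i < u j ↔ key i < key j := by
  have hmono : StrictMono (key ∘ Tuple.sort key) :=
    (Tuple.monotone_sort key).strictMono_of_injective (hkey.comp (Equiv.injective _))
  refine ⟨(Tuple.sort key).symm, fun i j => ?_⟩
  rw [← hmono.lt_iff_lt]
  simp

theorem exists_minRep {n : ℕ} {S0 : Set ℕ} {T : Finset (Fin n)} (hT : IsUpSet S0 T)
    {p : Fin n} (hp : p ∉ T) (hpT : IsUpSet S0 (insert p T)) :
    ∃ u : Equiv.Perm (Fin n), WminRep S0 u ∧ (∀ m, m ∈ T ↔ u p < u m) ∧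
      ∀ m, SameBlock S0 m p → m ∉ T → SameBlock (S0ofu S0 u) (u m) (u p) := by
  let cls : Fin n → ℕ := fun m => if m ∈ T then 2 else if SameBlock S0 m p then 1 else 0
  let key : Fin n → ℕ := fun m => cls m * n + m
  have hkey_lt : ∀ i j, cls i < cls j → key i < key j := by
    intro i j h
    have : (cls i + 1) * n ≤ cls j * n := Nat.mul_le_mul_right _ h
    have := i.2
    simp only [key]
    linarith [add_mul (cls i) 1 n]
  have hkey_eq : ∀ i j, cls i = cls j → (key i < key j ↔ i < j) := by
    intro i j h
    simp only [key, h, Fin.lt_def]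
    omega
  have hinj : Function.Injective key := by
    intro i j h
    rcases lt_trichotomy (cls i) (cls j) with h' | h' | h'
    · exact absurd h (hkey_lt _ _ h').ne
    · simp only [key, h'] at h
      ext
      omega
    · exact absurd h (hkey_lt _ _ h').ne'
  obtain ⟨u, hu⟩ := exists_perm_lt_iff key hinj
  have hcp : cls p = 1 := by simp [cls, hp, SameBlock.refl]
  have hle : ∀ m, SameBlock S0 m p → m ∉ T → m ≤ p := by
    intro m hm hmT
    by_contra hlt
    have := hpT.mem_of_le (Finset.mem_insert_self p T) (not_le.1 hlt).le hm.symm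
    rw [Finset.mem_insert] at this
    rcases this with rfl | h
    · exact hlt le_rfl
    · exact hmT h
  refine ⟨u, ?_, ?_, ?_⟩
  · intro i j hij hi
    rw [hu]
    have hcl : cls i ≤ cls j := by
      have h1 : i ∈ T → j ∈ T := hT i j hij hi
      have h2 : SameBlock S0 i p → SameBlock S0 j p := (sameBlock_succ hij hi).symm.trans
      simp only [cls]
      split_ifs <;> simp_all
    rcases hcl.lt_or_eq with h | h
    · exact hkey_lt _ _ h
    · rw [hkey_eq _ _ h, Fin.lt_def]
      omega
  · intro m
    rw [hu]
    constructor
    · intro hm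
      exact hkey_lt _ _ (by simp [hcp, cls, hm])
    · intro hlt
      by_contra hm
      by_cases hb : SameBlock S0 m p
      · rw [hkey_eq _ _ (by simp [hcp, cls, hm, hb])] at hlt
        exact absurd (hle m hb hm) (not_le.2 hlt)
      · exact absurd (hkey_lt m p (by simp [hcp, cls, hm, hb])) hlt.asymm
  · have step : ∀ a b : Fin n, (b : ℕ) = a + 1 → cls a = cls b → (u b : ℕ) = u a + 1 := by
      intro a b hab hc
      have hk : key b = key a + 1 := by
        simp only [key, hc]
        omega
      have hlt : u a < u b := (hu _ _).2 (by omega)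
      by_contra hne
      rw [Fin.lt_def] at hlt
      obtain ⟨x, hx⟩ := u.surjective ⟨u a + 1, by omega⟩
      have h1 : u a < u x := by simp [hx, Fin.lt_def]
      have h2 : u x < u b := by
        simp only [hx, Fin.lt_def]
        omega
      rw [hu] at h1 h2
      omega
    have main : ∀ d : ℕ, ∀ m : Fin n, (m : ℕ) + d = p → SameBlock S0 m p → m ∉ T →
        (u m : ℕ) ≤ u p ∧ ∀ k : ℕ, (u m : ℕ) ≤ k → k < u p → k ∈ S0ofu S0 u := by
      intro d
      induction d with
      | zero =>
        intro m hm _ _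
        obtain rfl : m = p := by
          ext
          omega
        exact ⟨le_rfl, fun k _ _ => by omega⟩
      | succ d ih =>
        intro m hm hb hmT
        have hmS : (m : ℕ) ∈ S0 := hb m (by simp) (by simp; omega)
        let m' : Fin n := ⟨m + 1, by omega⟩
        have hb' : SameBlock S0 m' p := (sameBlock_succ (q := m') rfl hmS).symm.trans hb
        have hmT' : m' ∉ T := by
          intro h
          exact hp (hT.mem_of_le h (by rw [Fin.le_def]; simp [m']; omega) hb')
        obtain ⟨h1, h2⟩ := ih m' (by simp [m']; omega) hb' hmT'
        have hs := step m m' rfl (by simp [cls, hmT, hmT', hb, hb'])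
        refine ⟨by omega, fun k hk1 hk2 => ?_⟩
        rcases hk1.eq_or_lt with rfl | hk1
        · exact ⟨u m, u m', rfl, hs, by simp [m'], by simpa using hmS⟩
        · exact h2 k (by omega) hk2
    intro m hb hmT
    have hmp := hle m hb hmT
    rw [Fin.le_def] at hmp
    obtain ⟨h1, h2⟩ := main (p - m) m (by omega) hb hmT
    intro k hk1 hk2
    exact h2 k (by omega) (by omega)

theorem exists_upSet_card {n : ℕ} {S0 : Set ℕ} (hS0 : ∀ i ∈ S0, i + 1 < n)
    (hne : S0.Nonempty) {k : ℕ} (hk : 1 ≤ k) (hkn : k < n) :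
    ∃ (T : Finset (Fin n)) (p q : Fin n), T.card = k ∧ IsUpSet S0 T ∧ (q : ℕ) = p + 1 ∧
      (p : ℕ) ∈ S0 ∧ p ∉ T ∧ q ∈ T := by
  let a : Fin n := ⟨n - k, by omega⟩
  let b : Fin n := ⟨n - k - 1, by omega⟩
  let T := Finset.Ici a
  have hTm : ∀ x : Fin n, x ∈ T ↔ n - k ≤ x := fun x => by simp [T, a, Fin.le_def]
  have hcard : T.card = k := by
    simp [T, a]
    omega
  have swap : ∀ x ∈ T, ∀ y ∉ T, (insert y (T.erase x)).card = k := by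
    intro x hx y hy
    rw [Finset.card_insert_of_notMem (fun h => hy (Finset.mem_of_mem_erase h)),
      Finset.card_erase_of_mem hx]
    omega
  by_cases hb : n - k - 1 ∈ S0
  · refine ⟨T, b, a, hcard, fun i j hij _ hi => ?_, by simp [a, b]; omega, hb, ?_, ?_⟩
    · rw [hTm] at hi ⊢
      omega
    · simp [hTm, b]
      omega
    · simp [hTm, a]
  by_cases hhigh : ∃ x, x ∈ S0 ∧ n - k ≤ x
  · obtain ⟨x, ⟨hx, hkx⟩, hmin⟩ : ∃ x, (x ∈ S0 ∧ n - k ≤ x) ∧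
        ∀ y < x, ¬ (y ∈ S0 ∧ n - k ≤ y) :=
      ⟨Nat.find hhigh, Nat.find_spec hhigh, fun y => Nat.find_min hhigh⟩
    have hxn := hS0 x hx
    have hxT : (⟨x, by omega⟩ : Fin n) ∈ T := by simp [hTm, hkx]
    have hbT : b ∉ T := by
      simp [hTm, b]
      omega
    refine ⟨insert b (T.erase ⟨x, by omega⟩), ⟨x, by omega⟩, ⟨x + 1, hxn⟩,
      swap _ hxT _ hbT, fun i j hij hi hiT => ?_, rfl, hx, ?_, ?_⟩
    · simp only [Finset.mem_insert, Finset.mem_erase, hTm, Fin.ext_iff, b] at hiT ⊢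
      rcases hiT with h | ⟨h1, h2⟩
      · exact absurd (h ▸ hi) hb
      · have hjx : (j : ℕ) ≠ x := fun h => hmin i (by omega) ⟨hi, h2⟩
        exact Or.inr ⟨fun h => hjx (congrArg Fin.val h), by omega⟩
    · simp [Fin.ext_iff, b]
      omega
    · simp [hTm, Fin.ext_iff]
      omega
  · push Not at hhigh
    obtain ⟨y, hy, hmax⟩ := Set.Finite.exists_maximal (s := S0)
      ((Set.finite_lt_nat n).subset fun i hi => by
        have := hS0 i hi
        simp only [Set.mem_ofPred_eq]
        omega) hne
    have hyk := hhigh y hy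
    have hyb : y ≠ n - k - 1 := fun h => hb (h ▸ hy)
    have haT : a ∈ T := by simp [hTm, a]
    have hyT : (⟨y + 1, hS0 y hy⟩ : Fin n) ∉ T := by
      simp [hTm]
      omega
    refine ⟨insert ⟨y + 1, hS0 y hy⟩ (T.erase a), ⟨y, by omega⟩, ⟨y + 1, hS0 y hy⟩,
      swap _ haT _ hyT, fun i j hij hi hiT => ?_, rfl, hy, ?_, by simp⟩
    · simp only [Finset.mem_insert, Finset.mem_erase, hTm, Fin.ext_iff, a] at hiT ⊢
      have := hhigh i hi
      rcases hiT with h | ⟨h1, h2⟩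
      · have := hmax hi (by omega)
        omega
      · omega
    · simp [hTm, Fin.ext_iff]
      omega

/-- The span of the first `k` columns of `g`. -/
def flag {n : ℕ} (g : Matrix (Fin n) (Fin n) E) (k : ℕ) : Submodule E (Fin n → E) :=
  Submodule.span E {v | ∃ i : Fin n, (i : ℕ) < k ∧ v = g.col i}

theorem col_mem_flag {n : ℕ} (g : Matrix (Fin n) (Fin n) E) {k : ℕ} (i : Fin n)
    (hi : (i : ℕ) < k) : g.col i ∈ flag g k :=
  Submodule.subset_span ⟨i, hi, rfl⟩

theorem flag_mono {n : ℕ} (g : Matrix (Fin n) (Fin n) E) {k l : ℕ} (h : k ≤ l) :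
    flag g k ≤ flag g l :=
  Submodule.span_mono fun _ ⟨i, hi, hv⟩ => ⟨i, hi.trans_le h, hv⟩

theorem flag_zero {n : ℕ} (g : Matrix (Fin n) (Fin n) E) : flag g 0 = ⊥ := by
  simp [flag]

theorem mem_flag_succ {n : ℕ} {g : Matrix (Fin n) (Fin n) E} {k : ℕ} (hk : k < n)
    {v : Fin n → E} :
    v ∈ flag g (k + 1) ↔ ∃ f ∈ flag g k, ∃ c : E, v = f + c • g.col ⟨k, hk⟩ := by
  have : {v | ∃ i : Fin n, (i : ℕ) < k + 1 ∧ v = g.col i} =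
      {v | ∃ i : Fin n, (i : ℕ) < k ∧ v = g.col i} ∪ {g.col ⟨k, hk⟩} := by
    ext v
    constructor
    · rintro ⟨i, hi, rfl⟩
      rcases Nat.lt_succ_iff_lt_or_eq.1 hi with h | h
      · exact Or.inl ⟨i, h, rfl⟩
      · subst h
        exact Or.inr rfl
    · rintro (⟨i, hi, rfl⟩ | rfl)
      · exact ⟨i, by omega, rfl⟩
      · exact ⟨⟨k, hk⟩, by simp, rfl⟩
  rw [flag, this, Submodule.span_union, Submodule.mem_sup]
  simp only [Submodule.mem_span_singleton]
  constructor
  · rintro ⟨f, hf, _, ⟨c, rfl⟩, rfl⟩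
    exact ⟨f, hf, c, rfl⟩
  · rintro ⟨f, hf, c, rfl⟩
    exact ⟨f, hf, _, ⟨c, rfl⟩, rfl⟩

theorem col_mul_mem_flag {n : ℕ} (h b : Matrix (Fin n) (Fin n) E)
    (hb : ∀ i j : Fin n, j < i → b i j = 0) {k : ℕ} (j : Fin n) (hj : (j : ℕ) < k) :
    (h * b).col j ∈ flag h k := by
  have : (h * b).col j = ∑ i, b i j • h.col i := by
    ext m
    simp [Matrix.mul_apply, Finset.sum_apply, mul_comm]
  rw [this]
  refine Submodule.sum_mem _ fun i _ => ?_
  rcases lt_or_ge j i with hij | hij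
  · simp [hb i j hij]
  · exact Submodule.smul_mem _ _ (col_mem_flag h i (lt_of_le_of_lt hij hj))

theorem flag_mul_le {n : ℕ} (h b : Matrix (Fin n) (Fin n) E)
    (hb : ∀ i j : Fin n, j < i → b i j = 0) (k : ℕ) : flag (h * b) k ≤ flag h k := by
  refine Submodule.span_le.2 ?_
  rintro _ ⟨j, hj, rfl⟩
  exact col_mul_mem_flag h b hb j hj

theorem IsBorel.exists_inv {n : ℕ} {b : Matrix (Fin n) (Fin n) E} (hb : IsBorel b) :
    ∃ b', IsBorel b' ∧ b * b' = 1 ∧ b' * b = 1 := by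
  have hdet := (Matrix.isUnit_iff_isUnit_det b).1 hb.1
  have h1 := Matrix.mul_nonsing_inv b hdet
  have h2 := Matrix.nonsing_inv_mul b hdet
  let := b.invertibleOfIsUnitDet hdet
  refine ⟨b⁻¹, ⟨⟨⟨b⁻¹, b, h2, h1⟩, rfl⟩, ?_⟩, h1, h2⟩
  have : Matrix.BlockTriangular b id := fun i j h => hb.2 i j h
  exact fun i j h => Matrix.blockTriangular_inv_of_blockTriangular this h

theorem IsBorel.mul {n : ℕ} {b c : Matrix (Fin n) (Fin n) E} (hb : IsBorel b)
    (hc : IsBorel c) : IsBorel (b * c) := by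
  refine ⟨hb.1.mul hc.1, fun i j h => ?_⟩
  have hb' : Matrix.BlockTriangular b id := fun i j h => hb.2 i j h
  have hc' : Matrix.BlockTriangular c id := fun i j h => hc.2 i j h
  exact hb'.mul hc' h

theorem IsUniUpper.isBorel {n : ℕ} {m : Matrix (Fin n) (Fin n) E} (hm : IsUniUpper m) :
    IsBorel m := by
  refine ⟨(Matrix.isUnit_iff_isUnit_det m).2 ?_, hm.1⟩
  rw [Matrix.det_of_isUpperTriangular (fun i j h => hm.1 i j h)]
  simp [hm.2]

/-- An upper unitriangular `P'` with `P' = P * M`, `P` upper unitriangular and `M` lower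
triangular, equals `P`. -/
theorem IsUniUpper.eq_of_eq_mul_lower {n : ℕ} {P P' M : Matrix (Fin n) (Fin n) E}
    (hP : IsUniUpper P) (hP' : IsUniUpper P') (hM : ∀ i j : Fin n, i < j → M i j = 0)
    (h : P' = P * M) : P' = P := by
  obtain ⟨Q, hQ, -, hQP⟩ := hP.isBorel.exists_inv
  have hMQ : M = Q * P' := by rw [h, ← Matrix.mul_assoc, hQP, Matrix.one_mul]
  have hMu := hMQ ▸ (hQ.mul hP'.isBorel).2
  have hdiag : M = Matrix.diagonal fun i => M i i := by
    ext i j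
    rcases lt_trichotomy i j with hij | rfl | hij
    · rw [Matrix.diagonal_apply_ne _ hij.ne, hM i j hij]
    · simp
    · rw [Matrix.diagonal_apply_ne _ hij.ne', hMu i j hij]
  have hone : M = 1 := by
    rw [hdiag, ← Matrix.diagonal_one]
    congr 1
    ext i
    have := hP'.2 i
    rw [h, hdiag, Matrix.mul_diagonal, hP.2, one_mul] at this
    exact this
  rw [h, hone, Matrix.mul_one]

/-- No nonzero vector of the `k`-th step of the flag vanishes on an up-set of size `k`. -/
def Transverse {n : ℕ} (S0 : Set ℕ) (g : Matrix (Fin n) (Fin n) E) : Prop :=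
  ∀ T : Finset (Fin n), IsUpSet S0 T → ∀ v ∈ flag g T.card, (∀ m ∈ T, v m = 0) → v = 0

/-- For every up-set `T` and every index `p` that may be added to `T`, the vectors of the two
flags of step `#T + 1` vanishing on `T` and normalized at `p` agree on the block of `p`. -/
def BlockAgree {n : ℕ} (S0 : Set ℕ) (g g' : Matrix (Fin n) (Fin n) E) : Prop :=
  ∀ (T : Finset (Fin n)) (p : Fin n), IsUpSet S0 T → p ∉ T → IsUpSet S0 (insert p T) →
    ∃ h ∈ flag g (T.card + 1), ∃ h' ∈ flag g' (T.card + 1),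
      (∀ m ∈ T, h m = 0) ∧ (∀ m ∈ T, h' m = 0) ∧ h p = 1 ∧ h' p = 1 ∧
      ∀ m, SameBlock S0 m p → h m = h' m

theorem Transverse.eq_smul {n : ℕ} {S0 : Set ℕ} {g : Matrix (Fin n) (Fin n) E}
    (hg : Transverse S0 g) {T : Finset (Fin n)} {p : Fin n} (hp : p ∉ T)
    (hpT : IsUpSet S0 (insert p T)) {v h : Fin n → E} (hv : v ∈ flag g (T.card + 1))
    (hh : h ∈ flag g (T.card + 1)) (hvT : ∀ m ∈ T, v m = 0) (hhT : ∀ m ∈ T, h m = 0)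
    (hhp : h p = 1) : v = v p • h := by
  refine sub_eq_zero.1 (hg _ hpT _ ?_ fun m hm => ?_)
  · rw [Finset.card_insert_of_notMem hp]
    exact Submodule.sub_mem _ hv (Submodule.smul_mem _ _ hh)
  · rcases Finset.mem_insert.1 hm with rfl | hm
    · simp [hhp]
    · simp [hvT m hm, hhT m hm]

theorem flag_succ_le {n : ℕ} {g : Matrix (Fin n) (Fin n) E} {k : ℕ} (hk : k < n)
    {W : Submodule E (Fin n → E)} (hW : flag g k ≤ W) {h : Fin n → E}
    (hh : h ∈ flag g (k + 1)) (hhk : h ∉ flag g k) (hhW : h ∈ W) : flag g (k + 1) ≤ W := by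
  obtain ⟨f, hf, c, rfl⟩ := (mem_flag_succ hk).1 hh
  have hc : c ≠ 0 := by
    rintro rfl
    simp [hf] at hhk
  have hcol : g.col ⟨k, hk⟩ ∈ W := by
    have := (Submodule.add_mem_iff_right W (hW hf)).1 hhW
    exact (Submodule.smul_mem_iff W hc).1 this
  intro v hv
  obtain ⟨f, hf, c, rfl⟩ := (mem_flag_succ hk).1 hv
  exact W.add_mem (hW hf) (W.smul_mem _ hcol)

theorem BlockAgree.flag_succ_eq {n : ℕ} {S0 : Set ℕ} (hS0 : ∀ i ∈ S0, i + 1 < n)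
    (hne : S0.Nonempty) {g g' : Matrix (Fin n) (Fin n) E} (hg : Transverse S0 g)
    (hg' : Transverse S0 g') (ha : BlockAgree S0 g g') {k : ℕ} (hk : 1 ≤ k) (hkn : k < n)
    (heq : flag g k = flag g' k) : flag g (k + 1) = flag g' (k + 1) := by
  obtain ⟨T, p₀, q, rfl, hT, hq, hp₀S, hp₀T, hqT⟩ := exists_upSet_card hS0 hne hk hkn
  have hp₀q : SameBlock S0 p₀ q := sameBlock_succ hq hp₀S
  have hp₀ : IsUpSet S0 (insert p₀ T) := by
    intro i j hij hi hiT
    rw [Finset.mem_insert] at hiT ⊢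
    rcases hiT with rfl | hiT
    · obtain rfl : j = q := by
        ext
        omega
      exact Or.inr hqT
    · exact Or.inr (hT i j hij hi hiT)
  have hTq : IsUpSet S0 (T.erase q) := by
    intro i j hij hi hiT
    rw [Finset.mem_erase] at hiT ⊢
    refine ⟨?_, hT i j hij hi hiT.2⟩
    rintro rfl
    obtain rfl : i = p₀ := by
      ext
      omega
    exact hp₀T hiT.2
  have hcard : (T.erase q).card + 1 = T.card := Finset.card_erase_add_one hqT
  obtain ⟨h₀, hh₀, h₀', hh₀', h₀T, h₀'T, h₀p, h₀'p, h₀eq⟩ := ha T p₀ hT hp₀T hp₀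
  have main : h₀ = h₀' := by
    ext m
    by_cases hm : m ∈ T
    · rw [h₀T m hm, h₀'T m hm]
    by_cases hmb : SameBlock S0 m p₀
    · exact h₀eq m hmb
    obtain ⟨p, hpT, hmp, hp⟩ := hT.exists_top hm
    have hpb : ¬ SameBlock S0 p q := fun h => hmb (hmp.trans (h.trans hp₀q.symm))
    obtain ⟨h₁, hh₁, h₁', hh₁', h₁T, h₁'T, h₁p, h₁'p, h₁eq⟩ := ha T p hT hpT hp
    have e₁ := hg.eq_smul hpT hp hh₀ hh₁ h₀T h₁T h₁p
    have e₁' := hg'.eq_smul hpT hp hh₀' hh₁' h₀'T h₁'T h₁'p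
    suffices hb : h₀ p = h₀' p by
      rw [e₁, e₁']
      simp [hb, h₁eq m hmp]
    have hpe : p ∉ T.erase q := fun h => hpT (Finset.mem_of_mem_erase h)
    have hT' : IsUpSet S0 (insert p (T.erase q)) := by
      intro i j hij hi hiT
      rw [Finset.mem_insert] at hiT
      rcases hiT with rfl | hiT
      · have := hp i j hij hi (Finset.mem_insert_self _ _)
        rw [Finset.mem_insert] at this ⊢
        refine this.imp id fun h => Finset.mem_erase.2 ⟨?_, h⟩
        rintro rfl
        exact hpb (sameBlock_succ hij hi)
      · exact Finset.mem_insert_of_mem (hTq i j hij hi hiT)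
    have hqT' : q ∉ insert p (T.erase q) := by
      simp only [Finset.mem_insert, Finset.mem_erase, ne_eq, not_true_eq_false, false_and,
        or_false]
      rintro rfl
      exact hpT hqT
    have hins : insert q (insert p (T.erase q)) = insert p T := by
      rw [Finset.insert_comm, Finset.insert_erase hqT]
    have hcard' : (insert p (T.erase q)).card = T.card := by
      rw [Finset.card_insert_of_notMem hpe, hcard]
    obtain ⟨w, hw, -, -, wT, -, wp, -, -⟩ := ha _ p hTq hpe hT'
    rw [hcard] at hw
    obtain ⟨h₂, hh₂, h₂', hh₂', h₂T, h₂'T, h₂q, h₂'q, h₂eq⟩ :=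
      ha _ q hT' hqT' (hins ▸ hp)
    have relation : ∀ {G : Matrix (Fin n) (Fin n) E} {x y : Fin n → E}, Transverse S0 G →
        w ∈ flag G T.card → x ∈ flag G (T.card + 1) → (∀ m ∈ T, x m = 0) → x p₀ = 1 →
        y ∈ flag G ((insert p (T.erase q)).card + 1) →
        (∀ m ∈ insert p (T.erase q), y m = 0) → y q = 1 →
        x p * (w p₀ - w q * y p₀) = 1 := by
      intro G x y hG hwG hx hxT hxp hy hyT hyq
      have hmem : x - x p • w ∈ flag G ((insert p (T.erase q)).card + 1) := by
        rw [hcard']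
        exact Submodule.sub_mem _ hx (Submodule.smul_mem _ _ (flag_mono G (Nat.le_succ _) hwG))
      have hvan : ∀ m ∈ insert p (T.erase q), (x - x p • w) m = 0 := by
        intro m hm
        rcases Finset.mem_insert.1 hm with rfl | hm
        · simp [wp]
        · simp [wT m hm, hxT m (Finset.mem_of_mem_erase hm)]
      have := congrFun (hG.eq_smul hqT' (hins ▸ hp) hmem hy hvan hyT hyq) p₀
      simp only [Pi.sub_apply, Pi.smul_apply, smul_eq_mul, hxp, hxT q hqT] at this
      linear_combination -this
    have r := relation hg hw hh₀ h₀T h₀p hh₂ h₂T h₂q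
    have r' := relation hg' (heq ▸ hw) hh₀' h₀'T h₀'p hh₂' h₂'T h₂'q
    rw [← h₂eq p₀ hp₀q] at r'
    exact mul_right_cancel₀ (right_ne_zero_of_mul_eq_one r) (r.trans r'.symm)
  have hnot : ∀ {G : Matrix (Fin n) (Fin n) E}, Transverse S0 G → h₀ ∉ flag G T.card := by
    intro G hG hmem
    have := congrFun (hG T hT h₀ hmem h₀T) p₀
    simp [h₀p] at this
  apply le_antisymm
  · exact flag_succ_le hkn (heq.le.trans (flag_mono _ (Nat.le_succ _))) hh₀ (hnot hg)
      (main ▸ hh₀')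
  · exact flag_succ_le hkn (heq.ge.trans (flag_mono _ (Nat.le_succ _))) (main ▸ hh₀')
      (hnot hg') hh₀

theorem exists_borel_of_flag_eq {n : ℕ} {g g' : Matrix (Fin n) (Fin n) E} (hg : IsUnit g)
    (hg' : IsUnit g') (h : ∀ k ≤ n, flag g' k ≤ flag g k) : ∃ b, IsBorel b ∧ g' = g * b := by
  have hdet := (Matrix.isUnit_iff_isUnit_det g).1 hg
  refine ⟨g⁻¹ * g', ⟨(Matrix.isUnit_nonsing_inv_iff.2 hg).mul hg', fun i j hij => ?_⟩, ?_⟩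
  · have hmem := h (j + 1) j.2 (col_mem_flag g' j (Nat.lt_succ_self _))
    have hle : flag g (j + 1) ≤
        LinearMap.ker ((LinearMap.proj i).comp (Matrix.mulVecLin g⁻¹)) := by
      refine Submodule.span_le.2 ?_
      rintro _ ⟨l, hl, rfl⟩
      have : (g⁻¹ * g) i l = 0 := by
        rw [Matrix.nonsing_inv_mul _ hdet, Matrix.one_apply_ne]
        rintro rfl
        rw [Fin.lt_def] at hij
        omega
      simpa [Matrix.mulVec, dotProduct, Matrix.mul_apply] using this
    simpa [Matrix.mulVec, dotProduct, Matrix.mul_apply] using hle hmem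
  · rw [← Matrix.mul_assoc, Matrix.mul_nonsing_inv _ hdet, Matrix.one_mul]

theorem permMat_mul_apply {n : ℕ} (u : Equiv.Perm (Fin n)) (g : Matrix (Fin n) (Fin n) E)
    (i j : Fin n) : (permMat E u * g) (u i) j = g i j := by
  simp [permMat, Matrix.mul_apply]

theorem mul_w0Mat_apply {n : ℕ} (m : Matrix (Fin n) (Fin n) E) (i j : Fin n) :
    (m * w0Mat E n) i j = m i j.rev := by
  rw [Matrix.mul_apply, Finset.sum_eq_single j.rev]
  · have : (j.rev : ℕ) + j + 1 = n := by
      rw [Fin.val_rev]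
      omega
    rw [w0Mat, Matrix.of_apply, if_pos this, mul_one]
  · intro x _ hx
    have : ¬ (x : ℕ) + j + 1 = n := fun h => hx (by
      ext
      rw [Fin.val_rev]
      omega)
    simp [w0Mat, this]
  · simp

/-- The flag of `g` is the flag of the matrix `(m, j) ↦ n_u (u m) (w₀ j)`. -/
theorem flag_eq_of_bruhat {n : ℕ} {g ν b : Matrix (Fin n) (Fin n) E}
    {u : Equiv.Perm (Fin n)} (hb : IsBorel b) (h : permMat E u * g = ν * w0Mat E n * b) (k : ℕ) :
    flag g k = flag (ν.submatrix u Fin.rev) k := by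
  obtain ⟨c, hc, hbc, hcb⟩ := hb.exists_inv
  have hgb : g = ν.submatrix u Fin.rev * b := by
    ext i j
    rw [← permMat_mul_apply u g i j, h]
    rw [Matrix.mul_apply, Matrix.mul_apply]
    simp only [mul_w0Mat_apply, Matrix.submatrix_apply]
  apply le_antisymm
  · rw [hgb]
    exact flag_mul_le _ b hb.2 k
  · have : ν.submatrix u Fin.rev = g * c := by
      rw [hgb, Matrix.mul_assoc, hbc, Matrix.mul_one]
    rw [this]
    exact flag_mul_le _ c hc.2 k

theorem IsUniUpper.eq_zero_of_mem_flag {n : ℕ} {ν : Matrix (Fin n) (Fin n) E}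
    (hν : IsUniUpper ν) (u : Equiv.Perm (Fin n)) :
    ∀ k ≤ n, ∀ v ∈ flag (ν.submatrix u Fin.rev) k, (∀ m, n ≤ u m + k → v m = 0) → v = 0 := by
  intro k
  induction k with
  | zero =>
    intro _ v hv _
    simpa [flag_zero] using hv
  | succ k ih =>
    intro hk v hv hvan
    obtain ⟨f, hf, c, rfl⟩ := (mem_flag_succ (by omega)).1 hv
    have hcol : ∀ m, n ≤ u m + k → ν (u m) (Fin.rev ⟨k, by omega⟩) = 0 := fun m hm =>
      hν.1 _ _ (by rw [Fin.lt_def, Fin.val_rev]; simp; omega)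
    have hf0 : f = 0 := by
      refine ih (by omega) f hf fun m hm => ?_
      have := hvan m (by omega)
      simpa [hcol m hm] using this
    subst hf0
    have := hvan (u.symm (Fin.rev ⟨k, by omega⟩)) (by simp [Fin.val_rev]; omega)
    have hc : c = 0 := by simpa [hν.2] using this
    simp [hc]

theorem card_eq_of_mem_iff_lt {n : ℕ} {T : Finset (Fin n)} {u : Equiv.Perm (Fin n)} {p : Fin n}
    (h : ∀ m, m ∈ T ↔ u p < u m) : T.card + u p + 1 = n := by
  have : T.map u.toEmbedding = Finset.Ioi (u p) := by
    ext x
    rw [Finset.mem_map_equiv, h, Equiv.apply_symm_apply, Finset.mem_Ioi]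
  have := congrArg Finset.card this
  rw [Finset.card_map, Fin.card_Ioi] at this
  omega

theorem transverse_of_bruhat {n : ℕ} {S0 : Set ℕ} {g : Matrix (Fin n) (Fin n) E}
    {ν : Equiv.Perm (Fin n) → Matrix (Fin n) (Fin n) E}
    (hν : ∀ u, WminRep S0 u → IsUniUpper (ν u) ∧
        ∃ b, IsBorel b ∧ permMat E u * g = ν u * w0Mat E n * b) : Transverse S0 g := by
  intro T hT v hv hvT
  by_cases hall : ∀ m, m ∈ T
  · ext m
    exact hvT m (hall m)
  push Not at hall
  obtain ⟨m, hm⟩ := hall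
  obtain ⟨p, hp, -, hpT⟩ := hT.exists_top hm
  obtain ⟨u, hu, huT, -⟩ := exists_minRep hT hp hpT
  obtain ⟨hU, b, hb, hgb⟩ := hν u hu
  have hcard := card_eq_of_mem_iff_lt huT
  rw [flag_eq_of_bruhat hb hgb] at hv
  refine hU.eq_zero_of_mem_flag u _ (by omega) v hv fun m hm => hvT m ?_
  rw [huT, Fin.lt_def]
  omega

theorem blockAgree_of_bruhat {n : ℕ} {S0 : Set ℕ} {g g' : Matrix (Fin n) (Fin n) E}
    {ν ν' : Equiv.Perm (Fin n) → Matrix (Fin n) (Fin n) E}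
    (hν : ∀ u, WminRep S0 u → IsUniUpper (ν u) ∧
        ∃ b, IsBorel b ∧ permMat E u * g = ν u * w0Mat E n * b)
    (hν' : ∀ u, WminRep S0 u → IsUniUpper (ν' u) ∧
        ∃ b, IsBorel b ∧ permMat E u * g' = ν' u * w0Mat E n * b)
    (heq : ∀ u, WminRep S0 u → ∀ i j, SameBlock (S0ofu S0 u) i j → ν u i j = ν' u i j) :
    BlockAgree S0 g g' := by
  intro T p hT hp hpT
  obtain ⟨u, hu, huT, hblock⟩ := exists_minRep hT hp hpT
  have hcard := card_eq_of_mem_iff_lt huT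
  obtain ⟨hU, b, hb, hgb⟩ := hν u hu
  obtain ⟨hU', b', hb', hgb'⟩ := hν' u hu
  have hmem : ∀ N : Matrix (Fin n) (Fin n) E,
      (fun m => N (u m) (u p)) ∈ flag (N.submatrix u Fin.rev) (T.card + 1) := by
    intro N
    have hrev : ((u p).rev : ℕ) < T.card + 1 := by
      rw [Fin.val_rev]
      omega
    convert col_mem_flag (N.submatrix u Fin.rev) (u p).rev hrev using 1
    ext m
    simp
  refine ⟨fun m => ν u (u m) (u p), ?_, fun m => ν' u (u m) (u p), ?_,
    fun m hm => hU.1 _ _ ((huT m).1 hm), fun m hm => hU'.1 _ _ ((huT m).1 hm),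
    hU.2 _, hU'.2 _, fun m hm => ?_⟩
  · rw [flag_eq_of_bruhat hb hgb]
    exact hmem _
  · rw [flag_eq_of_bruhat hb' hgb']
    exact hmem _
  · by_cases hmT : m ∈ T
    · simp only [hU.1 _ _ ((huT m).1 hmT), hU'.1 _ _ ((huT m).1 hmT)]
    · exact heq u hu _ _ (hblock m hm hmT)

theorem blockStart_spec (J : Set ℕ) (p : ℕ) :
    blockStart J p ≤ p ∧ ∀ k, blockStart J p ≤ k → k < p → k ∈ J :=
  Nat.sInf_mem (s := {m : ℕ | m ≤ p ∧ ∀ k, m ≤ k → k < p → k ∈ J})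
    ⟨p, le_rfl, fun k h1 h2 => by omega⟩

theorem blockEnd_spec {n : ℕ} (J : Set ℕ) (p : Fin n) :
    blockEnd n J p < n ∧ ∀ k, (p : ℕ) ≤ k → k < blockEnd n J p → k ∈ J :=
  Nat.sSup_mem (s := {m : ℕ | m < n ∧ ∀ k, (p : ℕ) ≤ k → k < m → k ∈ J})
    ⟨p, p.2, fun k h1 h2 => by omega⟩ ⟨n, fun _ h => h.1.le⟩

theorem le_blockEnd {n : ℕ} {J : Set ℕ} {p m : ℕ} (hm : m < n)
    (h : ∀ k, p ≤ k → k < m → k ∈ J) : m ≤ blockEnd n J p :=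
  le_csSup (s := {m : ℕ | m < n ∧ ∀ k, p ≤ k → k < m → k ∈ J}) ⟨n, fun _ h => h.1.le⟩ ⟨hm, h⟩

theorem blockStart_le {J : Set ℕ} {p m : ℕ} (hm : m ≤ p)
    (h : ∀ k, m ≤ k → k < p → k ∈ J) : blockStart J p ≤ m :=
  Nat.sInf_le (s := {m : ℕ | m ≤ p ∧ ∀ k, m ≤ k → k < p → k ∈ J}) ⟨hm, h⟩

theorem SameBlock.blockStart_eq {n : ℕ} {J : Set ℕ} {p q : Fin n} (h : SameBlock J p q) :
    blockStart J p = blockStart J q := by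
  wlog hpq : (p : ℕ) ≤ q generalizing p q
  · exact (this h.symm (by omega)).symm
  have hJ : ∀ k, (p : ℕ) ≤ k → k < q → k ∈ J := fun k h1 h2 => h k (by omega) (by omega)
  obtain ⟨h1, h2⟩ := blockStart_spec J p
  obtain ⟨h3, h4⟩ := blockStart_spec J q
  have hle : blockStart J q ≤ blockStart J p := by
    refine blockStart_le (by omega) fun k hk1 hk2 => ?_
    rcases lt_or_ge k p with h | h
    · exact h2 k hk1 h
    · exact hJ k h hk2
  exact le_antisymm (blockStart_le (by omega) fun k hk1 hk2 => h4 k hk1 (by omega)) hle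

theorem SameBlock.blockEnd_eq {n : ℕ} {J : Set ℕ} {p q : Fin n} (h : SameBlock J p q) :
    blockEnd n J p = blockEnd n J q := by
  wlog hpq : (p : ℕ) ≤ q generalizing p q
  · exact (this h.symm (by omega)).symm
  have hJ : ∀ k, (p : ℕ) ≤ k → k < q → k ∈ J := fun k h1 h2 => h k (by omega) (by omega)
  obtain ⟨h1, h2⟩ := blockEnd_spec J p
  obtain ⟨h3, h4⟩ := blockEnd_spec J q
  refine le_antisymm (le_blockEnd h1 fun k hk1 hk2 => h2 k (by omega) hk2)
    (le_blockEnd h3 fun k hk1 hk2 => ?_)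
  rcases lt_or_ge k q with h | h
  · exact hJ k hk1 h
  · exact h4 k h hk2

/-- The matrix `w_{0,J}` is the permutation matrix of an involution reversing each block. -/
theorem exists_blockReverse {n : ℕ} (J : Set ℕ) :
    ∃ σ : Fin n → Fin n, (∀ i, σ (σ i) = i) ∧ (∀ i, SameBlock J i (σ i)) ∧
      (∀ i j, SameBlock J i j → i < j → σ j < σ i) ∧
      ∀ i j, w0Blk E n J i j = if i = σ j then 1 else 0 := by
  have hle : ∀ i : Fin n, blockStart J i ≤ i ∧ (i : ℕ) ≤ blockEnd n J i := fun i =>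
    ⟨(blockStart_spec J i).1, le_blockEnd i.2 fun k h1 h2 => by omega⟩
  have hlt := fun i : Fin n => (blockEnd_spec J i).1
  let σ : Fin n → Fin n := fun i =>
    ⟨blockStart J i + blockEnd n J i - i, by have := hle i; have := hlt i; omega⟩
  have hσ : ∀ i, (σ i : ℕ) + i = blockStart J i + blockEnd n J i := fun i => by
    have := hle i
    simp only [σ]
    omega
  have hb : ∀ i, SameBlock J i (σ i) := by
    intro i k h1 h2
    have := hσ i
    have := hle i
    rcases lt_or_ge k i with h | h
    · exact (blockStart_spec J i).2 k (by omega) h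
    · exact (blockEnd_spec J i).2 k h (by omega)
  refine ⟨σ, fun i => ?_, hb, fun i j hij h => ?_, fun i j => ?_⟩
  · have h1 := hσ (σ i)
    rw [← (hb i).blockStart_eq, ← (hb i).blockEnd_eq] at h1
    have := hσ i
    ext
    omega
  · have h1 := hσ j
    rw [← hij.blockStart_eq, ← hij.blockEnd_eq] at h1
    have := hσ i
    rw [Fin.lt_def] at h ⊢
    omega
  · have := hσ j
    have h : (i : ℕ) + j = blockStart J j + blockEnd n J j ↔ i = σ j := by
      rw [Fin.ext_iff]
      omega
    simp [w0Blk, h]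

theorem LeviCosetEq.blockPart_eq {n : ℕ} {J : Set ℕ} {m m' : Matrix (Fin n) (Fin n) E}
    (hm : IsUniUpper m) (hm' : IsUniUpper m')
    (h : LeviCosetEq J (blockPart J m * w0Blk E n J) (blockPart J m' * w0Blk E n J)) :
    blockPart J m' = blockPart J m := by
  obtain ⟨z, c, ⟨-, hz, hzJ⟩, ⟨⟨-, hcJ⟩, hc⟩, h⟩ := h
  obtain ⟨σ, hσσ, hσJ, hσlt, hW⟩ := exists_blockReverse (E := E) (n := n) J
  have huni : ∀ {x : Matrix (Fin n) (Fin n) E}, IsUniUpper x → IsUniUpper (blockPart J x) := by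
    intro x hx
    refine ⟨fun i j hij => ?_, fun i => by simp [blockPart, SameBlock.refl, hx.2]⟩
    simp [blockPart, hx.1 i j hij]
  have hcomm : z * blockPart J m = blockPart J m * z := by
    have hzd : z = Matrix.diagonal fun i => z i i := by
      ext i j
      by_cases hij : i = j
      · simp [hij]
      · rw [Matrix.diagonal_apply_ne _ hij, hz i j hij]
    ext i j
    rw [hzd, Matrix.diagonal_mul, Matrix.mul_diagonal]
    by_cases hij : SameBlock J i j
    · rw [hzJ i j hij, mul_comm]
    · simp [blockPart, hij]
  have hsub : (w0Blk E n J * c).submatrix id σ = c.submatrix σ σ := by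
    ext i j
    simp only [Matrix.submatrix_apply, Matrix.mul_apply, hW, id]
    rw [Finset.sum_eq_single (σ i)]
    · simp [hσσ]
    · intro x _ hx
      rw [if_neg, zero_mul]
      rintro rfl
      exact hx (hσσ x).symm
    · simp
  have hsub' : (blockPart J m' * w0Blk E n J).submatrix id σ = blockPart J m' := by
    ext i j
    simp [Matrix.mul_apply, hW, hσσ]
  refine (huni hm).eq_of_eq_mul_lower (huni hm') (M := z * c.submatrix σ σ) ?_ ?_
  · intro i j hij
    rw [Matrix.mul_apply]
    refine Finset.sum_eq_zero fun x _ => ?_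
    by_cases hix : i = x
    · subst hix
      rw [Matrix.submatrix_apply]
      by_cases hb : SameBlock J i j
      · rw [hc _ _ (hσlt i j hb hij), mul_zero]
      · rw [hcJ _ _ fun hs => hb ((hσJ i).trans (hs.trans (hσJ j).symm)), mul_zero]
    · rw [hz i x hix, zero_mul]
  · have hz' : z * (blockPart J m * w0Blk E n J) * c =
        blockPart J m * (z * (w0Blk E n J * c)) := by
      rw [← Matrix.mul_assoc z, hcomm]
      simp only [Matrix.mul_assoc]
    rw [← hsub', h, hz', ← hsub]
    rfl

/-- Scaling the rows of `g` by `z` scales the flag of `g` coordinatewise. -/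
theorem mem_flag_diagonal_mul {n : ℕ} {g : Matrix (Fin n) (Fin n) E} {z : Fin n → E}
    {k : ℕ} {v : Fin n → E} :
    v ∈ flag (Matrix.diagonal z * g) k ↔ ∃ w ∈ flag g k, v = z * w := by
  have : flag (Matrix.diagonal z * g) k = (flag g k).map (LinearMap.mulLeft E z) := by
    rw [flag, flag, Submodule.map_span]
    congr 1
    have hcol : ∀ i, (Matrix.diagonal z * g).col i = z * g.col i := by
      intro i
      ext m
      simp [Matrix.diagonal_mul]
    ext v
    constructor
    · rintro ⟨i, hi, rfl⟩
      exact ⟨_, ⟨i, hi, rfl⟩, (hcol i).symm⟩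
    · rintro ⟨_, ⟨i, hi, rfl⟩, rfl⟩
      exact ⟨i, hi, (hcol i).symm⟩
  rw [this, Submodule.mem_map]
  simp [eq_comm]

theorem Transverse.diagonal_mul {n : ℕ} {S0 : Set ℕ} {g : Matrix (Fin n) (Fin n) E}
    (hg : Transverse S0 g) {z : Fin n → E} (hz : ∀ i, z i ≠ 0) :
    Transverse S0 (Matrix.diagonal z * g) := by
  intro T hT v hv hvT
  obtain ⟨w, hw, rfl⟩ := mem_flag_diagonal_mul.1 hv
  rw [hg T hT w hw fun m hm => by simpa [hz m] using hvT m hm, mul_zero]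

theorem BlockAgree.diagonal_mul {n : ℕ} {S0 : Set ℕ} {g g' : Matrix (Fin n) (Fin n) E}
    (ha : BlockAgree S0 g g') {z : Fin n → E} (hz : ∀ i, z i ≠ 0)
    (hzS : ∀ i j, SameBlock S0 i j → z i = z j) :
    BlockAgree S0 (Matrix.diagonal z * g) g' := by
  intro T p hT hp hpT
  obtain ⟨h, hh, h', hh', hT0, hT0', hp1, hp1', hb⟩ := ha T p hT hp hpT
  refine ⟨z * ((z p)⁻¹ • h), mem_flag_diagonal_mul.2 ⟨_, Submodule.smul_mem _ _ hh, rfl⟩,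
    h', hh', fun m hm => by simp [hT0 m hm], hT0', by simp [hp1, hz p], hp1', fun m hm => ?_⟩
  simp [hzS m p hm, hz p, hb m hm]

theorem BlockAgree.exists_diagonal {n : ℕ} {S0 : Set ℕ} {g g' : Matrix (Fin n) (Fin n) E}
    (hS0 : ∀ i ∈ S0, i + 1 < n) (hn : 0 < n) (hg : Transverse S0 g) (hg' : Transverse S0 g')
    (ha : BlockAgree S0 g g') :
    ∃ z : Fin n → E, (∀ i, z i ≠ 0) ∧ (∀ i j, SameBlock S0 i j → z i = z j) ∧
      flag (Matrix.diagonal z * g) 1 = flag g' 1 := by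
  have hempty : IsUpSet S0 (∅ : Finset (Fin n)) := fun i j _ _ h => by simp at h
  choose e _ heb heU using fun m : Fin n => hempty.exists_top (Finset.notMem_empty m)
  have heS : ∀ m, (e m : ℕ) ∉ S0 := by
    intro m hm
    have := heU m (e m) ⟨e m + 1, hS0 _ hm⟩ rfl hm (by simp)
    simp [Fin.ext_iff] at this
  have hconst : ∀ i j, SameBlock S0 i j → e i = e j := by
    intro i j hij
    have hb := (heb i).symm.trans (hij.trans (heb j))
    by_contra hne
    rcases lt_or_gt_of_ne hne with h | h <;> rw [Fin.lt_def] at h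
    · exact heS i (hb _ (by omega) (by omega))
    · exact heS j (hb _ (by omega) (by omega))
  let o : Fin n := ⟨0, hn⟩
  choose h hh h' hh' _ _ hp hp' hb using fun m => ha ∅ (e m) hempty (by simp) (heU m)
  have hcol : ∀ {G : Matrix (Fin n) (Fin n) E} {m : Fin n} {x : Fin n → E},
      Transverse S0 G → x ∈ flag G ((∅ : Finset (Fin n)).card + 1) → x (e m) = 1 →
      G.col o = G (e m) o • x := fun hG hx hx1 =>
    hG.eq_smul (T := ∅) (by simp) (heU _) (col_mem_flag _ o (by simp [o])) hx (by simp)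
      (by simp) hx1
  have hcne : ∀ {G : Matrix (Fin n) (Fin n) E} {m : Fin n} {x : Fin n → E},
      Transverse S0 G → x ∈ flag G ((∅ : Finset (Fin n)).card + 1) → x (e m) = 1 →
      G (e m) o ≠ 0 := by
    intro G m x hG hx hx1 h0
    have hc := hcol hG hx hx1
    rw [h0, zero_smul] at hc
    obtain ⟨f, hf, c, rfl⟩ := (mem_flag_succ hn).1 hx
    have hf0 : f = 0 := by simpa [flag_zero] using hf
    have : G.col ⟨0, hn⟩ = 0 := hc
    simp [hf0, this] at hx1
  have hgne := fun m => hcne hg (hh m) (hp m)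
  have hgne' := fun m => hcne hg' (hh' m) (hp' m)
  let z : Fin n → E := fun m => g' (e m) o / g (e m) o
  refine ⟨z, fun m => div_ne_zero (hgne' m) (hgne m),
    fun i j hij => by simp only [z, hconst i j hij], ?_⟩
  have hcoleq : (Matrix.diagonal z * g).col o = g'.col o := by
    ext m
    have h1 := congrFun (hcol hg (hh m) (hp m)) m
    have h2 := congrFun (hcol hg' (hh' m) (hp' m)) m
    simp only [Pi.smul_apply, smul_eq_mul, Matrix.col_apply] at h1 h2
    rw [Matrix.col_apply, Matrix.diagonal_mul, Matrix.col_apply, h1, h2, hb m m (heb m)]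
    simp only [z]
    have := hgne m
    field_simp
  ext v
  rw [mem_flag_succ hn, mem_flag_succ hn]
  simp only [flag_zero, Submodule.mem_bot, exists_eq_left, zero_add]
  rw [show (⟨0, hn⟩ : Fin n) = o from rfl, hcoleq]

theorem BlockAgree.exists_eq_mul {n : ℕ} {S0 : Set ℕ} {g g' : Matrix (Fin n) (Fin n) E}
    (hS0 : ∀ i ∈ S0, i + 1 < n) (hne : S0.Nonempty) (hgu : IsUnit g) (hgu' : IsUnit g')
    (hg : Transverse S0 g) (hg' : Transverse S0 g') (ha : BlockAgree S0 g g') :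
    ∃ z b : Matrix (Fin n) (Fin n) E, InCenterLevi S0 z ∧ IsBorel b ∧ g' = z * g * b := by
  have hn : 0 < n := by
    obtain ⟨i, hi⟩ := hne
    have := hS0 i hi
    omega
  obtain ⟨z, hz, hzS, hone⟩ := ha.exists_diagonal hS0 hn hg hg'
  have hflag : ∀ k, flag (Matrix.diagonal z * g) (k + 1) = flag g' (k + 1) ∨ n ≤ k := by
    intro k
    induction k with
    | zero => exact Or.inl hone
    | succ k ih =>
      rcases lt_or_ge (k + 1) n with h | h
      · exact Or.inl ((ha.diagonal_mul hz hzS).flag_succ_eq hS0 hne (hg.diagonal_mul hz) hg'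
          (by omega) h (ih.resolve_right (by omega)))
      · exact Or.inr h
  have hzu : IsUnit (Matrix.diagonal z) :=
    Matrix.isUnit_diagonal.2 (Pi.isUnit_iff.2 fun i => (hz i).isUnit)
  obtain ⟨b, hb, hgb⟩ := exists_borel_of_flag_eq (hzu.mul hgu) hgu' fun k hk => by
    rcases k with _ | k
    · simp [flag_zero]
    · exact ((hflag k).resolve_right (by omega)).ge
  refine ⟨Matrix.diagonal z, b, ⟨hzu, fun p q h => Matrix.diagonal_apply_ne _ h, ?_⟩, hb, hgb⟩
  intro p q h
  simpa using hzS p q h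

theorem CrCosetEq.exists_eq_mul {n : ℕ} {g g' m m' b b' : Matrix (Fin n) (Fin n) E}
    (hb : IsBorel b) (hb' : IsBorel b') (hg : g = m * w0Mat E n * b)
    (hg' : g' = m' * w0Mat E n * b') (h : CrCosetEq (m * w0Mat E n) (m' * w0Mat E n)) :
    ∃ t c : Matrix (Fin n) (Fin n) E, IsTorus t ∧ IsBorel c ∧ g' = t * g * c := by
  obtain ⟨t, c, ht, hc, h⟩ := h
  obtain ⟨d, hd, hbd, -⟩ := hb.exists_inv
  refine ⟨t, d * (c * b'), ht, hd.mul (hc.mul hb'), ?_⟩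
  have : g * (d * (c * b')) = m * w0Mat E n * (c * b') := by
    rw [hg, Matrix.mul_assoc _ b, ← Matrix.mul_assoc b, hbd, Matrix.one_mul]
  rw [Matrix.mul_assoc t, this, hg', h]
  simp only [Matrix.mul_assoc]

theorem isU0_empty {n : ℕ} {u : Equiv.Perm (Fin n)} (hu : IsU0 ∅ u) : u = 1 := by
  have hmono : StrictMono u := fun p q h => hu.1 p q h (by simp) (by simp)
  exact Equiv.ext fun i => congrFun hmono.eq_id i

/-- If `g, g'` are non-critical of type `S₀`,
`p_ref,u(Z_{S₀}gB) = p_ref,u(Z_{S₀}g'B)` for all `u ∈ W_n^{S₀}`, and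
`p_cr(Z_{S₀}gB) = p_cr(Z_{S₀}g'B)`, then `Z_{S₀}gB = Z_{S₀}g'B`.
Here `ν u` (resp. `ν' u`) is the unipotent part `n_u` of `[u]g ∈ N w₀ B`
(resp. of `[u]g'`), `u₀` is the distinguished refinement used for `p_cr`,
and `s = n - #S₀` is the number of blocks. -/
theorem statement0
    {n : ℕ} (S0 : Set ℕ) (hS0 : ∀ i ∈ S0, i + 1 < n)
    (g g' : Matrix (Fin n) (Fin n) E)
    (hg : NonCritical S0 g) (hg' : NonCritical S0 g')
    (ν ν' : Equiv.Perm (Fin n) → Matrix (Fin n) (Fin n) E)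
    (hν : ∀ u, WminRep S0 u → IsUniUpper (ν u) ∧
        ∃ b, IsBorel b ∧ permMat E u * g = ν u * w0Mat E n * b)
    (hν' : ∀ u, WminRep S0 u → IsUniUpper (ν' u) ∧
        ∃ b, IsBorel b ∧ permMat E u * g' = ν' u * w0Mat E n * b)
    (u0 : Equiv.Perm (Fin n)) (hu0 : IsU0 S0 u0) (hu0W : WminRep S0 u0)
    (href : ∀ u, WminRep S0 u →
        LeviCosetEq (S0ofu S0 u)
          (blockPart (S0ofu S0 u) (ν u) * w0Blk E n (S0ofu S0 u))
          (blockPart (S0ofu S0 u) (ν' u) * w0Blk E n (S0ofu S0 u)))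
    (hcr : CrCosetEq
        (corner (n - S0.ncard) (ν u0) * w0Mat E (n - S0.ncard))
        (corner (n - S0.ncard) (ν' u0) * w0Mat E (n - S0.ncard))) :
    ∃ z b : Matrix (Fin n) (Fin n) E,
      InCenterLevi S0 z ∧ IsBorel b ∧ g' = z * g * b := by
  rcases S0.eq_empty_or_nonempty with rfl | hne
  · obtain rfl := isU0_empty hu0
    have hone : permMat E (1 : Equiv.Perm (Fin n)) = 1 := by
      ext i j
      by_cases hij : i = j <;> simp [permMat, Matrix.one_apply, hij]
    obtain ⟨-, b, hb, hgb⟩ := hν 1 hu0W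
    obtain ⟨-, b', hb', hgb'⟩ := hν' 1 hu0W
    rw [hone, Matrix.one_mul] at hgb hgb'
    have hcorner : ∀ m : Matrix (Fin n) (Fin n) E, corner n m = m := by
      intro m
      ext i j
      simp [corner]
    have hcard : n - (∅ : Set ℕ).ncard = n := by simp
    rw [hcard, hcorner, hcorner] at hcr
    obtain ⟨t, c, ht, hc, h⟩ := hcr.exists_eq_mul hb hb' hgb hgb'
    refine ⟨t, c, ⟨ht.1, ht.2, fun p q hpq => ?_⟩, hc, h⟩
    by_cases hne : p = q
    · rw [hne]
    · have : (p : ℕ) ≠ q := fun h => hne (Fin.ext h)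
      exact absurd (hpq (min (p : ℕ) q) le_rfl (by omega)) (by simp)
  · refine BlockAgree.exists_eq_mul hS0 hne hg.1 hg'.1 (transverse_of_bruhat hν)
      (transverse_of_bruhat hν') (blockAgree_of_bruhat hν hν' fun u hu i j hij => ?_)
    have := congrFun (congrFun ((href u hu).blockPart_eq (hν u hu).1 (hν' u hu).1) i) j
    simpa [blockPart, hij] using this.symm

end Stmt0
end
end

section
/- Suppose g, g' ∈ GL_n(E) are both non-critical of type S₀. Assume: (i) the subspace K(g) := { (X_u)_{u ∈ W_n^{S₀}} : X_u ∈ Ad_{[u]⁻¹}(τ_{S₀(u)}) ∩ Ad_g(𝔟) for every u, and Σ_u X_u = 0 } of ∏_{u ∈ W_n^{S₀}} M_n(E) equals the analogously defined subspace K(g'); and (ii) for every u ∈ W_n^{S₀} there exists z_u ∈ Z_{S₀(u)} with 𝔩_{S₀(u)} ∩ Ad_{[u]g'}(𝔟) = Ad_{z_u}(𝔩_{S₀(u)} ∩ Ad_{[u]g}(𝔟)). Then Z_{S₀}gB = Z_{S₀}g'B. (This is the paper's Lie-algebraic reformulation of its theorem that a non-critical semistable (φ,Γ)-module is determined by its Steinberg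 subquotient data together with the comparison maps ι^{r,q} between parabolic filtrations.) -/
/-!
Statement 1: the Lie-algebraic reformulation of the theorem that a non-critical semistable
`(φ,Γ)`-module is determined by its Steinberg subquotient data together with the
comparison maps `ι^{r,q}`.  All indexing is 0-based.
-/

open scoped Classical

noncomputable section

namespace Stmt1

/-- The permutation matrix `[u]`, characterized by `[u] · eⱼ = e_{u j}`. -/
def permMat (E : Type*) [Field E] {n : ℕ} (u : Equiv.Perm (Fin n)) :
    Matrix (Fin n) (Fin n) E :=
  Matrix.of fun i j => if i = u j then 1 else 0

/-- The antidiagonal permutation matrix `w₀`. -/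
def w0Mat (E : Type*) [Field E] (n : ℕ) : Matrix (Fin n) (Fin n) E :=
  Matrix.of fun i j => if (i : ℕ) + (j : ℕ) + 1 = n then 1 else 0

variable {E : Type*} [Field E]

/-- Membership in the Borel subgroup `B` of invertible upper triangular matrices. -/
def IsBorel {n : ℕ} (b : Matrix (Fin n) (Fin n) E) : Prop :=
  IsUnit b ∧ ∀ i j : Fin n, j < i → b i j = 0

/-- Membership in the big Bruhat cell `B w₀ B`. -/
def InBigCell {n : ℕ} (g : Matrix (Fin n) (Fin n) E) : Prop :=
  ∃ b b' : Matrix (Fin n) (Fin n) E, IsBorel b ∧ IsBorel b' ∧ g = b * w0Mat E n * b'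

/-- `u ∈ W_n^{S₀}` (0-based). -/
def WminRep {n : ℕ} (S0 : Set ℕ) (u : Equiv.Perm (Fin n)) : Prop :=
  ∀ i j : Fin n, (j : ℕ) = (i : ℕ) + 1 → (i : ℕ) ∈ S0 → u i < u j

/-- `g ∈ GL_n(E)` is non-critical of type `S₀`. -/
def NonCritical {n : ℕ} (S0 : Set ℕ) (g : Matrix (Fin n) (Fin n) E) : Prop :=
  IsUnit g ∧ ∀ u : Equiv.Perm (Fin n), WminRep S0 u → InBigCell (permMat E u * g)

/-- The set `S₀(u)` (0-based). -/
def S0ofu {n : ℕ} (S0 : Set ℕ) (u : Equiv.Perm (Fin n)) : Set ℕ :=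
  { i | ∃ a b : Fin n, (a : ℕ) = i ∧ (b : ℕ) = i + 1 ∧
      (u.symm b : ℕ) = (u.symm a : ℕ) + 1 ∧ ((u.symm a : ℕ) ∈ S0) }

/-- `p` and `q` lie in the same `J`-block. -/
def SameBlock {n : ℕ} (J : Set ℕ) (p q : Fin n) : Prop :=
  ∀ k : ℕ, min (p : ℕ) (q : ℕ) ≤ k → k < max (p : ℕ) (q : ℕ) → k ∈ J

/-- `Ad_h(V) = { h X h⁻¹ : X ∈ V }`. -/
def AdSet {n : ℕ} (h : Matrix (Fin n) (Fin n) E)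
    (V : Set (Matrix (Fin n) (Fin n) E)) : Set (Matrix (Fin n) (Fin n) E) :=
  (fun x => h * x * h⁻¹) '' V

/-- The Borel subalgebra `𝔟` of upper triangular matrices. -/
def bSet (E : Type*) [Field E] (n : ℕ) : Set (Matrix (Fin n) (Fin n) E) :=
  { x | ∀ i j : Fin n, j < i → x i j = 0 }

/-- The Levi subalgebra `𝔩_J` of block-diagonal matrices. -/
def lSetJ (E : Type*) [Field E] {n : ℕ} (J : Set ℕ) : Set (Matrix (Fin n) (Fin n) E) :=
  { x | ∀ p q : Fin n, ¬ SameBlock J p q → x p q = 0 }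

/-- The nilpotent radical `𝔫_J` of strictly block-upper-triangular matrices. -/
def nSetJ (E : Type*) [Field E] {n : ℕ} (J : Set ℕ) : Set (Matrix (Fin n) (Fin n) E) :=
  { x | ∀ p q : Fin n, ¬ ((p : ℕ) < (q : ℕ) ∧ ¬ SameBlock J p q) → x p q = 0 }

/-- The centre `𝔷_J` of `𝔩_J`: diagonal matrices constant on each `J`-block. -/
def zSetJ (E : Type*) [Field E] {n : ℕ} (J : Set ℕ) : Set (Matrix (Fin n) (Fin n) E) :=
  { x | (∀ p q : Fin n, p ≠ q → x p q = 0) ∧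
        ∀ p q : Fin n, SameBlock J p q → x p p = x q q }

/-- The full radical `τ_J = 𝔷_J + 𝔫_J` of `𝔭_J`. -/
def tauSetJ (E : Type*) [Field E] {n : ℕ} (J : Set ℕ) : Set (Matrix (Fin n) (Fin n) E) :=
  { x | ∃ a ∈ zSetJ E J, ∃ b ∈ nSetJ E J, x = a + b }

/-- The subspace
`K(g) = { (X_u)_u : X_u ∈ Ad_{[u]⁻¹}(τ_{S₀(u)}) ∩ Ad_g(𝔟) for u ∈ W_n^{S₀}, Σ_u X_u = 0 }`
(tuples indexed by `W_n^{S₀}`, encoded as functions on all permutations vanishing off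
`W_n^{S₀}`). -/
def Kset {n : ℕ} (S0 : Set ℕ) (g : Matrix (Fin n) (Fin n) E) :
    Set (Equiv.Perm (Fin n) → Matrix (Fin n) (Fin n) E) :=
  { X | (∀ u, WminRep S0 u →
          X u ∈ AdSet (permMat E u)⁻¹ (tauSetJ E (S0ofu S0 u)) ∩ AdSet g (bSet E n)) ∧
        (∀ u, ¬ WminRep S0 u → X u = 0) ∧
        ∑ u : Equiv.Perm (Fin n), X u = 0 }

lemma permMat_one {n : ℕ} : permMat E (1 : Equiv.Perm (Fin n)) = 1 := by
  ext i j; simp only [permMat, Matrix.of_apply, Matrix.one_apply, Equiv.Perm.one_apply]; congr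

lemma permMat_mul_apply {n : ℕ} (u : Equiv.Perm (Fin n)) (g : Matrix (Fin n) (Fin n) E)
    (i j : Fin n) : (permMat E u * g) i j = g (u.symm i) j := by
  rw [Matrix.mul_apply, Finset.sum_eq_single (u.symm i)]
  · simp [permMat]
  · intro b _ hb
    have : i ≠ u b := by rintro rfl; simp at hb
    simp [permMat, this]
  · simp

lemma mul_permMat_apply {n : ℕ} (u : Equiv.Perm (Fin n)) (g : Matrix (Fin n) (Fin n) E)
    (i j : Fin n) : (g * permMat E u) i j = g i (u j) := by
  simp [Matrix.mul_apply, permMat]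

lemma permMat_mul {n : ℕ} (u v : Equiv.Perm (Fin n)) :
    permMat E u * permMat E v = permMat E (u * v) := by
  ext i j
  rw [mul_permMat_apply]
  simp only [permMat, Matrix.of_apply, Equiv.Perm.mul_apply]
  congr

lemma permMat_inv {n : ℕ} (u : Equiv.Perm (Fin n)) : (permMat E u)⁻¹ = permMat E u⁻¹ :=
  Matrix.inv_eq_left_inv (by rw [permMat_mul, inv_mul_cancel, permMat_one])

lemma isUnit_permMat {n : ℕ} (u : Equiv.Perm (Fin n)) : IsUnit (permMat E u) :=
  IsUnit.of_mul_eq_one (permMat E u⁻¹) (by rw [permMat_mul, mul_inv_cancel, permMat_one])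

lemma w0Mat_eq {n : ℕ} : w0Mat E n = permMat E (Fin.revPerm : Equiv.Perm (Fin n)) := by
  ext i j
  simp only [w0Mat, permMat, Matrix.of_apply, Fin.revPerm_apply, Fin.ext_iff, Fin.val_rev]
  congr 1
  apply propext
  omega

lemma w0Mat_mul_self {n : ℕ} : w0Mat E n * w0Mat E n = 1 := by
  rw [w0Mat_eq, permMat_mul, ← permMat_one]
  congr 1
  ext i; simp

lemma w0Mat_mul_mul_apply {n : ℕ} (Y : Matrix (Fin n) (Fin n) E) (p q : Fin n) :
    (w0Mat E n * Y * w0Mat E n) p q = Y p.rev q.rev := by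
  rw [w0Mat_eq, mul_permMat_apply, permMat_mul_apply]; simp

lemma unit_mul_inv {n : ℕ} {h : Matrix (Fin n) (Fin n) E} (hh : IsUnit h) : h * h⁻¹ = 1 :=
  Matrix.mul_nonsing_inv h ((Matrix.isUnit_iff_isUnit_det h).1 hh)

lemma unit_inv_mul {n : ℕ} {h : Matrix (Fin n) (Fin n) E} (hh : IsUnit h) : h⁻¹ * h = 1 :=
  Matrix.nonsing_inv_mul h ((Matrix.isUnit_iff_isUnit_det h).1 hh)

lemma mem_AdSet {n : ℕ} {h : Matrix (Fin n) (Fin n) E} (hh : IsUnit h)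
    {V : Set (Matrix (Fin n) (Fin n) E)} {X : Matrix (Fin n) (Fin n) E} :
    X ∈ AdSet h V ↔ h⁻¹ * X * h ∈ V := by
  have h1 := unit_mul_inv hh
  have h2 := unit_inv_mul hh
  constructor
  · rintro ⟨Y, hY, rfl⟩
    have : h⁻¹ * (h * Y * h⁻¹) * h = (h⁻¹ * h) * Y * (h⁻¹ * h) := by noncomm_ring
    simpa [this, h2] using hY
  · intro hX
    refine ⟨_, hX, ?_⟩
    have : h * (h⁻¹ * X * h) * h⁻¹ = (h * h⁻¹) * X * (h * h⁻¹) := by noncomm_ring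
    simpa [h1] using this

lemma IsBorel.blockTriangular {n : ℕ} {b : Matrix (Fin n) (Fin n) E} (hb : IsBorel b) :
    b.BlockTriangular id := fun _ _ h => hb.2 _ _ h

lemma IsUnit.inv_matrix {n : ℕ} {b : Matrix (Fin n) (Fin n) E} (hb : IsUnit b) :
    IsUnit b⁻¹ := IsUnit.of_mul_eq_one b (unit_inv_mul hb)

lemma IsBorel.inv {n : ℕ} {b : Matrix (Fin n) (Fin n) E} (hb : IsBorel b) : IsBorel b⁻¹ := by
  have := hb.1.invertible
  exact ⟨IsUnit.inv_matrix hb.1,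
    fun i j h => Matrix.blockTriangular_inv_of_blockTriangular hb.blockTriangular h⟩

lemma IsBorel.mul {n : ℕ} {b c : Matrix (Fin n) (Fin n) E} (hb : IsBorel b) (hc : IsBorel c) :
    IsBorel (b * c) :=
  ⟨hb.1.mul hc.1, fun _ _ h => hb.blockTriangular.mul hc.blockTriangular h⟩

lemma IsBorel.diag_ne_zero {n : ℕ} {b : Matrix (Fin n) (Fin n) E} (hb : IsBorel b) (i : Fin n) :
    b i i ≠ 0 := by
  have h := (Matrix.isUnit_iff_isUnit_det b).1 hb.1
  rw [Matrix.det_of_isUpperTriangular hb.blockTriangular, isUnit_iff_ne_zero,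
    Finset.prod_ne_zero_iff] at h
  exact h i (Finset.mem_univ i)

/-- The coordinate projection onto the indices `≥ i`. -/
def upperProj (E : Type*) [Field E] (n i : ℕ) : Matrix (Fin n) (Fin n) E :=
  Matrix.diagonal fun j => if i ≤ (j : ℕ) then 1 else 0

lemma upperProj_mul_self {n i : ℕ} : upperProj E n i * upperProj E n i = upperProj E n i := by
  simp [upperProj, Matrix.diagonal_mul_diagonal]

lemma upperProj_mul_upper {n i : ℕ} {b : Matrix (Fin n) (Fin n) E} (hb : b.BlockTriangular id) :
    upperProj E n i * b * upperProj E n i = upperProj E n i * b := by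
  ext p q
  simp only [upperProj, Matrix.mul_diagonal, Matrix.diagonal_mul]
  by_cases hp : i ≤ (p : ℕ) <;> by_cases hq : i ≤ (q : ℕ) <;> simp [hp, hq]
  rw [eq_comm]
  exact hb (show q < p by rw [Fin.lt_def]; omega)

lemma lower_mul_upperProj {n i : ℕ} {Y : Matrix (Fin n) (Fin n) E} (hY : Y.BlockTriangular id) :
    w0Mat E n * Y * w0Mat E n * upperProj E n i =
      upperProj E n i * (w0Mat E n * Y * w0Mat E n) * upperProj E n i := by
  ext p q
  simp only [upperProj, Matrix.mul_diagonal, Matrix.diagonal_mul, w0Mat_mul_mul_apply]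
  by_cases hp : i ≤ (p : ℕ) <;> by_cases hq : i ≤ (q : ℕ) <;> simp [hp, hq]
  exact hY (show q.rev < p.rev by rw [Fin.lt_def, Fin.val_rev, Fin.val_rev]; omega)

/-- A projection along the span of the first `i` vectors lies in `τ_J` if `J` has a block
boundary at `i`. -/
lemma mem_tauSetJ {n i : ℕ} {J : Set ℕ} (hJ : ∀ k, k + 1 = i → k ∉ J)
    {Q : Matrix (Fin n) (Fin n) E} (h1 : upperProj E n i * Q = upperProj E n i)
    (h2 : Q * upperProj E n i = Q) : Q ∈ tauSetJ E J := by
  have hsep : ∀ p q : Fin n, (p : ℕ) < i → i ≤ (q : ℕ) → ¬ SameBlock J p q := by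
    intro p q hp hq hs
    exact hJ (i - 1) (by omega) (hs (i - 1) (by omega) (by omega))
  have hsymm : ∀ p q : Fin n, SameBlock J p q → SameBlock J q p := by
    intro p q h k hk hk'
    exact h k (by rwa [min_comm]) (by rwa [max_comm])
  refine ⟨upperProj E n i, ⟨?_, ?_⟩, Q - upperProj E n i, ?_, by abel⟩
  · intro p q hpq; simp [upperProj, hpq]
  · intro p q hpq
    simp only [upperProj, Matrix.diagonal_apply_eq]
    by_cases hp : i ≤ (p : ℕ) <;> by_cases hq : i ≤ (q : ℕ) <;> simp [hp, hq]
    · exact hsep q p (by omega) hp (hsymm _ _ hpq)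
    · exact hsep p q (by omega) hq hpq
  · intro p q hpq
    have e1 := congrFun (congrFun h1 p) q
    have e2 := congrFun (congrFun h2 p) q
    rw [upperProj, Matrix.diagonal_mul] at e1
    rw [upperProj, Matrix.mul_diagonal] at e2
    rw [Matrix.sub_apply, upperProj]
    by_cases hp : i ≤ (p : ℕ)
    · simpa [hp, sub_eq_zero] using e1
    · by_cases hq : i ≤ (q : ℕ)
      · exact absurd ⟨by omega, hsep p q (by omega) hq⟩ hpq
      · have : p ≠ q ∨ p = q := ne_or_eq p q
        simp only [hq, if_false, mul_zero] at e2
        rw [← e2]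
        rcases this with h | rfl
        · simp [h]
        · simp [hp]

lemma upperProj_permMat {n i : ℕ} {u : Equiv.Perm (Fin n)}
    (hu : ∀ j, i ≤ (u j : ℕ) ↔ i ≤ (j : ℕ)) :
    upperProj E n i * permMat E u = permMat E u * upperProj E n i := by
  ext p q
  rw [upperProj, Matrix.mul_diagonal, Matrix.diagonal_mul]
  by_cases h : p = u q
  · subst h; simp [permMat, hu]
  · simp [permMat, h]

/-- If two different elements of `W_n^{S₀}` have the same initial segment of length `i`, at
which both have a block boundary, then `K(g)` determines the step `F_{n-i}` of the flag of `g`. -/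
lemma flag_step_eq {n i : ℕ} {S0 : Set ℕ} {g g' : Matrix (Fin n) (Fin n) E}
    (hg : NonCritical S0 g) (hg' : NonCritical S0 g') (hK : Kset S0 g = Kset S0 g')
    {u v : Equiv.Perm (Fin n)} (hu : WminRep S0 u) (hv : WminRep S0 v) (huv : u ≠ v)
    (hcu : ∀ k, k + 1 = i → k ∉ S0ofu S0 u) (hcv : ∀ k, k + 1 = i → k ∉ S0ofu S0 v)
    (hi : ∀ j, i ≤ (u j : ℕ) ↔ i ≤ (v j : ℕ)) {j l : Fin n}
    (hj : (j.rev : ℕ) < i) (hl : i ≤ (l.rev : ℕ)) : (g⁻¹ * g') j l = 0 := by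
  obtain ⟨β, β', hβ, hβ', hd⟩ := hg.2 u hu
  obtain ⟨γ, γ', hγ, hγ', hd'⟩ := hg'.2 u hu
  set D := upperProj E n i with hD
  set w := w0Mat E n with hw
  set U := permMat E u with hU
  have hUu : IsUnit U := isUnit_permMat u
  have hww : w * w = 1 := w0Mat_mul_self
  set Q := β * D * β⁻¹ with hQ
  have hββ := unit_mul_inv hβ.1
  have hββ' := unit_inv_mul hβ.1
  have hUU := unit_mul_inv hUu
  have hUU' := unit_inv_mul hUu
  have hDβ : D * β * D = D * β := upperProj_mul_upper hβ.blockTriangular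
  have hDβi : D * β⁻¹ * D = D * β⁻¹ := upperProj_mul_upper hβ.inv.blockTriangular
  have hDD : D * D = D := upperProj_mul_self
  have hQ1 : D * Q = D := by
    rw [hQ, ← mul_assoc, ← mul_assoc, hDβ, mul_assoc, hββ, mul_one]
  have hQ2 : Q * D = Q := by
    rw [hQ, mul_assoc, mul_assoc, ← mul_assoc D, hDβi, ← mul_assoc]
  set P := U⁻¹ * Q * U with hP
  have hPu : P ∈ AdSet U⁻¹ (tauSetJ E (S0ofu S0 u)) := by
    refine ⟨Q, mem_tauSetJ hcu hQ1 hQ2, ?_⟩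
    simp only [hP, hU, permMat_inv, inv_inv]
  have hPv : P ∈ AdSet (permMat E v)⁻¹ (tauSetJ E (S0ofu S0 v)) := by
    set s := permMat E (v * u⁻¹) with hs
    have hcomm : D * s = s * D := by
      apply upperProj_permMat
      intro j
      have := hi (u⁻¹ j)
      simpa using this.symm
    have hss : s * s⁻¹ = 1 := unit_mul_inv (isUnit_permMat _)
    have hss' : s⁻¹ * s = 1 := unit_inv_mul (isUnit_permMat _)
    have hcomm' : D * s⁻¹ = s⁻¹ * D := by
      calc D * s⁻¹ = s⁻¹ * (s * D) * s⁻¹ := by rw [← mul_assoc s⁻¹, hss', one_mul]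
        _ = s⁻¹ * D := by rw [← hcomm, mul_assoc, mul_assoc, hss, mul_one]
    refine ⟨s * Q * s⁻¹, mem_tauSetJ hcv ?_ ?_, ?_⟩
    · change D * (s * Q * s⁻¹) = D
      rw [← mul_assoc, ← mul_assoc, hcomm, mul_assoc s, hQ1, ← hcomm, mul_assoc, hss, mul_one]
    · change (s * Q * s⁻¹) * D = _
      rw [mul_assoc, ← hcomm', ← mul_assoc, mul_assoc s, hQ2]
    · change (permMat E v)⁻¹ * (s * Q * s⁻¹) * ((permMat E v)⁻¹)⁻¹ = P
      have e1 : (permMat E v)⁻¹ * s = U⁻¹ := by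
        rw [permMat_inv, hs, permMat_mul, hU, permMat_inv]; congr 1; group
      have e2 : s⁻¹ * permMat E v = U := by
        rw [hs, permMat_inv, permMat_mul, hU]; congr 1; group
      rw [Matrix.nonsing_inv_nonsing_inv _
        ((Matrix.isUnit_iff_isUnit_det _).1 (isUnit_permMat v)), hP, ← e1, ← e2]
      noncomm_ring
  have hcan : ∀ {x y : Matrix (Fin n) (Fin n) E}, x * y = 1 → ∀ t, x * (y * t) = t :=
    fun h t => by rw [← mul_assoc, h, one_mul]
  have c2 := hcan hββ'
  have c3 := hcan hUU
  have c4 := hcan hUU'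
  have c5 := hcan hww
  have c6 := hcan (unit_mul_inv hγ.1)
  have c7 := hcan (unit_inv_mul hγ.1)
  have c10 := hcan (unit_mul_inv hγ'.1)
  have hγγ := unit_mul_inv hγ.1
  have hγγ' := unit_inv_mul hγ.1
  have hb := unit_mul_inv hβ'.1
  have hc := unit_mul_inv hγ'.1
  have hgU : g = U⁻¹ * (β * (w * β')) := by
    rw [← mul_assoc β, ← hd, c4]
  have hgU' : g' = U⁻¹ * (γ * (w * γ')) := by
    rw [← mul_assoc γ, ← hd', c4]
  have hgi : g⁻¹ = β'⁻¹ * (w * (β⁻¹ * U)) := Matrix.inv_eq_left_inv (by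
    rw [hgU]; simp only [mul_assoc, c2, c3, c5, unit_inv_mul hβ'.1])
  have hgi' : g'⁻¹ = γ'⁻¹ * (w * (γ⁻¹ * U)) := Matrix.inv_eq_left_inv (by
    rw [hgU']; simp only [mul_assoc, c7, c3, c5, unit_inv_mul hγ'.1])
  have hDtri : (w * D * w).BlockTriangular id := by
    intro p q hpq
    rw [w0Mat_mul_mul_apply, hD, upperProj, Matrix.diagonal_apply_ne]
    intro h
    exact (ne_of_lt hpq) (Fin.rev_injective h).symm
  have hPg : P ∈ AdSet g (bSet E n) := by
    rw [mem_AdSet hg.1]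
    have : g⁻¹ * P * g = β'⁻¹ * (w * D * w) * β' := by
      rw [hgi, hP, hQ, hgU]
      simp only [mul_assoc, c2, c3]
    rw [this]
    exact fun p q hpq =>
      (hβ'.inv.blockTriangular.mul hDtri).mul hβ'.blockTriangular hpq
  have hX : (Pi.single u P - Pi.single v P :
      Equiv.Perm (Fin n) → Matrix (Fin n) (Fin n) E) ∈ Kset S0 g := by
    have h0 : ∀ x, WminRep S0 x → (0 : Matrix (Fin n) (Fin n) E) ∈
        AdSet (permMat E x)⁻¹ (tauSetJ E (S0ofu S0 x)) ∩ AdSet g (bSet E n) := by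
      intro x _
      refine ⟨⟨0, ⟨0, ⟨?_, ?_⟩, 0, ?_, ?_⟩, ?_⟩, ⟨0, ?_, ?_⟩⟩ <;> simp [nSetJ, bSet]
    have hneg : ∀ (h : Matrix (Fin n) (Fin n) E) (J : Set ℕ) (X : Matrix (Fin n) (Fin n) E),
        X ∈ AdSet h (tauSetJ E J) → -X ∈ AdSet h (tauSetJ E J) := by
      rintro h J _ ⟨_, ⟨a, ⟨ha, ha'⟩, b, hb, rfl⟩, rfl⟩
      refine ⟨-(a + b), ⟨-a, ⟨?_, ?_⟩, -b, ?_, ?_⟩, ?_⟩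
      · intro p q hpq; simp [ha p q hpq]
      · intro p q hpq; simp [ha' p q hpq]
      · intro p q hpq; simp [hb p q hpq]
      · abel
      · simp only [mul_neg, neg_mul]
    have hneg' : -P ∈ AdSet g (bSet E n) := by
      obtain ⟨Y, hY, hYP⟩ := hPg
      exact ⟨-Y, fun p q hpq => by simp [hY p q hpq], by rw [← hYP]; simp⟩
    refine ⟨?_, ?_, ?_⟩
    · intro x hx
      by_cases hxu : x = u
      · subst hxu; simpa [huv] using ⟨hPu, hPg⟩
      · by_cases hxv : x = v
        · subst hxv; simpa [hxu] using ⟨hneg _ _ _ hPv, hneg'⟩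
        · simpa [hxu, hxv] using h0 x hx
    · intro x hx
      have h1 : x ≠ u := by rintro rfl; exact hx hu
      have h2 : x ≠ v := by rintro rfl; exact hx hv
      simp [h1, h2]
    · simp [Finset.sum_sub_distrib]
  have hPg' : g'⁻¹ * P * g' ∈ bSet E n := by
    rw [hK] at hX
    have := (hX.1 u hu).2
    rw [mem_AdSet hg'.1] at this
    simpa [huv] using this
  have hYtri : (γ' * (g'⁻¹ * P * g') * γ'⁻¹).BlockTriangular id :=
    (hγ'.blockTriangular.mul fun p q hpq => hPg' p q hpq).mul hγ'.inv.blockTriangular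
  have hlow := lower_mul_upperProj (i := i) hYtri
  have hQ' : w * (γ' * (g'⁻¹ * P * g') * γ'⁻¹) * w = γ⁻¹ * Q * γ := by
    rw [hgi', hP, hgU']
    simp only [mul_assoc, c3, c5, c10, hc, mul_one, hww]
  rw [← hw, ← hD, hQ'] at hlow
  have hDγ : D * γ * D = D * γ := upperProj_mul_upper hγ.blockTriangular
  have hDγi : D * γ⁻¹ * D = D * γ⁻¹ := upperProj_mul_upper hγ.inv.blockTriangular
  have hQ1' : D * (γ⁻¹ * Q * γ) = D := by
    calc D * (γ⁻¹ * Q * γ) = (D * γ⁻¹) * Q * γ := by simp only [mul_assoc]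
      _ = D * γ⁻¹ * (D * Q) * γ := by rw [← mul_assoc (D * γ⁻¹) D Q, hDγi]
      _ = D := by rw [hQ1, hDγi, mul_assoc, hγγ', mul_one]
  have hQ2' : (γ⁻¹ * Q * γ) * D = γ⁻¹ * Q * γ := by
    calc (γ⁻¹ * Q * γ) * D = γ⁻¹ * (Q * D) * γ * D := by rw [hQ2]
      _ = γ⁻¹ * Q * (D * γ * D) := by simp only [mul_assoc]
      _ = γ⁻¹ * (Q * D) * γ := by rw [hDγ]; simp only [mul_assoc]
      _ = _ := by rw [hQ2]
  have hQD : γ⁻¹ * Q * γ = D := by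
    rw [← hQ2', hlow, hQ1', hDD]
  have hQγ : Q = γ * D * γ⁻¹ := by
    rw [← hQD]; simp only [mul_assoc, c6, hγγ, mul_one]
  have hβγ : D * (β⁻¹ * γ) = β⁻¹ * γ * D := by
    have h1 : β⁻¹ * Q * γ = D * (β⁻¹ * γ) := by rw [hQ]; simp only [mul_assoc, c2]
    have h2 : β⁻¹ * Q * γ = β⁻¹ * γ * D := by
      rw [hQγ]; simp only [mul_assoc, hγγ', mul_one]
    rw [← h1, h2]
  have hblock : (w * (β⁻¹ * γ) * w).BlockTriangular
      (fun j : Fin n => if i ≤ (j.rev : ℕ) then (0 : ℕ) else 1) := by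
    intro p q hpq
    have hq : i ≤ (q.rev : ℕ) := by
      by_contra h; simp only [if_neg h] at hpq; split_ifs at hpq <;> omega
    have hp : ¬ i ≤ (p.rev : ℕ) := by
      intro h; simp only [if_pos h] at hpq; omega
    rw [w0Mat_mul_mul_apply]
    have := congrFun (congrFun hβγ p.rev) q.rev
    rw [hD, upperProj, Matrix.mul_diagonal, Matrix.diagonal_mul] at this
    simpa only [if_neg hp, if_pos hq, zero_mul, mul_one] using this.symm
  have hmono : ∀ b : Matrix (Fin n) (Fin n) E, b.BlockTriangular id →
      b.BlockTriangular (fun j : Fin n => if i ≤ (j.rev : ℕ) then (0 : ℕ) else 1) := by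
    intro b hb p q hpq
    refine hb (show q < p from ?_)
    by_contra h
    rw [not_lt, Fin.le_def] at h
    simp only [Fin.val_rev] at hpq
    split_ifs at hpq <;> omega
  have hfin : g⁻¹ * g' = β'⁻¹ * (w * (β⁻¹ * γ) * w) * γ' := by
    rw [hgi, hgU']; simp only [mul_assoc, c3]
  rw [hfin]
  refine ((hmono _ hβ'.inv.blockTriangular).mul hblock).mul (hmono _ hγ'.blockTriangular) ?_
  simp only [if_pos hl, if_neg (not_le.2 hj), zero_lt_one]

/-- A permutation given by a formula on natural numbers, together with the translation of the
conditions defining `W_n^{S₀}` and a block boundary at `i`. -/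
lemma exists_perm {n i : ℕ} {S0 : Set ℕ} (f : ℕ → ℕ) (hlt : ∀ j < n, f j < n)
    (hinj : ∀ j < n, ∀ l < n, f j = f l → j = l)
    (hmin : ∀ j, j + 1 < n → j ∈ S0 → f j < f (j + 1))
    (hcut : ∀ j, j + 1 < n → j ∈ S0 → f (j + 1) = f j + 1 → f (j + 1) ≠ i) :
    ∃ u : Equiv.Perm (Fin n), (∀ j, (u j : ℕ) = f j) ∧ WminRep S0 u ∧
      ∀ k, k + 1 = i → k ∉ S0ofu S0 u := by
  have hF : Function.Injective (fun j : Fin n => (⟨f j, hlt j j.2⟩ : Fin n)) := by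
    intro j l h
    exact Fin.ext (hinj _ j.2 _ l.2 (by simpa using h))
  refine ⟨Equiv.ofBijective _ (Finite.injective_iff_bijective.1 hF), fun j => rfl, ?_, ?_⟩
  · intro j l hjl hj
    have := hmin j (hjl ▸ l.2) hj
    rw [← hjl] at this
    exact this
  · rintro k hk ⟨a, b, ha, hb, hab, haS⟩
    set u := Equiv.ofBijective _ (Finite.injective_iff_bijective.1 hF) with hu
    have hua : f (u.symm a) = a := congrArg Fin.val (u.apply_symm_apply a)
    have hub : f (u.symm b) = b := congrArg Fin.val (u.apply_symm_apply b)
    have hlt' := (u.symm b).2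
    rw [hab] at hub hlt'
    exact hcut _ hlt' haS (by omega) (by omega)

/-- If `Δ ∖ S₀` contains an index which is neither the first nor the last one, or both the first
and the last one (and these differ), then every step of the flag is detected by two different
elements of `W_n^{S₀}`. -/
lemma exists_pair {n c i : ℕ} {S0 : Set ℕ} (hc : c ∉ S0)
    (h : (1 ≤ c ∧ c + 3 ≤ n) ∨ (c = 0 ∧ 3 ≤ n ∧ n - 2 ∉ S0)) (hi : 1 ≤ i) (hin : i < n) :
    ∃ u v : Equiv.Perm (Fin n), WminRep S0 u ∧ WminRep S0 v ∧ u ≠ v ∧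
      (∀ k, k + 1 = i → k ∉ S0ofu S0 u) ∧ (∀ k, k + 1 = i → k ∉ S0ofu S0 v) ∧
      ∀ j, i ≤ (u j : ℕ) ↔ i ≤ (v j : ℕ) := by
  suffices H : ∃ f f' : ℕ → ℕ, (∀ j < n, f j < n) ∧ (∀ j < n, f' j < n) ∧
      (∀ j < n, ∀ l < n, f j = f l → j = l) ∧ (∀ j < n, ∀ l < n, f' j = f' l → j = l) ∧
      (∀ j, j + 1 < n → j ∈ S0 → f j < f (j + 1) ∧ (f (j + 1) = f j + 1 → f (j + 1) ≠ i)) ∧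
      (∀ j, j + 1 < n → j ∈ S0 → f' j < f' (j + 1) ∧
        (f' (j + 1) = f' j + 1 → f' (j + 1) ≠ i)) ∧
      (∃ j < n, f j ≠ f' j) ∧ ∀ j < n, (i ≤ f j ↔ i ≤ f' j) by
    obtain ⟨f, f', h1, h1', h2, h2', h3, h3', ⟨j, hj, hne⟩, h4⟩ := H
    obtain ⟨u, hu, huW, huc⟩ := exists_perm (i := i) f h1 h2
      (fun j hj hS => (h3 j hj hS).1) (fun j hj hS => (h3 j hj hS).2)
    obtain ⟨v, hv, hvW, hvc⟩ := exists_perm (i := i) f' h1' h2'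
      (fun j hj hS => (h3' j hj hS).1) (fun j hj hS => (h3' j hj hS).2)
    refine ⟨u, v, huW, hvW, ?_, huc, hvc, fun j => by rw [hu, hv]; exact h4 j j.2⟩
    rintro rfl
    exact hne ((hu ⟨j, hj⟩).symm.trans (hv ⟨j, hj⟩))
  have key : ∀ {j d : ℕ}, d ∉ S0 → j ∈ S0 → j ≠ d := fun hd hj h => hd (h ▸ hj)
  rcases h with ⟨h1, h3⟩ | ⟨rfl, h3, hn⟩
  · by_cases hi1 : i = 1
    · subst hi1
      refine ⟨fun j => if j < 1 then j else if j ≤ c then j + (n - c - 1) else j - c,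
        fun j => if j < 1 then j else if j ≤ c then j + 1 else if j = c + 1 then 1 else j,
        ?_, ?_, ?_, ?_, ?_, ?_, ⟨1, ?_⟩, ?_⟩
      · intro j hj; dsimp only; split_ifs <;> omega
      · intro j hj; dsimp only; split_ifs <;> omega
      · intro j hj l hl; dsimp only; split_ifs <;> omega
      · intro j hj l hl; dsimp only; split_ifs <;> omega
      · intro j hj hS; have := key hc hS; dsimp only; split_ifs <;> omega
      · intro j hj hS; have := key hc hS; dsimp only; split_ifs <;> omega
      · dsimp only; split_ifs <;> omega
      · intro j hj; dsimp only; split_ifs <;> omega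
    · by_cases hi2 : i = n - 1
      · subst hi2
        refine ⟨fun j => if j ≤ c then j + (n - c - 2) else if j < n - 1 then j - (c + 1) else j,
          fun j => if j < c then j else if j = c then n - 2 else if j < n - 1 then j - 1 else j,
          ?_, ?_, ?_, ?_, ?_, ?_, ⟨0, ?_⟩, ?_⟩
        · intro j hj; dsimp only; split_ifs <;> omega
        · intro j hj; dsimp only; split_ifs <;> omega
        · intro j hj l hl; dsimp only; split_ifs <;> omega
        · intro j hj l hl; dsimp only; split_ifs <;> omega
        · intro j hj hS; have := key hc hS; dsimp only; split_ifs <;> omega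
        · intro j hj hS; have := key hc hS; dsimp only; split_ifs <;> omega
        · dsimp only; split_ifs <;> omega
        · intro j hj; dsimp only; split_ifs <;> omega
      · obtain ⟨a, b, ha, hac, hb, hbc, rfl⟩ :
            ∃ a b, 1 ≤ a ∧ a ≤ c ∧ 1 ≤ b ∧ c + b + 2 ≤ n ∧ i = a + b := by
          by_cases hic : i ≤ c + 1
          · exact ⟨i - 1, 1, by omega, by omega, le_rfl, by omega, by omega⟩
          · exact ⟨c, i - c, by omega, le_rfl, by omega, by omega, by omega⟩
        refine ⟨fun j => if j < a then j + b else if j ≤ c then j + (n - c - 1) else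
            if j < c + 1 + b then j - (c + 1) else j - (c + 1) + a,
          fun j => if j < a then j else if j ≤ c then j + b else
            if j < c + 1 + b then j - (c + 1) + a else j,
          ?_, ?_, ?_, ?_, ?_, ?_, ⟨0, ?_⟩, ?_⟩
        · intro j hj; dsimp only; split_ifs <;> omega
        · intro j hj; dsimp only; split_ifs <;> omega
        · intro j hj l hl; dsimp only; split_ifs <;> omega
        · intro j hj l hl; dsimp only; split_ifs <;> omega
        · intro j hj hS; have := key hc hS; dsimp only; split_ifs <;> omega
        · intro j hj hS; have := key hc hS; dsimp only; split_ifs <;> omega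
        · dsimp only; split_ifs <;> omega
        · intro j hj; dsimp only; split_ifs <;> omega
  · by_cases hi2 : i = n - 1
    · subst hi2
      refine ⟨fun j => if j = 0 then n - 2 else if j < n - 1 then j - 1 else j, fun j => j,
        ?_, ?_, ?_, ?_, ?_, ?_, ⟨0, ?_⟩, ?_⟩
      · intro j hj; dsimp only; split_ifs <;> omega
      · intro j hj; exact hj
      · intro j hj l hl; dsimp only; split_ifs <;> omega
      · intro j hj l hl; exact id
      · intro j hj hS; have := key hc hS; dsimp only; split_ifs <;> omega
      · intro j hj hS; have := key hn hS; dsimp only; omega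
      · dsimp only; split_ifs <;> omega
      · intro j hj; dsimp only; split_ifs <;> omega
    · refine ⟨fun j => if j = 0 then i - 1 else if j < i then j - 1 else j,
        fun j => if j = 0 then i - 1 else if j < i then j - 1 else if j < n - 1 then j + 1 else i,
        ?_, ?_, ?_, ?_, ?_, ?_, ⟨n - 1, ?_⟩, ?_⟩
      · intro j hj; dsimp only; split_ifs <;> omega
      · intro j hj; dsimp only; split_ifs <;> omega
      · intro j hj l hl; dsimp only; split_ifs <;> omega
      · intro j hj l hl; dsimp only; split_ifs <;> omega
      · intro j hj hS; have := key hc hS; dsimp only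
        refine ⟨?_, ?_⟩ <;> split_ifs <;> intros <;> first | contradiction | omega
      · intro j hj hS; have := key hc hS; have := key hn hS; dsimp only
        refine ⟨?_, ?_⟩ <;> split_ifs <;> intros <;> first | contradiction | omega
      · dsimp only; split_ifs <;> omega
      · intro j hj; dsimp only; split_ifs <;> omega

lemma mul_single_mul_apply {n : ℕ} (A B : Matrix (Fin n) (Fin n) E) (i j k l : Fin n) :
    (A * Matrix.single i j (1 : E) * B) k l = A k i * B j l := by
  rw [Matrix.mul_apply, Finset.sum_eq_single j]
  · simp
  · intro b _ hb
    simp [Matrix.mul_single_apply_of_ne (hbj := hb)]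
  · simp

lemma single_mem_bSet {n : ℕ} {i j : Fin n} (hij : i ≤ j) :
    Matrix.single i j (1 : E) ∈ bSet E n := by
  intro p q hqp
  rw [Matrix.single_apply, if_neg]
  rintro ⟨rfl, rfl⟩
  exact absurd hij (not_le.2 hqp)

/-- A criterion for an invertible matrix to be upper triangular. -/
lemma IsBorel.of_vanishing {n : ℕ} {M h : Matrix (Fin n) (Fin n) E} (hMh : M * h = 1)
    (H : ∀ j l, l < j → h j l = 0 ∨ ∀ k i, l < k → i ≤ j → M k i = 0) : IsBorel h := by
  have hhM : h * M = 1 := mul_eq_one_comm.1 hMh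
  refine ⟨IsUnit.of_mul_eq_one M hhM, fun j l hlj => (H j l hlj).elim id fun hM => ?_⟩
  have htri : M.BlockTriangular (fun x : Fin n => if x ≤ l then (0 : ℕ) else 1) := by
    intro p q hpq
    have hq : q ≤ l := by
      by_contra hq
      simp only [if_neg hq] at hpq
      split_ifs at hpq <;> omega
    have hp : ¬ p ≤ l := by
      intro hp
      simp only [if_pos hp] at hpq
      omega
    exact hM p q (not_le.1 hp) (hq.trans hlj.le)
  have := (IsUnit.of_mul_eq_one h hMh).invertible
  have hinv := Matrix.blockTriangular_inv_of_blockTriangular htri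
  rw [Matrix.inv_eq_right_inv hMh] at hinv
  exact hinv (by simp [not_le.2 hlj])

lemma commute_of_mem_zSetJ {n : ℕ} {J : Set ℕ} {z X : Matrix (Fin n) (Fin n) E}
    (hz : z ∈ zSetJ E J) (hX : X ∈ lSetJ E J) : z * X = X * z := by
  have hd : z = Matrix.diagonal fun i => z i i := by
    ext p q
    by_cases h : p = q
    · simp [h]
    · simp [h, hz.1 p q h]
  rw [hd]
  ext p q
  rw [Matrix.diagonal_mul, Matrix.mul_diagonal]
  by_cases h : SameBlock J p q
  · rw [hz.2 p q h, mul_comm]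
  · simp [hX p q h]

lemma bSet_conj_iff {n : ℕ} {b Y : Matrix (Fin n) (Fin n) E} (hb : IsBorel b) :
    b⁻¹ * Y * b ∈ bSet E n ↔ Y ∈ bSet E n := by
  constructor
  · intro h
    have e : b * (b⁻¹ * Y * b) * b⁻¹ = (b * b⁻¹) * Y * (b * b⁻¹) := by noncomm_ring
    rw [unit_mul_inv hb.1, one_mul, mul_one] at e
    rw [← e]
    exact fun p q hpq => (hb.blockTriangular.mul fun p q hpq => h p q hpq).mul
      hb.inv.blockTriangular hpq
  · intro h
    exact fun p q hpq => (hb.inv.blockTriangular.mul fun p q hpq => h p q hpq).mul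
      hb.blockTriangular hpq

/-- The Levi condition at `u = 1`: an element of `𝔩_{S₀}` stabilizing the flag of `g` stabilizes
the flag of `g'`. -/
lemma levi_le {n : ℕ} {S0 : Set ℕ} (hS0 : ∀ i ∈ S0, i + 1 < n)
    {g g' : Matrix (Fin n) (Fin n) E} (hg : IsUnit g) (hg' : IsUnit g')
    (hLevi : ∀ u : Equiv.Perm (Fin n), WminRep S0 u →
      ∃ zu : Matrix (Fin n) (Fin n) E, IsUnit zu ∧ zu ∈ zSetJ E (S0ofu S0 u) ∧
        lSetJ E (S0ofu S0 u) ∩ AdSet (permMat E u * g') (bSet E n) =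
          AdSet zu (lSetJ E (S0ofu S0 u) ∩ AdSet (permMat E u * g) (bSet E n)))
    {X : Matrix (Fin n) (Fin n) E} (hX : X ∈ lSetJ E S0) (hXg : g⁻¹ * X * g ∈ bSet E n) :
    g'⁻¹ * X * g' ∈ bSet E n := by
  have h1 : S0ofu S0 (1 : Equiv.Perm (Fin n)) = S0 := by
    ext k
    constructor
    · rintro ⟨a, _, ha, -, -, h⟩
      exact ha ▸ h
    · intro hk
      have := hS0 k hk
      exact ⟨⟨k, by omega⟩, ⟨k + 1, this⟩, rfl, rfl, rfl, hk⟩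
  obtain ⟨z, hzu, hz, hzeq⟩ := hLevi 1 fun i j hij _ => by
    rw [Equiv.Perm.one_apply, Equiv.Perm.one_apply, Fin.lt_def]; omega
  rw [h1] at hz hzeq
  rw [permMat_one, one_mul, one_mul] at hzeq
  have hmem : X ∈ AdSet z (lSetJ E S0 ∩ AdSet g (bSet E n)) := by
    rw [mem_AdSet hzu, mul_assoc, ← commute_of_mem_zSetJ hz hX, ← mul_assoc,
      unit_inv_mul hzu, one_mul]
    exact ⟨hX, (mem_AdSet hg).2 hXg⟩
  rw [← hzeq] at hmem
  exact (mem_AdSet hg').1 hmem.2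

/-- The diagonal matrix with entry `t` at `a` and `1` elsewhere. -/
def diagAt {n : ℕ} (a : Fin n) (t : E) : Matrix (Fin n) (Fin n) E :=
  Matrix.diagonal fun p => if p = a then t else 1

lemma diagAt_mul_inv {n : ℕ} (a : Fin n) {t : E} (ht : t ≠ 0) :
    diagAt a t * diagAt a t⁻¹ = 1 := by
  rw [diagAt, diagAt, Matrix.diagonal_mul_diagonal, ← Matrix.diagonal_one]
  congr 1
  ext p
  split_ifs <;> simp [ht]

lemma diagAt_comm {n : ℕ} {a : Fin n} (t : E) {X : Matrix (Fin n) (Fin n) E}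
    (hX : ∀ p, p ≠ a → X a p = 0 ∧ X p a = 0) : diagAt a t * X = X * diagAt a t := by
  ext p q
  rw [diagAt, Matrix.diagonal_mul, Matrix.mul_diagonal]
  by_cases hp : p = a <;> by_cases hq : q = a
  · simp [hp, hq, mul_comm]
  · simp [hp, hX q hq]
  · simp [hq, hX p hp]
  · simp [hp, hq]

/-- The normal form of an invertible matrix under right multiplication by `B`. -/
lemma exists_normal_form {n : ℕ} {o L a : Fin n} (ho : ∀ i, o ≤ i) (hL : ∀ i, i ≤ L)
    (hoL : o ≠ L) {g : Matrix (Fin n) (Fin n) E} (hg : IsUnit g) (h1 : g a o ≠ 0)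
    (h2 : g⁻¹ L a ≠ 0) :
    ∃ b : Matrix (Fin n) (Fin n) E, IsBorel b ∧ (∀ j, (g * b) a j = if j = o then 1 else 0) ∧
      ∀ i, (g * b) i o - (g * b) i L = if i = a then 1 else 0 := by
  set b : Matrix (Fin n) (Fin n) E := Matrix.of fun i j =>
    if j = o then (if i = o then (g a o)⁻¹ else 0)
    else if j = L then (if i = o then (g a o)⁻¹ else 0) - g⁻¹ i a
    else (if i = j then 1 else 0) - (if i = o then g a j / g a o else 0) with hb
  have hgg : ∀ i, ∑ k, g i k * g⁻¹ k a = if i = a then 1 else 0 := fun i => by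
    rw [← Matrix.mul_apply, unit_mul_inv hg, Matrix.one_apply]
  have hgb : ∀ i j, (g * b) i j = if j = o then g i o * (g a o)⁻¹
      else if j = L then g i o * (g a o)⁻¹ - (if i = a then 1 else 0)
      else g i j - g i o * (g a j / g a o) := by
    intro i j
    rw [Matrix.mul_apply]
    simp only [hb, Matrix.of_apply]
    split_ifs with h h' h''
    all_goals simp [mul_sub, Finset.sum_sub_distrib, *]
  have htri : b.BlockTriangular id := by
    intro i j hij
    have hio : i ≠ o := fun h => absurd (ho j) (by rw [← h]; exact not_le.2 hij)
    have hjL : j ≠ L := fun h => absurd (hL i) (by rw [← h]; exact not_le.2 hij)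
    have hne : i ≠ j := ne_of_gt hij
    simp [hb, hio, hjL, hne]
  refine ⟨b, ⟨?_, fun i j hij => htri hij⟩, ?_, ?_⟩
  · rw [Matrix.isUnit_iff_isUnit_det, Matrix.det_of_isUpperTriangular htri, isUnit_iff_ne_zero,
      Finset.prod_ne_zero_iff]
    intro i _
    by_cases hio : i = o
    · simp [hb, hio, h1]
    · by_cases hiL : i = L
      · subst hiL
        simp [hb, hio, h2]
      · simp [hb, hio, hiL]
  · intro j
    rw [hgb]
    split_ifs <;> first | contradiction | (field_simp; try simp)
  · intro i
    rw [hgb, hgb]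
    simp [hoL.symm]

/-- The case of a Levi with a one-element block `{a}`, for matrices in normal form. -/
lemma exists_diagAt_of_normal_form {n : ℕ} {o L a : Fin n} (ho : ∀ i, o ≤ i) (hL : ∀ i, i ≤ L)
    (hoL : o ≠ L) {G G' : Matrix (Fin n) (Fin n) E} (hG : IsUnit G) (hG' : IsUnit G')
    (hrow : ∀ j, G a j = if j = o then 1 else 0) (hrow' : ∀ j, G' a j = if j = o then 1 else 0)
    (hcol : ∀ i, G i o - G i L = if i = a then 1 else 0)
    (hcol' : ∀ i, G' i o - G' i L = if i = a then 1 else 0)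
    (hlevi : ∀ X : Matrix (Fin n) (Fin n) E, (∀ p, p ≠ a → X a p = 0 ∧ X p a = 0) →
      G⁻¹ * X * G ∈ bSet E n → G'⁻¹ * X * G' ∈ bSet E n) :
    ∃ t : E, t ≠ 0 ∧ IsBorel (G⁻¹ * (diagAt a t * G')) := by
  have hPG := unit_inv_mul hG
  have hGP := unit_mul_inv hG
  have hPG' := unit_inv_mul hG'
  have hGP' := unit_mul_inv hG'
  have hinvrow : ∀ {A : Matrix (Fin n) (Fin n) E}, IsUnit A →
      (∀ j, A a j = if j = o then 1 else 0) → ∀ k, A⁻¹ o k = if k = a then 1 else 0 := by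
    intro A hA h k
    have := congrFun (congrFun (unit_mul_inv hA) a) k
    rw [Matrix.mul_apply] at this
    simpa [h, Matrix.one_apply, eq_comm] using this
  have hmulcol : ∀ {A : Matrix (Fin n) (Fin n) E} (B : Matrix (Fin n) (Fin n) E),
      (∀ i, A i o - A i L = if i = a then 1 else 0) →
      ∀ k, (B * A) k o - (B * A) k L = B k a := by
    intro A B h k
    rw [Matrix.mul_apply, Matrix.mul_apply, ← Finset.sum_sub_distrib]
    simp only [← mul_sub, h]
    simp
  have hone : ∀ k, (1 : Matrix (Fin n) (Fin n) E) k o - (1 : Matrix (Fin n) (Fin n) E) k L =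
      (if k = o then 1 else 0) - (if k = L then 1 else 0) := fun k => by
    rw [Matrix.one_apply, Matrix.one_apply]
  have hPa : ∀ k, G⁻¹ k a = (if k = o then 1 else 0) - (if k = L then 1 else 0) := fun k => by
    rw [← hmulcol G⁻¹ hcol k, hPG, hone]
  have hPa' : ∀ k, G'⁻¹ k a = (if k = o then 1 else 0) - (if k = L then 1 else 0) := fun k => by
    rw [← hmulcol G'⁻¹ hcol' k, hPG', hone]
  have hPo := hinvrow hG hrow
  have hPo' := hinvrow hG' hrow'
  -- the two kinds of elements of the Levi
  have hE : ∀ i j, o ≠ i → j ≠ L → i ≤ j →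
      (∀ p, p ≠ a → (G * Matrix.single i j (1 : E) * G⁻¹) a p = 0 ∧
        (G * Matrix.single i j (1 : E) * G⁻¹) p a = 0) := by
    intro i j hi hj hij p hp
    have hj' : j ≠ o := fun h => hi (le_antisymm (ho i) (h ▸ hij))
    rw [mul_single_mul_apply, mul_single_mul_apply, hrow, hPa]
    simp [hi.symm, hj, hj']
  set Y₀ : Matrix (Fin n) (Fin n) E := Matrix.single o o 1 + Matrix.single L L 1 with hY₀
  have hY₀app : ∀ (A B : Matrix (Fin n) (Fin n) E) k l,
      (A * Y₀ * B) k l = A k o * B o l + A k L * B L l := by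
    intro A B k l
    rw [hY₀, mul_add, add_mul, Matrix.add_apply, mul_single_mul_apply, mul_single_mul_apply]
  have hX₀ : ∀ p, p ≠ a → (G * Y₀ * G⁻¹) a p = 0 ∧ (G * Y₀ * G⁻¹) p a = 0 := by
    intro p hp
    rw [hY₀app, hY₀app, hrow, hrow, hPo, hPa, hPa]
    have := hcol p
    rw [if_neg hp] at this
    simpa [hp, hoL, hoL.symm, ← sub_eq_add_neg] using this
  have hback : ∀ Y : Matrix (Fin n) (Fin n) E, G⁻¹ * (G * Y * G⁻¹) * G = Y := fun Y => by
    have : G⁻¹ * (G * Y * G⁻¹) * G = (G⁻¹ * G) * Y * (G⁻¹ * G) := by noncomm_ring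
    rw [this, hPG, one_mul, mul_one]
  have hY₀b : Y₀ ∈ bSet E n := by
    intro i j hij
    have e : ∀ x : Fin n, ¬ (x = i ∧ x = j) := fun x h => (ne_of_gt hij) (h.1.symm.trans h.2)
    rw [hY₀, Matrix.add_apply, Matrix.single_apply, Matrix.single_apply, if_neg (e o),
      if_neg (e L), add_zero]
  -- the scalar `t`
  set h₀ := G⁻¹ * G' with hh₀
  set M := G'⁻¹ * G with hM
  have hh₀M : h₀ * M = 1 := by
    rw [hh₀, hM, mul_assoc, ← mul_assoc G', hGP', one_mul, hPG]
  have hh₀o : ∀ k, h₀ o k = if k = o then 1 else 0 := fun k => by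
    rw [hh₀, Matrix.mul_apply]; simp [hPo, hrow']
  have hMo : ∀ k, M o k = if k = o then 1 else 0 := fun k => by
    rw [hM, Matrix.mul_apply]; simp [hPo', hrow]
  have hMcol : ∀ k, M k o - M k L = (if k = o then 1 else 0) - (if k = L then 1 else 0) :=
    fun k => by rw [hM, hmulcol _ hcol, hPa']
  set t : E := 1 + h₀ L o with ht
  have hML : ∀ k, k ≠ o → M k L * t = if k = L then 1 else 0 := by
    intro k hk
    have h := hlevi _ hX₀ (by rw [hback]; exact hY₀b) k o (lt_of_le_of_ne (ho k) hk.symm)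
    have e : G'⁻¹ * (G * Y₀ * G⁻¹) * G' = M * Y₀ * h₀ := by rw [hM, hh₀]; noncomm_ring
    rw [e, hY₀app, hh₀o, if_pos rfl] at h
    have h' := hMcol k
    rw [if_neg hk] at h'
    rw [ht]
    linear_combination h - h'
  have ht0 : t ≠ 0 := by
    intro h
    have := hML L hoL.symm
    rw [h] at this
    simp at this
  have hML' : ∀ k, M k L = if k = L then t⁻¹ else 0 := by
    intro k
    by_cases hk : k = o
    · rw [hk, hMo, if_neg hoL.symm, if_neg hoL]
    · have := hML k hk
      split_ifs with h
      · rw [if_pos h] at this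
        exact eq_inv_of_mul_eq_one_left this
      · rw [if_neg h] at this
        exact (mul_eq_zero.1 this).resolve_right ht0
  have hh₀L : ∀ k, h₀ k L = if k = L then t else 0 := by
    intro k
    have := congrFun (congrFun hh₀M k) L
    rw [Matrix.mul_apply] at this
    simp only [hML', mul_ite, mul_zero, Finset.sum_ite_eq', Finset.mem_univ, if_true,
      Matrix.one_apply] at this
    rw [mul_inv_eq_iff_eq_mul₀ ht0] at this
    rw [this]
    simp
  have hG'h : G' = G * h₀ := by rw [hh₀, ← mul_assoc, hGP, one_mul]
  have hG'L : ∀ i, G' i L = t * G i L := fun i => by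
    rw [hG'h, Matrix.mul_apply]; simp [hh₀L, mul_comm]
  -- after rescaling
  set D := diagAt a t with hD
  set D' := diagAt a t⁻¹ with hD'
  have hDD : D * D' = 1 := diagAt_mul_inv a ht0
  have hDD' : D' * D = 1 := mul_eq_one_comm.1 hDD
  have hDL : ∀ p, (D * G') p L = t * G p L := by
    intro p
    rw [hD, diagAt, Matrix.diagonal_mul, hG'L]
    by_cases hp : p = a
    · subst hp; simp [hrow, hoL.symm]
    · simp [hp]
  have hDo : ∀ p, (D * G') p o = t * G p o := by
    intro p
    rw [hD, diagAt, Matrix.diagonal_mul]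
    by_cases hp : p = a
    · subst hp; simp [hrow, hrow']
    · have e1 := hcol p
      have e2 := hcol' p
      rw [if_neg hp, sub_eq_zero] at e1 e2
      rw [if_neg hp, one_mul, e2, hG'L, e1]
  set h := G⁻¹ * (D * G') with hh
  set N := G'⁻¹ * (D' * G) with hN
  have hNh : N * h = 1 := by
    have : N * h = G'⁻¹ * (D' * ((G * G⁻¹) * (D * G'))) := by rw [hN, hh]; noncomm_ring
    rw [this, hGP, one_mul, ← mul_assoc D', hDD', one_mul, hPG']
  have hhcol : ∀ x, (∀ p, (D * G') p x = t * G p x) → ∀ k, h k x = if k = x then t else 0 := by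
    intro x hx k
    have := congrFun (congrFun hPG k) x
    rw [Matrix.mul_apply, Matrix.one_apply] at this
    rw [hh, Matrix.mul_apply]
    simp only [hx, mul_left_comm _ t]
    rw [← Finset.mul_sum, this]
    simp
  have hNcol : ∀ x, (∀ p, (D * G') p x = t * G p x) → ∀ k, N k x = if k = x then t⁻¹ else 0 := by
    intro x hx k
    have := congrFun (congrFun hNh k) x
    rw [Matrix.mul_apply] at this
    simp only [hhcol x hx, mul_ite, mul_zero, Finset.sum_ite_eq', Finset.mem_univ, if_true,
      Matrix.one_apply] at this
    rw [(eq_mul_inv_iff_mul_eq₀ ht0).2 this]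
    simp
  have hconj : ∀ Y ∈ bSet E n,
      (∀ p, p ≠ a → (G * Y * G⁻¹) a p = 0 ∧ (G * Y * G⁻¹) p a = 0) →
      N * Y * h ∈ bSet E n := by
    intro Y hY hX
    have e : N * Y * h = G'⁻¹ * (D' * ((G * Y * G⁻¹) * D)) * G' := by
      rw [hN, hh]; noncomm_ring
    rw [e, ← diagAt_comm t hX, ← hD, ← mul_assoc D', hDD', one_mul]
    exact hlevi _ hX (by rwa [hback])
  refine ⟨t, ht0, IsBorel.of_vanishing hNh fun j l hlj => ?_⟩
  by_cases hjL : j = L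
  · left
    subst hjL
    have := hconj _ hY₀b hX₀ j l hlj
    rw [hY₀app, hNcol o hDo, hNcol j hDL, if_neg hoL.symm, if_pos rfl, zero_mul, zero_add] at this
    exact (mul_eq_zero.1 this).resolve_left (inv_ne_zero ht0)
  · by_contra hcon
    push Not at hcon
    obtain ⟨hne, k, i, hlk, hij, hNki⟩ := hcon
    have hko : k ≠ o := fun e => absurd (ho l) (not_le.2 (e ▸ hlk))
    have hio : o ≠ i := by
      rintro rfl
      rw [hNcol o hDo, if_neg hko] at hNki
      exact hNki rfl
    have := hconj _ (single_mem_bSet hij) (hE i j hio hjL hij) k l hlk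
    rw [mul_single_mul_apply] at this
    exact (mul_ne_zero hNki hne) this

/-- The case of a Levi with a one-element block `{a}`. -/
lemma exists_diagAt {n : ℕ} {o L a : Fin n} (ho : ∀ i, o ≤ i) (hL : ∀ i, i ≤ L)
    (hoL : o ≠ L) {g g' : Matrix (Fin n) (Fin n) E} (hg : IsUnit g) (hg' : IsUnit g')
    (h1 : g a o ≠ 0) (h2 : g⁻¹ L a ≠ 0) (h1' : g' a o ≠ 0) (h2' : g'⁻¹ L a ≠ 0)
    (hlevi : ∀ X : Matrix (Fin n) (Fin n) E, (∀ p, p ≠ a → X a p = 0 ∧ X p a = 0) →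
      g⁻¹ * X * g ∈ bSet E n → g'⁻¹ * X * g' ∈ bSet E n) :
    ∃ (t : E) (b : Matrix (Fin n) (Fin n) E), t ≠ 0 ∧ IsBorel b ∧ g' = diagAt a t * g * b := by
  obtain ⟨b, hb, hrow, hcol⟩ := exists_normal_form ho hL hoL hg h1 h2
  obtain ⟨b', hb', hrow', hcol'⟩ := exists_normal_form ho hL hoL hg' h1' h2'
  have hconj : ∀ (x c X : Matrix (Fin n) (Fin n) E),
      (x * c)⁻¹ * X * (x * c) = c⁻¹ * (x⁻¹ * X * x) * c := fun x c X => by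
    rw [Matrix.mul_inv_rev]; noncomm_ring
  obtain ⟨t, ht, hh⟩ := exists_diagAt_of_normal_form ho hL hoL (hg.mul hb.1) (hg'.mul hb'.1)
    hrow hrow' hcol hcol' fun X hX hXg => by
      rw [hconj, bSet_conj_iff hb] at hXg
      rw [hconj, bSet_conj_iff hb']
      exact hlevi X hX hXg
  have hDD : diagAt a t⁻¹ * diagAt a t = 1 := mul_eq_one_comm.1 (diagAt_mul_inv a ht)
  refine ⟨t⁻¹, b * ((g * b)⁻¹ * (diagAt a t * (g' * b'))) * b'⁻¹, inv_ne_zero ht,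
    (hb.mul hh).mul hb'.inv, ?_⟩
  have e : diagAt a t⁻¹ * g * (b * ((g * b)⁻¹ * (diagAt a t * (g' * b'))) * b'⁻¹) =
      diagAt a t⁻¹ * (((g * b) * (g * b)⁻¹) * diagAt a t) * (g' * (b' * b'⁻¹)) := by
    noncomm_ring
  rw [e, unit_mul_inv (hg.mul hb.1), unit_mul_inv hb'.1, one_mul, hDD, one_mul, mul_one]

lemma InBigCell.apply_ne_zero {n : ℕ} {o L : Fin n} (h : (o : ℕ) + L + 1 = n)
    (ho : (o : ℕ) = 0) {x : Matrix (Fin n) (Fin n) E} (hx : InBigCell x) : x L o ≠ 0 := by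
  obtain ⟨b, b', hb, hb', rfl⟩ := hx
  have hL : ∀ i, i ≤ L := fun i => by rw [Fin.le_def]; omega
  have ho' : ∀ i, o ≤ i := fun i => by rw [Fin.le_def]; omega
  rw [Matrix.mul_apply, Finset.sum_eq_single o, Matrix.mul_apply, Finset.sum_eq_single L]
  · have : w0Mat E n L o = 1 := by
      simp only [w0Mat, Matrix.of_apply]
      rw [if_pos (by omega)]
    rw [this, mul_one]
    exact mul_ne_zero (hb.diag_ne_zero L) (hb'.diag_ne_zero o)
  · intro k _ hk
    rw [hb.2 L k (lt_of_le_of_ne (hL k) hk), zero_mul]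
  · simp
  · intro k _ hk
    rw [hb'.2 k o (lt_of_le_of_ne (ho' k) hk.symm), mul_zero]
  · simp

lemma InBigCell.inv {n : ℕ} {x : Matrix (Fin n) (Fin n) E} (hx : InBigCell x) :
    InBigCell x⁻¹ := by
  obtain ⟨b, b', hb, hb', rfl⟩ := hx
  refine ⟨b'⁻¹, b⁻¹, hb'.inv, hb.inv, ?_⟩
  rw [Matrix.mul_inv_rev, Matrix.mul_inv_rev, mul_assoc,
    Matrix.inv_eq_right_inv (w0Mat_mul_self (E := E) (n := n))]

lemma NonCritical.entries_ne_zero {n : ℕ} {S0 : Set ℕ} {g : Matrix (Fin n) (Fin n) E}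
    (hg : NonCritical S0 g) {o L a : Fin n} (h : (o : ℕ) + L + 1 = n) (ho : (o : ℕ) = 0)
    {u v : Equiv.Perm (Fin n)} (hu : WminRep S0 u) (hv : WminRep S0 v) (hua : u a = L)
    (hva : v a = o) : g a o ≠ 0 ∧ g⁻¹ L a ≠ 0 := by
  constructor
  · have := (hg.2 u hu).apply_ne_zero h ho
    rwa [permMat_mul_apply, u.symm_apply_eq.2 hua.symm] at this
  · have := (hg.2 v hv).inv.apply_ne_zero h ho
    rwa [Matrix.mul_inv_rev, permMat_inv, mul_permMat_apply, Equiv.Perm.inv_eq_iff_eq.2 hva.symm]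
      at this

/-- If only the first or only the last step is missing from `S₀`, then the corresponding
one-element block can be moved to both ends by elements of `W_n^{S₀}`. -/
lemma exists_moving_perms {n : ℕ} {S0 : Set ℕ} {a o L : Fin n} (h : (o : ℕ) + L + 1 = n)
    (ho : (o : ℕ) = 0) (ha : (a = o ∧ 0 ∉ S0) ∨ (a = L ∧ n - 2 ∉ S0)) :
    ∃ u v : Equiv.Perm (Fin n), WminRep S0 u ∧ WminRep S0 v ∧ u a = L ∧ v a = o := by
  have h1 : WminRep S0 (1 : Equiv.Perm (Fin n)) := fun i j hij _ => by
    rw [Equiv.Perm.one_apply, Equiv.Perm.one_apply, Fin.lt_def]; omega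
  rcases ha with ⟨rfl, hS⟩ | ⟨rfl, hS⟩
  · obtain ⟨u, hu, huW, -⟩ := exists_perm (n := n) (i := 0) (S0 := S0)
      (fun j => if j = 0 then n - 1 else j - 1)
      (by intro j hj; split_ifs <;> omega)
      (by intro j hj l hl h; split_ifs at h <;> omega)
      (by intro j hj hjS
          have : j ≠ 0 := fun e => hS (e ▸ hjS)
          simp [this]; omega)
      (by intros; omega)
    refine ⟨u, 1, huW, h1, Fin.ext ?_, rfl⟩
    rw [hu, if_pos ho]; omega
  · obtain ⟨u, hu, huW, -⟩ := exists_perm (n := n) (i := 0) (S0 := S0)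
      (fun j => if j = n - 1 then 0 else j + 1)
      (by intro j hj; split_ifs <;> omega)
      (by intro j hj l hl h; split_ifs at h <;> omega)
      (by intro j hj hjS
          have : j ≠ n - 2 := fun e => hS (e ▸ hjS)
          split_ifs <;> omega)
      (by intros; omega)
    refine ⟨1, u, h1, huW, rfl, Fin.ext ?_⟩
    rw [hu, if_pos (by omega)]; omega

/-- Suppose `g, g'` are non-critical of type `S₀`, `K(g) = K(g')`, and
for every `u ∈ W_n^{S₀}` there is `z_u ∈ Z_{S₀(u)}` with
`𝔩_{S₀(u)} ∩ Ad_{[u]g'}(𝔟) = Ad_{z_u}(𝔩_{S₀(u)} ∩ Ad_{[u]g}(𝔟))`.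
Then `Z_{S₀} g B = Z_{S₀} g' B`. -/
theorem statement1
    {n : ℕ} (S0 : Set ℕ) (hS0 : ∀ i ∈ S0, i + 1 < n)
    (g g' : Matrix (Fin n) (Fin n) E)
    (hg : NonCritical S0 g) (hg' : NonCritical S0 g')
    (hK : Kset S0 g = Kset S0 g')
    (hLevi : ∀ u : Equiv.Perm (Fin n), WminRep S0 u →
      ∃ zu : Matrix (Fin n) (Fin n) E, IsUnit zu ∧ zu ∈ zSetJ E (S0ofu S0 u) ∧
        lSetJ E (S0ofu S0 u) ∩ AdSet (permMat E u * g') (bSet E n) =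
          AdSet zu (lSetJ E (S0ofu S0 u) ∩ AdSet (permMat E u * g) (bSet E n))) :
    ∃ z b : Matrix (Fin n) (Fin n) E,
      IsUnit z ∧ z ∈ zSetJ E S0 ∧ IsBorel b ∧ g' = z * g * b := by
  have hg1 := unit_mul_inv hg.1
  have hfin : (∀ j l : Fin n, l < j → (g⁻¹ * g') j l = 0) →
      ∃ z b : Matrix (Fin n) (Fin n) E,
        IsUnit z ∧ z ∈ zSetJ E S0 ∧ IsBorel b ∧ g' = z * g * b := fun h =>
    ⟨1, g⁻¹ * g', isUnit_one, ⟨fun p q hpq => Matrix.one_apply_ne hpq, fun p q _ => by simp⟩,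
      ⟨(IsUnit.inv_matrix hg.1).mul hg'.1, h⟩, by rw [one_mul, ← mul_assoc, hg1, one_mul]⟩
  by_cases hcase : ∃ c, c ∉ S0 ∧ ((1 ≤ c ∧ c + 3 ≤ n) ∨ (c = 0 ∧ 3 ≤ n ∧ n - 2 ∉ S0))
  · obtain ⟨c, hc, hcn⟩ := hcase
    refine hfin fun j l hlj => ?_
    have hj : (j.rev : ℕ) < l.rev := Fin.rev_lt_rev.2 hlj
    obtain ⟨u, v, hu, hv, huv, hcu, hcv, hi⟩ :=
      exists_pair hc hcn (i := l.rev) (by omega) l.rev.2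
    exact flag_step_eq hg hg' hK hu hv huv hcu hcv hi hj le_rfl
  by_cases hall : ∀ k, k + 1 < n → k ∈ S0
  · have hmem : ∀ X, X ∈ lSetJ E (n := n) S0 := fun X p q hpq =>
      absurd (fun k _ hk => hall k (by have := p.2; have := q.2; omega)) hpq
    have hMh : (g'⁻¹ * g) * (g⁻¹ * g') = 1 := by
      rw [mul_assoc, ← mul_assoc g, hg1, one_mul, unit_inv_mul hg'.1]
    refine hfin (IsBorel.of_vanishing hMh fun j l hlj => ?_).2
    by_contra hcon
    push Not at hcon
    obtain ⟨hne, k, i, hlk, hij, hMki⟩ := hcon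
    have hback : g⁻¹ * (g * Matrix.single i j (1 : E) * g⁻¹) * g = Matrix.single i j 1 := by
      have : g⁻¹ * (g * Matrix.single i j (1 : E) * g⁻¹) * g =
          (g⁻¹ * g) * Matrix.single i j 1 * (g⁻¹ * g) := by noncomm_ring
      rw [this, unit_inv_mul hg.1, one_mul, mul_one]
    have := levi_le hS0 hg.1 hg'.1 hLevi (hmem (g * Matrix.single i j 1 * g⁻¹))
      (by rw [hback]; exact single_mem_bSet hij) k l hlk
    have e : g'⁻¹ * (g * Matrix.single i j (1 : E) * g⁻¹) * g' =
        (g'⁻¹ * g) * Matrix.single i j 1 * (g⁻¹ * g') := by noncomm_ring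
    rw [e, mul_single_mul_apply] at this
    exact mul_ne_zero hMki hne this
  push Not at hcase hall
  obtain ⟨c, hcn, hc⟩ := hall
  obtain ⟨o, ho⟩ : ∃ o : Fin n, (o : ℕ) = 0 := ⟨⟨0, by omega⟩, rfl⟩
  obtain ⟨L, hL⟩ : ∃ L : Fin n, (L : ℕ) = n - 1 := ⟨⟨n - 1, by omega⟩, rfl⟩
  obtain ⟨a, ha⟩ : ∃ a : Fin n, (a = o ∧ c = 0) ∨ (a = L ∧ c = n - 2) := by
    by_cases h : c = 0
    · exact ⟨o, Or.inl ⟨rfl, h⟩⟩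
    · have := (hcase c hc).1
      exact ⟨L, Or.inr ⟨rfl, by omega⟩⟩
  have huniq : ∀ k, k + 1 < n → k ∉ S0 → k = c := by
    intro k hk hkS
    by_contra hkc
    have h1 := hcase k hkS
    have h2 := hcase c hc
    rcases Nat.eq_zero_or_pos k with hk0 | hk0
    · have := h1.2 hk0 (by omega)
      exact hc ((show c = n - 2 by omega) ▸ this)
    · rcases Nat.eq_zero_or_pos c with hc0 | hc0
      · have := h2.2 hc0 (by omega)
        exact hkS ((show k = n - 2 by omega) ▸ this)
      · omega
  have hblock : ∀ p q : Fin n, SameBlock S0 p q ↔ (p = a ↔ q = a) := by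
    intro p q
    have hp := p.2
    have hq := q.2
    have hpa : ∀ x : Fin n, x = a ↔ (x : ℕ) = a := fun x => Fin.ext_iff
    have ha' : ((a : ℕ) = 0 ∧ c = 0) ∨ ((a : ℕ) = n - 1 ∧ c = n - 2) := by
      rcases ha with ⟨rfl, h⟩ | ⟨rfl, h⟩
      · exact Or.inl ⟨ho, h⟩
      · exact Or.inr ⟨hL, h⟩
    rw [hpa, hpa]
    constructor
    · intro h
      by_contra hne
      exact hc (h c (by omega) (by omega))
    · intro h k hk hk'
      by_contra hkS
      have := huniq k (by omega) hkS
      omega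
  have hoL : (o : ℕ) + L + 1 = n := by omega
  obtain ⟨u, v, hu, hv, hua, hva⟩ := exists_moving_perms (S0 := S0) (a := a) hoL ho
    (by rcases ha with ⟨h, rfl⟩ | ⟨h, rfl⟩
        · exact Or.inl ⟨h, hc⟩
        · exact Or.inr ⟨h, hc⟩)
  obtain ⟨h1, h2⟩ := hg.entries_ne_zero hoL ho hu hv hua hva
  obtain ⟨h1', h2'⟩ := hg'.entries_ne_zero hoL ho hu hv hua hva
  obtain ⟨t, b, ht, hb, heq⟩ := exists_diagAt (o := o) (L := L) (a := a)
    (fun i => by rw [Fin.le_def]; omega) (fun i => by rw [Fin.le_def]; omega)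
    (fun h => by rw [Fin.ext_iff] at h; omega) hg.1 hg'.1 h1 h2 h1' h2'
    fun X hX => levi_le hS0 hg.1 hg'.1 hLevi fun p q hpq => by
      rw [hblock] at hpq
      by_cases hp : p = a
      · exact hp ▸ (hX q fun hq => hpq (by simp [hp, hq])).1
      · by_cases hq : q = a
        · exact hq ▸ (hX p hp).2
        · exact absurd (by simp [hp, hq]) hpq
  refine ⟨diagAt a t, b, IsUnit.of_mul_eq_one _ (diagAt_mul_inv a ht), ⟨?_, ?_⟩, hb, heq⟩
  · intro p q hpq
    exact Matrix.diagonal_apply_ne _ hpq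
  · intro p q hpq
    rw [hblock] at hpq
    simp [diagAt, hpq]


end Stmt1
end
end

section
/- Assume S₀ determines exactly two blocks, i.e. s = 2 (equivalently Δ∖S₀ = {t₁}). Then p_ref alone is injective: if g, g' ∈ GL_n(E) are non-critical of type S₀ and p_ref,u(Z_{S₀}gB) = p_ref,u(Z_{S₀}g'B) for every u ∈ W_n^{S₀}, then Z_{S₀}gB = Z_{S₀}g'B. (This is the flag-variety form of the paper's theorem that for a non-critical semistable (φ,Γ)-module with two Steinberg blocks, the collection C_ST of Steinberg subquotients determines the Hodge parameters.) -/
/-!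
Statement 2: when `s = 2` (two Steinberg blocks, i.e. `#S₀ + 2 = n`), the refinement map
`p_ref` alone is injective on the space `Φ_nc(S₀)` of non-critical Hodge parameters.
All indexing is 0-based.
-/

open scoped Classical

noncomputable section

namespace Stmt2

/-- The permutation matrix `[u]`, characterized by `[u] · eⱼ = e_{u j}`. -/
def permMat (E : Type*) [Field E] {n : ℕ} (u : Equiv.Perm (Fin n)) :
    Matrix (Fin n) (Fin n) E :=
  Matrix.of fun i j => if i = u j then 1 else 0

/-- The antidiagonal permutation matrix `w₀`. -/
def w0Mat (E : Type*) [Field E] (n : ℕ) : Matrix (Fin n) (Fin n) E :=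
  Matrix.of fun i j => if (i : ℕ) + (j : ℕ) + 1 = n then 1 else 0

variable {E : Type*} [Field E]

/-- Membership in the Borel subgroup `B` of invertible upper triangular matrices. -/
def IsBorel {n : ℕ} (b : Matrix (Fin n) (Fin n) E) : Prop :=
  IsUnit b ∧ ∀ i j : Fin n, j < i → b i j = 0

/-- Upper triangular unipotent matrices (the group `N`). -/
def IsUniUpper {n : ℕ} (m : Matrix (Fin n) (Fin n) E) : Prop :=
  (∀ i j : Fin n, j < i → m i j = 0) ∧ ∀ i : Fin n, m i i = 1

/-- Membership in the big Bruhat cell `B w₀ B`. -/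
def InBigCell {n : ℕ} (g : Matrix (Fin n) (Fin n) E) : Prop :=
  ∃ b b' : Matrix (Fin n) (Fin n) E, IsBorel b ∧ IsBorel b' ∧ g = b * w0Mat E n * b'

/-- `u ∈ W_n^{S₀}` (0-based). -/
def WminRep {n : ℕ} (S0 : Set ℕ) (u : Equiv.Perm (Fin n)) : Prop :=
  ∀ i j : Fin n, (j : ℕ) = (i : ℕ) + 1 → (i : ℕ) ∈ S0 → u i < u j

/-- `g ∈ GL_n(E)` is non-critical of type `S₀`. -/
def NonCritical {n : ℕ} (S0 : Set ℕ) (g : Matrix (Fin n) (Fin n) E) : Prop :=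
  IsUnit g ∧ ∀ u : Equiv.Perm (Fin n), WminRep S0 u → InBigCell (permMat E u * g)

/-- The set `S₀(u)` (0-based). -/
def S0ofu {n : ℕ} (S0 : Set ℕ) (u : Equiv.Perm (Fin n)) : Set ℕ :=
  { i | ∃ a b : Fin n, (a : ℕ) = i ∧ (b : ℕ) = i + 1 ∧
      (u.symm b : ℕ) = (u.symm a : ℕ) + 1 ∧ ((u.symm a : ℕ) ∈ S0) }

/-- `p` and `q` lie in the same `J`-block. -/
def SameBlock {n : ℕ} (J : Set ℕ) (p q : Fin n) : Prop :=
  ∀ k : ℕ, min (p : ℕ) (q : ℕ) ≤ k → k < max (p : ℕ) (q : ℕ) → k ∈ J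

/-- Membership in the standard Levi subgroup `L_J`. -/
def InLevi {n : ℕ} (J : Set ℕ) (g : Matrix (Fin n) (Fin n) E) : Prop :=
  IsUnit g ∧ ∀ p q : Fin n, ¬ SameBlock J p q → g p q = 0

/-- Membership in the centre `Z_J` of `L_J`. -/
def InCenterLevi {n : ℕ} (J : Set ℕ) (g : Matrix (Fin n) (Fin n) E) : Prop :=
  IsUnit g ∧ (∀ p q : Fin n, p ≠ q → g p q = 0) ∧
    ∀ p q : Fin n, SameBlock J p q → g p p = g q q

/-- Membership in `L_J^B = L_J ∩ B`. -/
def InLeviB {n : ℕ} (J : Set ℕ) (g : Matrix (Fin n) (Fin n) E) : Prop :=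
  InLevi J g ∧ ∀ i j : Fin n, j < i → g i j = 0

/-- The first index of the `J`-block containing `p`. -/
def blockStart (J : Set ℕ) (p : ℕ) : ℕ :=
  sInf {m : ℕ | m ≤ p ∧ ∀ k, m ≤ k → k < p → k ∈ J}

/-- The last index of the `J`-block containing `p`. -/
def blockEnd (n : ℕ) (J : Set ℕ) (p : ℕ) : ℕ :=
  sSup {m : ℕ | m < n ∧ ∀ k, p ≤ k → k < m → k ∈ J}

/-- The permutation matrix `w_{0,J}` reversing every `J`-block. -/
def w0Blk (E : Type*) [Field E] (n : ℕ) (J : Set ℕ) : Matrix (Fin n) (Fin n) E :=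
  Matrix.of fun i j =>
    if (i : ℕ) + (j : ℕ) = blockStart J (j : ℕ) + blockEnd n J (j : ℕ) then 1 else 0

/-- `π_J(m)`: the block-diagonal part of `m`. -/
def blockPart {n : ℕ} (J : Set ℕ) (m : Matrix (Fin n) (Fin n) E) :
    Matrix (Fin n) (Fin n) E :=
  Matrix.of fun i j => if SameBlock J i j then m i j else 0

/-- Equality of the classes of `x`, `y` in `Z_J \ L_J / L_J^B`. -/
def LeviCosetEq {n : ℕ} (J : Set ℕ) (x y : Matrix (Fin n) (Fin n) E) : Prop :=
  ∃ z c : Matrix (Fin n) (Fin n) E, InCenterLevi J z ∧ InLeviB J c ∧ y = z * x * c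

lemma mul_apply_w0Mat {n : ℕ} (A : Matrix (Fin n) (Fin n) E) (i j : Fin n) :
    (A * w0Mat E n) i j = A i j.rev := by
  rw [Matrix.mul_apply, Finset.sum_eq_single j.rev]
  · rw [w0Mat, Matrix.of_apply, if_pos (by rw [Fin.val_rev]; omega), mul_one]
  · intro k _ hk
    rw [w0Mat, Matrix.of_apply, if_neg, mul_zero]
    intro h
    exact hk (Fin.ext (by rw [Fin.val_rev]; omega))
  · simp

lemma permMat_mul_apply {n : ℕ} (u : Equiv.Perm (Fin n)) (A : Matrix (Fin n) (Fin n) E)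
    (i j : Fin n) : (permMat E u * A) (u i) j = A i j := by
  rw [Matrix.mul_apply, Finset.sum_eq_single i]
  · simp [permMat]
  · intro k _ hk
    simp [permMat, Ne.symm hk]
  · simp

lemma IsUniUpper.isUnit {n : ℕ} {m : Matrix (Fin n) (Fin n) E} (h : IsUniUpper m) :
    IsUnit m := by
  rw [Matrix.isUnit_iff_isUnit_det, Matrix.det_of_isUpperTriangular (M := m) fun _ _ hij => h.1 _ _ hij]
  simp [h.2]

lemma upper_inv {n : ℕ} {m : Matrix (Fin n) (Fin n) E} (hu : IsUnit m)
    (h : ∀ i j : Fin n, j < i → m i j = 0) (i j : Fin n) (hij : j < i) : m⁻¹ i j = 0 := by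
  have := hu.invertible
  exact Matrix.blockTriangular_inv_of_blockTriangular (M := m) (b := id) (fun _ _ hij => h _ _ hij) hij

lemma IsBorel.inv {n : ℕ} {b : Matrix (Fin n) (Fin n) E} (h : IsBorel b) : IsBorel b⁻¹ :=
  ⟨Matrix.isUnit_nonsing_inv_iff.2 h.1, upper_inv h.1 h.2⟩

lemma IsBorel.mul {n : ℕ} {b c : Matrix (Fin n) (Fin n) E} (hb : IsBorel b) (hc : IsBorel c) :
    IsBorel (b * c) :=
  ⟨hb.1.mul hc.1, fun _ _ hij =>
    Matrix.BlockTriangular.mul (b := id) (fun _ _ hij => hb.2 _ _ hij)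
      (fun _ _ hij => hc.2 _ _ hij) hij⟩

lemma isBorel_diagonal {n : ℕ} {d : Fin n → E} (hd : ∀ i, d i ≠ 0) :
    IsBorel (Matrix.diagonal d) := by
  refine ⟨?_, fun i j hij => Matrix.diagonal_apply_ne _ hij.ne'⟩
  rw [Matrix.isUnit_iff_isUnit_det, Matrix.det_diagonal]
  exact (Finset.prod_ne_zero_iff.2 fun i _ => hd i).isUnit

/-- A unipotent upper triangular matrix that differs from another one by right multiplication by
a lower triangular matrix is equal to it. -/
lemma IsUniUpper.eq_of_eq_mul_lower {n : ℕ} {A A' L : Matrix (Fin n) (Fin n) E}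
    (hA : IsUniUpper A) (hA' : IsUniUpper A') (hL : ∀ i j : Fin n, i < j → L i j = 0)
    (h : A' = A * L) : A' = A := by
  have hdet : IsUnit A.det := (Matrix.isUnit_iff_isUnit_det A).1 hA.isUnit
  have hL' : L = A⁻¹ * A' := by rw [h, Matrix.nonsing_inv_mul_cancel_left _ _ hdet]
  have hup : ∀ i j : Fin n, j < i → L i j = 0 := by
    intro i j hij
    rw [hL']
    exact Matrix.BlockTriangular.mul (b := id) (fun i j hij => upper_inv hA.isUnit hA.1 i j hij)
      (fun i j hij => hA'.1 i j hij) hij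
  have hne : ∀ i j : Fin n, i ≠ j → L i j = 0 := fun i j hij =>
    hij.lt_or_gt.elim (hL i j) (hup i j)
  have h1 : L = 1 := by
    ext i j
    rcases eq_or_ne i j with rfl | hij
    · have := congrFun (congrFun h i) i
      rw [hA'.2, Matrix.mul_apply, Finset.sum_eq_single i, hA.2, one_mul] at this
      · rw [← this, Matrix.one_apply_eq]
      · intro k _ hk
        rw [hne k i hk, mul_zero]
      · simp
    · rw [hne i j hij, Matrix.one_apply_ne hij]
  rw [h, h1, mul_one]

section Blocks

lemma blockStart_mem (J : Set ℕ) (p : ℕ) :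
    blockStart J p ≤ p ∧ ∀ k, blockStart J p ≤ k → k < p → k ∈ J :=
  Nat.sInf_mem (s := {m : ℕ | m ≤ p ∧ ∀ k, m ≤ k → k < p → k ∈ J}) ⟨p, le_rfl, by lia⟩

lemma blockStart_le {J : Set ℕ} {p m : ℕ} (h : m ≤ p) (hJ : ∀ k, m ≤ k → k < p → k ∈ J) :
    blockStart J p ≤ m :=
  Nat.sInf_le ⟨h, hJ⟩

lemma bddAbove_blockEnd (n : ℕ) (J : Set ℕ) (p : ℕ) :
    BddAbove {m : ℕ | m < n ∧ ∀ k, p ≤ k → k < m → k ∈ J} :=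
  ⟨n, fun _ hm => hm.1.le⟩

lemma blockEnd_mem {n : ℕ} (J : Set ℕ) {p : ℕ} (hp : p < n) :
    blockEnd n J p < n ∧ ∀ k, p ≤ k → k < blockEnd n J p → k ∈ J :=
  Nat.sSup_mem (s := {m : ℕ | m < n ∧ ∀ k, p ≤ k → k < m → k ∈ J})
    ⟨p, hp, by lia⟩ (bddAbove_blockEnd n J p)

lemma le_blockEnd {n : ℕ} {J : Set ℕ} {p m : ℕ} (h : m < n)
    (hJ : ∀ k, p ≤ k → k < m → k ∈ J) : m ≤ blockEnd n J p :=
  le_csSup (bddAbove_blockEnd n J p) ⟨h, hJ⟩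

lemma blockStart_eq {J : Set ℕ} {p q : ℕ} (hpq : p ≤ q) (h : ∀ k, p ≤ k → k < q → k ∈ J) :
    blockStart J p = blockStart J q := by
  have hp := blockStart_mem J p
  have hq := blockStart_mem J q
  have h1 : blockStart J q ≤ blockStart J p := blockStart_le (by lia) fun k hk hk' => by
    rcases lt_or_ge k p with hkp | hkp
    · exact hp.2 k hk hkp
    · exact h k hkp hk'
  exact le_antisymm (blockStart_le (by lia) fun k hk hk' => hq.2 k hk (by lia)) h1

lemma blockEnd_eq {n : ℕ} {J : Set ℕ} {p q : ℕ} (hpq : p ≤ q) (hq : q < n)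
    (h : ∀ k, p ≤ k → k < q → k ∈ J) : blockEnd n J p = blockEnd n J q := by
  have hp' := blockEnd_mem J (hpq.trans_lt hq)
  have hq' := blockEnd_mem J hq
  have h1 : blockEnd n J q ≤ blockEnd n J p := le_blockEnd hq'.1 fun k hk hk' => by
    rcases lt_or_ge k q with hkq | hkq
    · exact h k hk hkq
    · exact hq'.2 k hkq hk'
  exact le_antisymm h1 (le_blockEnd hp'.1 fun k hk hk' => hp'.2 k (by lia) hk') |>.symm

lemma SameBlock.symm {n : ℕ} {J : Set ℕ} {p q : Fin n} (h : SameBlock J p q) :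
    SameBlock J q p := by
  unfold SameBlock at *
  rwa [min_comm, max_comm]

lemma SameBlock.trans {n : ℕ} {J : Set ℕ} {p q r : Fin n} (h : SameBlock J p q)
    (h' : SameBlock J q r) : SameBlock J p r := by
  intro k hk hk'
  by_cases hc : min (p : ℕ) (q : ℕ) ≤ k ∧ k < max (p : ℕ) (q : ℕ)
  · exact h k hc.1 hc.2
  · exact h' k (by lia) (by lia)

lemma sameBlock_self {n : ℕ} (J : Set ℕ) (p : Fin n) : SameBlock J p p := by
  intro k hk hk'
  lia

lemma SameBlock.start_add_end_eq {n : ℕ} {J : Set ℕ} {p q : Fin n} (h : SameBlock J p q) :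
    blockStart J p + blockEnd n J p = blockStart J q + blockEnd n J q := by
  have key : ∀ {p q : Fin n}, p ≤ q → SameBlock J p q →
      blockStart J p + blockEnd n J p = blockStart J q + blockEnd n J q := by
    intro p q hpq h
    have h' : ∀ k, (p : ℕ) ≤ k → k < q → k ∈ J := fun k hk hk' => h k (by lia) (by lia)
    rw [blockStart_eq hpq h', blockEnd_eq hpq q.2 h']
  rcases le_total p q with hpq | hpq
  · exact key hpq h
  · exact (key hpq h.symm).symm

/-- The reflection of each `J`-block. -/
def blockRevFun {n : ℕ} (J : Set ℕ) (j : Fin n) : Fin n :=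
  ⟨blockStart J j + blockEnd n J j - j, by
    have h1 := (blockStart_mem J j).1
    have h2 := (blockEnd_mem J j.2).1
    lia⟩

lemma val_blockRevFun {n : ℕ} (J : Set ℕ) (j : Fin n) :
    (blockRevFun J j : ℕ) + j = blockStart J j + blockEnd n J j := by
  have h2 : (j : ℕ) ≤ blockEnd n J j := le_blockEnd j.2 (by lia)
  simp only [blockRevFun]
  lia

lemma sameBlock_blockRevFun {n : ℕ} (J : Set ℕ) (j : Fin n) :
    SameBlock J j (blockRevFun J j) := by
  intro k hk hk'
  have h := val_blockRevFun J j
  have h1 := blockStart_mem J j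
  have h2 := blockEnd_mem J j.2
  have h3 : (j : ℕ) ≤ blockEnd n J j := le_blockEnd j.2 (by lia)
  rcases lt_or_ge k j with hkj | hkj
  · exact h1.2 k (by lia) hkj
  · exact h2.2 k hkj (by lia)

lemma blockRevFun_involutive {n : ℕ} (J : Set ℕ) :
    Function.Involutive (blockRevFun (n := n) J) := by
  intro j
  have h1 := val_blockRevFun J j
  have h2 := val_blockRevFun J (blockRevFun J j)
  have h3 := (sameBlock_blockRevFun J j).start_add_end_eq
  exact Fin.ext (by lia)

/-- The reflection of each `J`-block, as a permutation. -/
def blockRev {n : ℕ} (J : Set ℕ) : Equiv.Perm (Fin n) := (blockRevFun_involutive J).toPerm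

lemma blockRev_blockRev {n : ℕ} (J : Set ℕ) (j : Fin n) : blockRev J (blockRev J j) = j :=
  blockRevFun_involutive J j

lemma mul_w0Blk_apply {n : ℕ} (J : Set ℕ) (A : Matrix (Fin n) (Fin n) E) (i j : Fin n) :
    (A * w0Blk E n J) i j = A i (blockRev J j) := by
  have h : (blockRev J j : ℕ) + j = _ := val_blockRevFun J j
  rw [Matrix.mul_apply, Finset.sum_eq_single (blockRev J j)]
  · rw [w0Blk, Matrix.of_apply, if_pos h, mul_one]
  · intro k _ hk
    rw [w0Blk, Matrix.of_apply, if_neg, mul_zero]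
    intro hk'
    exact hk (Fin.ext (by lia))
  · simp

lemma isUniUpper_blockPart {n : ℕ} (J : Set ℕ) {m : Matrix (Fin n) (Fin n) E}
    (h : IsUniUpper m) : IsUniUpper (blockPart J m) := by
  refine ⟨fun i j hij => ?_, fun i => ?_⟩
  · simp [blockPart, h.1 i j hij]
  · simp [blockPart, h.2 i, sameBlock_self J i]

lemma LeviCosetEq.blockPart_eq {n : ℕ} {J : Set ℕ} {m m' : Matrix (Fin n) (Fin n) E}
    (hm : IsUniUpper m) (hm' : IsUniUpper m')
    (h : LeviCosetEq J (blockPart J m * w0Blk E n J) (blockPart J m' * w0Blk E n J)) :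
    blockPart J m' = blockPart J m := by
  obtain ⟨z, c, ⟨-, hz, hzJ⟩, ⟨⟨-, hcJ⟩, hc⟩, h⟩ := h
  refine (isUniUpper_blockPart J hm).eq_of_eq_mul_lower (isUniUpper_blockPart J hm')
    (L := Matrix.of fun i j => z i i * c (blockRev J i) (blockRev J j)) ?_ ?_
  · intro i j hij
    rw [Matrix.of_apply]
    by_cases hb : SameBlock J (blockRev J i) (blockRev J j)
    · have h1 : (blockRev J i : ℕ) + i = _ := val_blockRevFun J i
      have h2 : (blockRev J j : ℕ) + j = _ := val_blockRevFun J j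
      have h3 := ((sameBlock_blockRevFun J i).trans
        (hb.trans (sameBlock_blockRevFun J j).symm)).start_add_end_eq
      rw [hc _ _ (Fin.lt_def.2 (by lia)), mul_zero]
    · rw [hcJ _ _ hb, mul_zero]
  · ext i j
    have h' := congrFun (congrFun h i) (blockRev J j)
    rw [mul_w0Blk_apply, blockRev_blockRev, Matrix.mul_assoc, Matrix.mul_apply,
      Finset.sum_eq_single i, Matrix.mul_apply, Finset.mul_sum] at h'
    · rw [h', Matrix.mul_apply, ← Equiv.sum_comp (blockRev J)]
      refine Finset.sum_congr rfl fun k _ => ?_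
      rw [mul_w0Blk_apply, blockRev_blockRev, Matrix.of_apply]
      by_cases hb : SameBlock J i k
      · rw [hzJ i k hb]; ring
      · simp [blockPart, hb]
    · intro k _ hk
      rw [hz i k hk.symm, zero_mul]
    · simp

end Blocks

section Shuffle

/-- The shuffle which keeps the first `a - p` and the last `q` indices in place and moves the
indices in `[a - p, a)` past those in `[a, n - q)`. -/
def shuffleFun (n a p q i : ℕ) : ℕ :=
  if i < a - p then i else if i < a then i + (n - q - a) else if i < n - q then i - p else i

/-- The inverse of `shuffleFun`. -/
def shuffleInv (n a p q i : ℕ) : ℕ :=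
  if i < a - p then i else if i < n - p - q then i + p
    else if i < n - q then i - (n - q - a) else i

/-- `shuffleFun` as a permutation. -/
def shuffle {n a p q : ℕ} (hp : p ≤ a) (hq : a + q ≤ n) : Equiv.Perm (Fin n) where
  toFun i := ⟨shuffleFun n a p q i, by have := i.2; unfold shuffleFun; split_ifs <;> lia⟩
  invFun i := ⟨shuffleInv n a p q i, by have := i.2; unfold shuffleInv; split_ifs <;> lia⟩
  left_inv i := Fin.ext (by
    have := i.2; simp only [shuffleFun, shuffleInv]; split_ifs <;> lia)
  right_inv i := Fin.ext (by
    have := i.2; simp only [shuffleFun, shuffleInv]; split_ifs <;> lia)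

variable {n a p q : ℕ} (hp : p ≤ a) (hq : a + q ≤ n)

lemma val_shuffle (i : Fin n) : (shuffle hp hq i : ℕ) = shuffleFun n a p q i := rfl

lemma val_shuffle_symm (i : Fin n) : ((shuffle hp hq).symm i : ℕ) = shuffleInv n a p q i := rfl

lemma wminRep_shuffle {S0 : Set ℕ} (hS : ∀ i, i ∈ S0 ↔ i + 1 < n ∧ i + 1 ≠ a) :
    WminRep S0 (shuffle hp hq) := by
  intro i j hij hi
  rw [hS] at hi
  rw [Fin.lt_def, val_shuffle, val_shuffle, hij]
  have := j.2
  unfold shuffleFun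
  split_ifs <;> lia

lemma sameBlock_shuffle {S0 : Set ℕ} (hS : ∀ i, i ∈ S0 ↔ i + 1 < n ∧ i + 1 ≠ a) {i j : Fin n}
    (h : (a - p ≤ i ∧ (i : ℕ) < n - p - q ∧ a - p ≤ j ∧ (j : ℕ) < n - p - q) ∨
      (n - p - q ≤ i ∧ (i : ℕ) < n - q ∧ n - p - q ≤ j ∧ (j : ℕ) < n - q)) :
    SameBlock (S0ofu S0 (shuffle hp hq)) i j := by
  intro k hk hk'
  refine ⟨⟨k, by lia⟩, ⟨k + 1, by lia⟩, rfl, rfl, ?_⟩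
  rw [val_shuffle_symm, val_shuffle_symm, hS]
  simp only [shuffleInv]
  split_ifs <;> lia

end Shuffle

/-- `v` lies in the span of the first `k` columns of `g`. -/
def InFlag {n : ℕ} (g : Matrix (Fin n) (Fin n) E) (k : ℕ) (v : Fin n → E) : Prop :=
  ∃ x : Fin n → E, (∀ c : Fin n, k ≤ c → x c = 0) ∧ v = g.mulVec x

lemma InFlag.mono {n : ℕ} {g : Matrix (Fin n) (Fin n) E} {k l : ℕ} (hkl : k ≤ l)
    {v : Fin n → E} (h : InFlag g k v) : InFlag g l v := by
  obtain ⟨x, hx, rfl⟩ := h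
  exact ⟨x, fun c hc => hx c (hkl.trans hc), rfl⟩

lemma InFlag.sub_smul {n : ℕ} {g : Matrix (Fin n) (Fin n) E} {k : ℕ} {v w : Fin n → E}
    (hv : InFlag g k v) (hw : InFlag g k w) (t : E) : InFlag g k (v - t • w) := by
  obtain ⟨x, hx, rfl⟩ := hv
  obtain ⟨y, hy, rfl⟩ := hw
  refine ⟨x - t • y, fun c hc => by simp [hx c hc, hy c hc], ?_⟩
  rw [Matrix.mulVec_sub, Matrix.mulVec_smul]

section Bruhat

variable {n : ℕ} {g m b : Matrix (Fin n) (Fin n) E} {u : Equiv.Perm (Fin n)}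

lemma apply_perm_eq (hb : IsBorel b) (h : permMat E u * g = m * w0Mat E n * b) (r j : Fin n) :
    m (u r) j = (g * b⁻¹) r j.rev := by
  have hdet : IsUnit b.det := (Matrix.isUnit_iff_isUnit_det b).1 hb.1
  have h' : permMat E u * (g * b⁻¹) = m * w0Mat E n := by
    rw [← Matrix.mul_assoc, h, Matrix.mul_nonsing_inv_cancel_right _ _ hdet]
  rw [← permMat_mul_apply u (g * b⁻¹), h', mul_apply_w0Mat, Fin.rev_rev]

lemma inFlag_column (hb : IsBorel b) (h : permMat E u * g = m * w0Mat E n * b) (j : Fin n) :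
    InFlag g (n - j) fun r => m (u r) j := by
  refine ⟨fun c => b⁻¹ c j.rev, fun c hc => hb.inv.2 _ _ ?_, ?_⟩
  · rw [Fin.lt_def, Fin.val_rev]
    lia
  · ext r
    rw [apply_perm_eq hb h, Matrix.mul_apply, Matrix.mulVec, dotProduct]

lemma InFlag.eq_zero (hm : IsUniUpper m) (hb : IsBorel b)
    (h : permMat E u * g = m * w0Mat E n * b) {k : ℕ} {v : Fin n → E} (hv : InFlag g k v)
    (hz : ∀ r, n ≤ u r + k → v r = 0) : v = 0 := by
  obtain ⟨x, hx, rfl⟩ := hv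
  have hdet : IsUnit b.det := (Matrix.isUnit_iff_isUnit_det b).1 hb.1
  set y := b.mulVec x with hy
  have hxy : x = b⁻¹.mulVec y := by
    rw [hy, Matrix.mulVec_mulVec, Matrix.nonsing_inv_mul _ hdet, Matrix.one_mulVec]
  have hy0 : ∀ c : Fin n, k ≤ c → y c = 0 := by
    intro c hc
    rw [hy, Matrix.mulVec, dotProduct]
    refine Finset.sum_eq_zero fun d _ => ?_
    rcases lt_or_ge d c with hdc | hdc
    · rw [hb.2 _ _ hdc, zero_mul]
    · rw [hx d (hc.trans hdc), mul_zero]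
  have hgx : ∀ r, g.mulVec x r = ∑ c, m (u r) c * y c.rev := by
    intro r
    rw [hxy, Matrix.mulVec_mulVec, Matrix.mulVec, dotProduct, ← Equiv.sum_comp Fin.revPerm]
    refine Finset.sum_congr rfl fun c _ => ?_
    rw [apply_perm_eq hb h, Fin.revPerm_apply]
  suffices hy' : y = 0 by rw [hxy, hy', Matrix.mulVec_zero, Matrix.mulVec_zero]
  by_contra hne
  obtain ⟨c, hc⟩ := Function.ne_iff.1 hne
  obtain ⟨d, hd, hmin⟩ :=
    (Finset.univ.filter fun c => y c ≠ 0).exists_minimal ⟨c, by simpa using hc⟩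
  rw [Finset.mem_filter] at hd
  have hdk : (d : ℕ) < k := not_le.1 fun h => hd.2 (hy0 d h)
  have hr := hz (u.symm d.rev) (by rw [Equiv.apply_symm_apply, Fin.val_rev]; lia)
  rw [hgx, Finset.sum_eq_single d.rev, Equiv.apply_symm_apply, hm.2, one_mul, Fin.rev_rev] at hr
  · exact hd.2 hr
  · intro e _ he
    rw [Equiv.apply_symm_apply]
    rcases lt_or_gt_of_ne he with hed | hed
    · rw [hm.1 _ _ hed, zero_mul]
    · have : y e.rev = 0 := by
        by_contra hye
        have hlt : e.rev < d := Fin.rev_lt_iff.2 hed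
        exact absurd (hmin (by simpa using hye) hlt.le) (not_le.2 hlt)
      rw [this, mul_zero]
  · simp

end Bruhat

/-- Vectors in the flag of `g` with prescribed zeros and ones, for the two blocks `[0, a)` and
`[a, n)` of rows. -/
structure AdaptedVectors {n : ℕ} (g : Matrix (Fin n) (Fin n) E) (a : ℕ)
    (W X : ℕ → Fin n → E) (Y : ∀ p, p < a → Fin n → E) : Prop where
  eq_zero : ∀ p ≤ a, ∀ v, InFlag g p v →
    (∀ r : Fin n, a - p ≤ r → (r : ℕ) < a → v r = 0) → v = 0
  eq_zero_succ : ∀ p < a, ∀ v, InFlag g (p + 1) v →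
    (∀ r : Fin n, a - p ≤ r → (r : ℕ) < a → v r = 0) →
    (∀ r : Fin n, (r : ℕ) + 1 = n → v r = 0) → v = 0
  W_mem : ∀ p < a, InFlag g (p + 1) (W p)
  W_zero : ∀ p < a, ∀ r : Fin n, a - p ≤ r → (r : ℕ) < a → W p r = 0
  W_one : ∀ r : Fin n, ∀ p, (r : ℕ) + p + 1 = a → W p r = 1
  Y_mem : ∀ p (hp : p < a), InFlag g (p + 1) (Y p hp)
  Y_zero : ∀ p (hp : p < a), ∀ r : Fin n, a - p ≤ r → (r : ℕ) < a → Y p hp r = 0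
  Y_one : ∀ p (hp : p < a), ∀ r : Fin n, (r : ℕ) + 1 = n → Y p hp r = 1
  X_mem : ∀ p < a, InFlag g (p + 2) (X p)
  X_zero : ∀ p < a, ∀ r : Fin n, a - p ≤ r → (r : ℕ) < a → X p r = 0
  X_zero' : ∀ p < a, ∀ r : Fin n, (r : ℕ) + 1 = n → X p r = 0
  X_one : ∀ r : Fin n, ∀ p, (r : ℕ) + p + 1 = a → X p r = 1

namespace AdaptedVectors

variable {n a : ℕ} {g : Matrix (Fin n) (Fin n) E} {W X : ℕ → Fin n → E}
  {Y : ∀ p, p < a → Fin n → E}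

lemma W_eq_smul_Y (h : AdaptedVectors g a W X Y) {p : ℕ} (hp : p < a) {l : Fin n}
    (hl : (l : ℕ) + 1 = n) : W p = W p l • Y p hp := by
  rw [← sub_eq_zero]
  refine h.eq_zero_succ p hp _ ((h.W_mem p hp).sub_smul (h.Y_mem p hp) _) ?_ ?_
  · intro r hr hr'
    simp [h.W_zero p hp r hr hr', h.Y_zero p hp r hr hr']
  · intro r hr
    obtain rfl : r = l := Fin.ext (by lia)
    simp [h.Y_one p hp r hr]

lemma W_last_ne_zero (h : AdaptedVectors g a W X Y) {p : ℕ} (hp : p < a) {l : Fin n}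
    (hl : (l : ℕ) + 1 = n) (han : a < n) : W p l ≠ 0 := by
  intro h0
  have h1 := h.W_one ⟨a - 1 - p, by lia⟩ p (by simp only []; lia)
  rw [h.W_eq_smul_Y hp hl, h0] at h1
  simp at h1

lemma X_sub_W_eq_smul (h : AdaptedVectors g a W X Y) {p : ℕ} {r : Fin n}
    (hr : (r : ℕ) + p + 2 = a) : X p - W p = (X p r - W p r) • W (p + 1) := by
  have hp : p < a := by lia
  rw [← sub_eq_zero]
  refine h.eq_zero (p + 2) (by lia) _ (InFlag.sub_smul ?_ (h.W_mem (p + 1) (by lia)) _) ?_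
  · simpa using (h.X_mem p hp).sub_smul ((h.W_mem p hp).mono (by lia)) 1
  · intro s hs hs'
    rcases (show a - p ≤ s ∨ (s : ℕ) + p + 1 = a ∨ s = r by
      rw [Fin.ext_iff]; lia) with hs1 | hs1 | rfl
    · simp [h.X_zero p hp s hs1 hs', h.W_zero p hp s hs1 hs',
        h.W_zero (p + 1) (by lia) s (by lia) hs']
    · simp [h.X_one s p hs1, h.W_one s p hs1, h.W_zero (p + 1) (by lia) s (by lia) hs']
    · simp [h.W_one s (p + 1) (by lia)]

lemma W_last_eq (h : AdaptedVectors g a W X Y) {p : ℕ} {r l : Fin n}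
    (hr : (r : ℕ) + p + 2 = a) (hl : (l : ℕ) + 1 = n) :
    -W p l = (X p r - W p r) * W (p + 1) l := by
  have := congrFun (h.X_sub_W_eq_smul hr) l
  simpa [h.X_zero' p (by lia) l hl] using this

/-- The last coordinates of the vectors `W p` are determined, up to a common factor, by the
coordinates of `W p` and `X p` in the first block. -/
lemma exists_ratio {g' : Matrix (Fin n) (Fin n) E} {W' X' : ℕ → Fin n → E}
    {Y' : ∀ p, p < a → Fin n → E} (h : AdaptedVectors g a W X Y)
    (h' : AdaptedVectors g' a W' X' Y') (ha : 0 < a) (han : a < n) {l : Fin n}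
    (hl : (l : ℕ) + 1 = n) (hW : ∀ p < a, ∀ r : Fin n, (r : ℕ) < a → W' p r = W p r)
    (hX : ∀ p < a, ∀ r : Fin n, (r : ℕ) < a → X' p r = X p r) :
    ∃ t : E, t ≠ 0 ∧ ∀ p < a, W' p l = t * W p l := by
  have h0 := h.W_last_ne_zero ha hl han
  refine ⟨W' 0 l / W 0 l, div_ne_zero (h'.W_last_ne_zero ha hl han) h0, fun p => ?_⟩
  induction p with
  | zero => exact fun _ => (div_mul_cancel₀ _ h0).symm
  | succ p ih =>
    intro hp
    obtain ⟨r, hr⟩ : ∃ r : Fin n, (r : ℕ) + p + 2 = a := ⟨⟨a - 2 - p, by lia⟩, by lia⟩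
    have e := h.W_last_eq hr hl
    have e' := h'.W_last_eq hr hl
    rw [hW p (by lia) r (by lia), hX p (by lia) r (by lia), ih (by lia)] at e'
    have hne := h.W_last_ne_zero (show p < a by lia) hl han
    refine mul_left_cancel₀ (a := X p r - W p r) ?_ ?_
    · intro hz
      rw [hz, zero_mul, neg_eq_zero] at e
      exact hne e
    · linear_combination -e' + (W' 0 l / W 0 l) * e

end AdaptedVectors

/-- The columns of the unipotent parts of `[u]g`, for `u` a shuffle, are adapted to `g`. -/
lemma adaptedVectors_of_shuffle {n a : ℕ} {g : Matrix (Fin n) (Fin n) E} (han : a < n)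
    {ν : Equiv.Perm (Fin n) → Matrix (Fin n) (Fin n) E}
    (hν : ∀ {p q : ℕ} (hp : p ≤ a) (hq : a + q ≤ n), IsUniUpper (ν (shuffle hp hq)) ∧
      ∃ b, IsBorel b ∧
        permMat E (shuffle hp hq) * g = ν (shuffle hp hq) * w0Mat E n * b) :
    AdaptedVectors g a
      (fun p r => ν (shuffle (n := n) le_rfl (q := 0) han.le)
        (shuffle (n := n) le_rfl (q := 0) han.le r) ⟨n - 1 - p, by lia⟩)
      (fun p r => ν (shuffle (n := n) le_rfl (q := 1) han)
        (shuffle (n := n) le_rfl (q := 1) han r) ⟨n - 2 - p, by lia⟩)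
      (fun p hp r => ν (shuffle (n := n) hp.le (q := 0) han.le)
        (shuffle (n := n) hp.le (q := 0) han.le r) ⟨n - 1 - p, by lia⟩) := by
  have hmem : ∀ {p q : ℕ} (hp : p ≤ a) (hq : a + q ≤ n) (j : Fin n) {k : ℕ}, n - j ≤ k →
      InFlag g k fun r => ν (shuffle hp hq) (shuffle hp hq r) j := by
    intro p q hp hq j k hk
    obtain ⟨-, b, hb, h⟩ := hν hp hq
    exact (inFlag_column hb h j).mono hk
  have hzero : ∀ {p q : ℕ} (hp : p ≤ a) (hq : a + q ≤ n) (r j : Fin n),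
      (j : ℕ) < shuffleFun n a p q r → ν (shuffle hp hq) (shuffle hp hq r) j = 0 :=
    fun hp hq r j hj => (hν hp hq).1.1 _ _ hj
  have hone : ∀ {p q : ℕ} (hp : p ≤ a) (hq : a + q ≤ n) (r j : Fin n),
      (j : ℕ) = shuffleFun n a p q r → ν (shuffle hp hq) (shuffle hp hq r) j = 1 := by
    intro p q hp hq r j hj
    rw [show j = shuffle hp hq r from Fin.ext hj]
    exact (hν hp hq).1.2 _
  refine ⟨?_, ?_, ?_, ?_, ?_, ?_, ?_, ?_, ?_, ?_, ?_, ?_⟩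
  · intro p hp v hv hz
    obtain ⟨hm, b, hb, h⟩ := hν (q := 0) hp han.le
    refine hv.eq_zero hm hb h fun r hr => ?_
    rw [val_shuffle] at hr
    have := r.2
    unfold shuffleFun at hr
    exact hz r (by split_ifs at hr <;> lia) (by split_ifs at hr <;> lia)
  · intro p hp v hv hz hz'
    obtain ⟨hm, b, hb, h⟩ := hν (q := 1) hp.le han
    refine hv.eq_zero hm hb h fun r hr => ?_
    rw [val_shuffle] at hr
    have := r.2
    unfold shuffleFun at hr
    by_cases hrn : (r : ℕ) + 1 = n
    · exact hz' r hrn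
    · exact hz r (by split_ifs at hr <;> lia) (by split_ifs at hr <;> lia)
  · exact fun p hp => hmem _ _ _ (by simp only []; lia)
  · intro p hp r hr hr'
    exact hzero _ _ _ _ (by simp only [shuffleFun]; split_ifs <;> lia)
  · intro r p hr
    exact hone _ _ _ _ (by simp only [shuffleFun]; split_ifs <;> lia)
  · exact fun p hp => hmem _ _ _ (by simp only []; lia)
  · intro p hp r hr hr'
    exact hzero _ _ _ _ (by simp only [shuffleFun]; split_ifs <;> lia)
  · intro p hp r hr
    exact hone _ _ _ _ (by simp only [shuffleFun]; split_ifs <;> lia)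
  · exact fun p hp => hmem _ _ _ (by simp only []; lia)
  · intro p hp r hr hr'
    exact hzero _ _ _ _ (by simp only [shuffleFun]; split_ifs <;> lia)
  · intro p hp r hr
    exact hzero _ _ _ _ (by simp only [shuffleFun]; split_ifs <;> lia)
  · intro r p hr
    exact hone _ _ _ _ (by simp only [shuffleFun]; split_ifs <;> lia)

/-- A set of `n - 2` elements of `{0, …, n - 2}` misses exactly one of them. -/
lemma exists_break {n : ℕ} {S0 : Set ℕ} (hS0 : ∀ i ∈ S0, i + 1 < n) (hs : S0.ncard + 2 = n) :
    ∃ a, 0 < a ∧ a < n ∧ ∀ i, i ∈ S0 ↔ i + 1 < n ∧ i + 1 ≠ a := by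
  have hsub : S0 ⊆ (Finset.range (n - 1) : Set ℕ) := fun i hi => by
    have := hS0 i hi
    simp only [Finset.coe_range, Set.mem_Iio]
    lia
  have hcard := Set.ncard_sdiff_add_ncard_of_subset hsub (Finset.finite_toSet _)
  rw [Set.ncard_coe_finset, Finset.card_range] at hcard
  obtain ⟨m, hm⟩ := Set.ncard_eq_one.1
    (show ((Finset.range (n - 1) : Set ℕ) \ S0).ncard = 1 by lia)
  have hmem : ∀ i, (i < n - 1 ∧ i ∉ S0) ↔ i = m := fun i => by
    simpa using Set.ext_iff.1 hm i
  have hm' := (hmem m).2 rfl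
  refine ⟨m + 1, by lia, by lia, fun i => ⟨fun hi => ⟨hS0 i hi, ?_⟩, fun hi => ?_⟩⟩
  · intro h
    obtain rfl : i = m := by lia
    exact hm'.2 hi
  · by_contra hi'
    have := (hmem i).1 ⟨by lia, hi'⟩
    lia

/-- Assume there are exactly two blocks (`#S₀ + 2 = n`).  If
`g, g'` are non-critical of type `S₀` and `p_ref,u(Z_{S₀}gB) = p_ref,u(Z_{S₀}g'B)` for
every `u ∈ W_n^{S₀}`, then `Z_{S₀}gB = Z_{S₀}g'B`. -/
theorem statement2
    {n : ℕ} (S0 : Set ℕ) (hS0 : ∀ i ∈ S0, i + 1 < n)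
    (hs : S0.ncard + 2 = n)
    (g g' : Matrix (Fin n) (Fin n) E)
    (hg : NonCritical S0 g) (hg' : NonCritical S0 g')
    (ν ν' : Equiv.Perm (Fin n) → Matrix (Fin n) (Fin n) E)
    (hν : ∀ u, WminRep S0 u → IsUniUpper (ν u) ∧
        ∃ b, IsBorel b ∧ permMat E u * g = ν u * w0Mat E n * b)
    (hν' : ∀ u, WminRep S0 u → IsUniUpper (ν' u) ∧
        ∃ b, IsBorel b ∧ permMat E u * g' = ν' u * w0Mat E n * b)
    (href : ∀ u, WminRep S0 u →
        LeviCosetEq (S0ofu S0 u)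
          (blockPart (S0ofu S0 u) (ν u) * w0Blk E n (S0ofu S0 u))
          (blockPart (S0ofu S0 u) (ν' u) * w0Blk E n (S0ofu S0 u))) :
    ∃ z b : Matrix (Fin n) (Fin n) E,
      InCenterLevi S0 z ∧ IsBorel b ∧ g' = z * g * b := by
  obtain ⟨a, ha, han, hS⟩ := exists_break hS0 hs
  have hνs : ∀ {p q : ℕ} (hp : p ≤ a) (hq : a + q ≤ n), _ := fun hp hq =>
    hν (shuffle hp hq) (wminRep_shuffle hp hq hS)
  have hνs' : ∀ {p q : ℕ} (hp : p ≤ a) (hq : a + q ≤ n), _ := fun hp hq =>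
    hν' (shuffle hp hq) (wminRep_shuffle hp hq hS)
  have hblk : ∀ {p q : ℕ} (hp : p ≤ a) (hq : a + q ≤ n) (i j : Fin n),
      ((a - p ≤ i ∧ (i : ℕ) < n - p - q ∧ a - p ≤ j ∧ (j : ℕ) < n - p - q) ∨
        (n - p - q ≤ i ∧ (i : ℕ) < n - q ∧ n - p - q ≤ j ∧ (j : ℕ) < n - q)) →
      ν' (shuffle hp hq) i j = ν (shuffle hp hq) i j := by
    intro p q hp hq i j hij
    have h := congrFun (congrFun ((href _ (wminRep_shuffle hp hq hS)).blockPart_eq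
      (hνs hp hq).1 (hνs' hp hq).1) i) j
    simpa [blockPart, sameBlock_shuffle hp hq hS hij] using h
  have hA := adaptedVectors_of_shuffle han hνs
  have hA' := adaptedVectors_of_shuffle han hνs'
  have hl : ((⟨n - 1, by lia⟩ : Fin n) : ℕ) + 1 = n := by simp only []; lia
  obtain ⟨t, ht, hWt⟩ := hA.exists_ratio hA' ha han hl
    (by
      intro p hp r hr
      refine hblk _ _ _ _ (Or.inr ?_)
      simp only [val_shuffle, shuffleFun]
      split_ifs <;> lia)
    (by
      intro p hp r hr
      refine hblk _ _ _ _ (Or.inr ?_)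
      simp only [val_shuffle, shuffleFun]
      split_ifs <;> lia)
  set u : Equiv.Perm (Fin n) := shuffle (n := n) (le_refl a) (q := 0) han.le with hu
  have hval : ∀ r : Fin n, (u r : ℕ) = if (r : ℕ) < a then r + (n - a) else r - a := by
    intro r
    rw [hu, val_shuffle]
    have := r.2
    unfold shuffleFun
    split_ifs <;> lia
  have hcol : ∀ r j : Fin n, ν' u (u r) j = (if (r : ℕ) < a then 1 else t) * ν u (u r) j *
      (if (j : ℕ) < n - a then t⁻¹ else 1) := by
    intro r j
    have hur := hval r
    by_cases hj : (j : ℕ) < n - a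
    · rw [if_pos hj]
      by_cases hr : (r : ℕ) < a
      · rw [if_pos hr] at hur
        have hlt : j < u r := Fin.lt_def.2 (by lia)
        rw [(hνs' le_rfl han.le).1.1 _ _ hlt, (hνs le_rfl han.le).1.1 _ _ hlt]
        ring
      · rw [if_neg hr] at hur
        rw [if_neg hr, hblk _ _ _ _ (Or.inl (by lia))]
        field_simp
        rfl
    · rw [if_neg hj, mul_one]
      by_cases hr : (r : ℕ) < a
      · rw [if_pos hr] at hur
        rw [if_pos hr, one_mul]
        exact hblk _ _ _ _ (Or.inr (by lia))
      · rw [if_neg hr]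
        have hp : n - 1 - j < a := by lia
        have hjp : (⟨n - 1 - (n - 1 - j), by lia⟩ : Fin n) = j := Fin.ext (by simp only []; lia)
        have e := congrFun (hA.W_eq_smul_Y hp hl) r
        have e' := congrFun (hA'.W_eq_smul_Y hp hl) r
        rw [hWt _ hp] at e'
        simp only [Pi.smul_apply, smul_eq_mul] at e e'
        rw [hblk hp.le han.le (shuffle hp.le han.le r) _ (Or.inl (by
          simp only [val_shuffle, shuffleFun]; split_ifs <;> lia)), mul_assoc, ← e] at e'
        simpa only [hjp] using e'
  obtain ⟨-, b, hb, hgb⟩ := hνs (le_refl a) (q := 0) han.le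
  obtain ⟨-, b', hb', hgb'⟩ := hνs' (le_refl a) (q := 0) han.le
  set Z : Matrix (Fin n) (Fin n) E :=
    Matrix.diagonal fun r : Fin n => if (r : ℕ) < a then 1 else t with hZ
  set D : Matrix (Fin n) (Fin n) E :=
    Matrix.diagonal fun j : Fin n => if (j.rev : ℕ) < n - a then t⁻¹ else 1 with hD
  have hDb : IsBorel D := isBorel_diagonal fun j => by
    split_ifs
    exacts [inv_ne_zero ht, one_ne_zero]
  refine ⟨Z, b⁻¹ * D * b', ⟨?_, fun p q hpq => Matrix.diagonal_apply_ne _ hpq, ?_⟩,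
    (hb.inv.mul hDb).mul hb', ?_⟩
  · refine (isBorel_diagonal fun r => ?_).1
    split_ifs
    exacts [one_ne_zero, ht]
  · intro p q hpq
    have hm : ¬ (min (p : ℕ) q ≤ a - 1 ∧ a - 1 < max (p : ℕ) q) := fun h =>
      ((hS (a - 1)).1 (hpq (a - 1) h.1 h.2)).2 (by lia)
    have hiff : (p : ℕ) < a ↔ (q : ℕ) < a := by lia
    simp [hZ, hiff]
  · have hdet : IsUnit b'.det := (Matrix.isUnit_iff_isUnit_det b').1 hb'.1
    have key : g' * b'⁻¹ = Z * (g * b⁻¹) * D := by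
      ext r j
      have h := hcol r j.rev
      rw [apply_perm_eq hb hgb, apply_perm_eq hb' hgb', Fin.rev_rev] at h
      rw [h, hZ, hD, Matrix.mul_diagonal, Matrix.diagonal_mul]
    calc g' = g' * b'⁻¹ * b' := (Matrix.nonsing_inv_mul_cancel_right _ _ hdet).symm
      _ = Z * g * (b⁻¹ * D * b') := by rw [key]; simp only [Matrix.mul_assoc]

end Stmt2
end
end

section
/- Fix 1 ≤ r < q ≤ s with q > r+1, and let M, M' ∈ N both be non-critical of type S₀. Assume: (a) M_{ij} = M'_{ij} for every entry (i,j) with i in block r' and j in block q' for some pair r ≤ r' ≤ q' ≤ q with (r',q') ≠ (r,q); (b) M_{t_{r−1}+l_r, t_{q−1}+1} = M'_{t_{r−1}+l_r, t_{q−1}+1}; (c) Fl_{r,q,t}(M; (l₁,…,l_s)) = Fl_{r,q,t}(M'; (l₁,…,l_s)) for every 1 ≤ t ≤ l_q; (d) Fl_{s+1−q, s+1−r, t}(M^∨; (l_s,…,l₁)) = Fl_{s+1−q, s+1−r, t}(M'^∨; (l_s,…,l₁)) for every 1 ≤ t ≤ l_r, where M^∨ := w₀(M⁻¹)ᵀw₀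 and the dual block sizes are (l_s,…,l₁). Then M_{ij} = M'_{ij} for every entry (i,j) with i in block r and j in block q. (This is the matrix/flag form of the paper's proposition that, given the intermediate blocks, the Steinberg subquotient data C_r^q determines the Hodge-parameter block (r,q) up to its single lower-left entry.) -/
/-!
Statement 3: given the intermediate blocks, the Steinberg subquotient data `C_r^q`
determines the Hodge-parameter block `(r,q)` up to its single lower-left entry.
All indexing of positions is 0-based (a 1-based index `i` becomes the 0-based `i-1`);
block indices `r, q, r', q'` remain 1-based natural numbers.
-/

open scoped Classical

noncomputable section

namespace Stmt3

/-- The permutation matrix `[u]`, characterized by `[u] · eⱼ = e_{u j}`. -/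
def permMat (E : Type*) [Field E] {n : ℕ} (u : Equiv.Perm (Fin n)) :
    Matrix (Fin n) (Fin n) E :=
  Matrix.of fun i j => if i = u j then 1 else 0

/-- The antidiagonal permutation matrix `w₀`. -/
def w0Mat (E : Type*) [Field E] (n : ℕ) : Matrix (Fin n) (Fin n) E :=
  Matrix.of fun i j => if (i : ℕ) + (j : ℕ) + 1 = n then 1 else 0

variable {E : Type*} [Field E]

/-- Membership in the Borel subgroup `B` of invertible upper triangular matrices. -/
def IsBorel {n : ℕ} (b : Matrix (Fin n) (Fin n) E) : Prop :=
  IsUnit b ∧ ∀ i j : Fin n, j < i → b i j = 0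

/-- Upper triangular unipotent matrices (the group `N`). -/
def IsUniUpper {n : ℕ} (m : Matrix (Fin n) (Fin n) E) : Prop :=
  (∀ i j : Fin n, j < i → m i j = 0) ∧ ∀ i : Fin n, m i i = 1

/-- Membership in the big Bruhat cell `B w₀ B`. -/
def InBigCell {n : ℕ} (g : Matrix (Fin n) (Fin n) E) : Prop :=
  ∃ b b' : Matrix (Fin n) (Fin n) E, IsBorel b ∧ IsBorel b' ∧ g = b * w0Mat E n * b'

/-- `u ∈ W_n^{S₀}` (0-based). -/
def WminRep {n : ℕ} (S0 : Set ℕ) (u : Equiv.Perm (Fin n)) : Prop :=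
  ∀ i j : Fin n, (j : ℕ) = (i : ℕ) + 1 → (i : ℕ) ∈ S0 → u i < u j

/-- The partial sums `τ_r = m₁ + ⋯ + m_r` of a tuple of block sizes. -/
def partialSum {k : ℕ} (m : Fin k → ℕ) (r : ℕ) : ℕ :=
  ∑ j ∈ Finset.univ.filter (fun j : Fin k => (j : ℕ) < r), m j

/-- `F_i(M)`: the span of the last `i` columns of `M`. -/
def lastCols {n : ℕ} (M : Matrix (Fin n) (Fin n) E) (i : ℕ) :
    Submodule E (Fin n → E) :=
  Submodule.span E { v | ∃ j : Fin n, n ≤ (j : ℕ) + i ∧ v = fun k => M k j }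

/-- The span of the standard basis vectors `e_p` with `p ∈ P` (0-based positions). -/
def coordSpan (E : Type*) [Field E] (n : ℕ) (P : Set ℕ) : Submodule E (Fin n → E) :=
  Submodule.span E { v | ∃ p : Fin n, (p : ℕ) ∈ P ∧ v = Pi.single p 1 }

/-- `Fl_{a,c,t}(M; (m₁,…,m_k))(i)`: the filtration on `W ⊆ A/B'` induced by `F_•(M)`,
where `A = ⟨e₁,…,e_{τ_{c-1}+t}⟩`,
`B' = ⟨e₁,…,e_{τ_{a-1}}⟩ + ⟨e_{τ_{c-1}+1},…,e_{τ_{c-1}+t}⟩` and `W` is the image of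
`⟨e_{τ_{a-1}+1},…,e_{τ_a}⟩`.  Submodules of the quotient `A/B'` are encoded via the
canonical bijection as submodules of `Eⁿ` containing `B'`:
`Fl(i) = ((F_i ⊓ A) ⊔ B') ⊓ (W₀ ⊔ B')`. -/
def inducedFl {n : ℕ} (M : Matrix (Fin n) (Fin n) E)
    (k : ℕ) (m : Fin k → ℕ) (a c t i : ℕ) : Submodule E (Fin n → E) :=
  ((lastCols M i ⊓ coordSpan E n {p | p < partialSum m (c - 1) + t}) ⊔
      coordSpan E n ({p | p < partialSum m (a - 1)} ∪
        {p | partialSum m (c - 1) ≤ p ∧ p < partialSum m (c - 1) + t})) ⊓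
    (coordSpan E n {p | partialSum m (a - 1) ≤ p ∧ p < partialSum m a} ⊔
      coordSpan E n ({p | p < partialSum m (a - 1)} ∪
        {p | partialSum m (c - 1) ≤ p ∧ p < partialSum m (c - 1) + t}))

theorem mem_coordSpan {n : ℕ} {P : Set ℕ} {v : Fin n → E} :
    v ∈ coordSpan E n P ↔ ∀ p : Fin n, (p : ℕ) ∉ P → v p = 0 := by
  constructor
  · intro hv p hp
    induction hv using Submodule.span_induction with
    | mem x hx =>
      obtain ⟨p', hp', rfl⟩ := hx
      have : p ≠ p' := fun h => hp (h ▸ hp')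
      simp [this]
    | zero => rfl
    | add x y _ _ hx hy => simp [hx, hy]
    | smul a x _ hx => simp [hx]
  · intro h
    rw [pi_eq_sum_univ' v]
    refine Submodule.sum_mem _ fun p _ => ?_
    by_cases hp : (p : ℕ) ∈ P
    · exact Submodule.smul_mem _ _ 
        (Submodule.subset_span ⟨p, hp, by ext k; simp [Pi.single_apply, eq_comm]⟩)
    · simp [h p hp]

theorem coordSpan_sup {n : ℕ} (P Q : Set ℕ) :
    coordSpan E n P ⊔ coordSpan E n Q = coordSpan E n (P ∪ Q) := by
  rw [coordSpan, coordSpan, coordSpan, ← Submodule.span_union]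
  congr 1
  ext v
  simp only [Set.mem_union, Set.mem_ofPred_eq, or_and_right, exists_or]

theorem mem_lastCols {n : ℕ} {M : Matrix (Fin n) (Fin n) E} {k : ℕ} {v : Fin n → E} :
    v ∈ lastCols M k ↔
      ∃ x : Fin n → E, (∀ j : Fin n, (j : ℕ) + k < n → x j = 0) ∧ v = M.mulVec x := by
  constructor
  · intro hv
    induction hv using Submodule.span_induction with
    | mem x hx =>
      obtain ⟨j, hj, rfl⟩ := hx
      refine ⟨Pi.single j 1, fun i hi => ?_, ?_⟩
      · have : i ≠ j := by rintro rfl; omega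
        simp [this]
      · ext i; simp
    | zero => exact ⟨0, by simp⟩
    | add x y _ _ hx hy =>
      obtain ⟨x', hx, rfl⟩ := hx
      obtain ⟨y', hy, rfl⟩ := hy
      exact ⟨x' + y', fun j hj => by simp [hx j hj, hy j hj], by rw [Matrix.mulVec_add]⟩
    | smul a x _ hx =>
      obtain ⟨x', hx, rfl⟩ := hx
      exact ⟨a • x', fun j hj => by simp [hx j hj], by rw [Matrix.mulVec_smul]⟩
  · rintro ⟨x, hx, rfl⟩
    have : M.mulVec x = ∑ j, x j • fun k => M k j := by
      ext i
      simp [Matrix.mulVec, dotProduct, mul_comm]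
    rw [this]
    refine Submodule.sum_mem _ fun j _ => ?_
    by_cases hj : (j : ℕ) + k < n
    · simp [hx j hj]
    · exact Submodule.smul_mem _ _ (Submodule.subset_span ⟨j, by omega, rfl⟩)

theorem mem_inducedFl {n k a c t i α β γ : ℕ} {M : Matrix (Fin n) (Fin n) E} {m : Fin k → ℕ}
    (hα : partialSum m (a - 1) = α) (hβ : partialSum m a = β) (hγ : partialSum m (c - 1) = γ)
    {y : Fin n → E} :
    y ∈ inducedFl M k m a c t i ↔
      (∃ w ∈ lastCols M i, (∀ p : Fin n, γ + t ≤ (p : ℕ) → w p = 0) ∧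
        ∀ p : Fin n, ¬((p : ℕ) < α ∨ γ ≤ (p : ℕ) ∧ (p : ℕ) < γ + t) → y p = w p) ∧
      ∀ p : Fin n, ¬((α ≤ (p : ℕ) ∧ (p : ℕ) < β) ∨ (p : ℕ) < α ∨
        γ ≤ (p : ℕ) ∧ (p : ℕ) < γ + t) → y p = 0 := by
  subst hα hβ hγ
  rw [inducedFl, coordSpan_sup, Submodule.mem_inf, Submodule.mem_sup, mem_coordSpan]
  refine and_congr ⟨?_, ?_⟩ Iff.rfl
  · rintro ⟨w, ⟨hw, hwA⟩, z, hz, rfl⟩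
    refine ⟨w, hw, fun p hp => mem_coordSpan.1 hwA p (by simpa using hp), fun p hp => ?_⟩
    simp [mem_coordSpan.1 hz p hp]
  · rintro ⟨w, hw, hwA, h⟩
    refine ⟨w, ⟨hw, mem_coordSpan.2 fun p hp => hwA p (by simpa using hp)⟩, y - w,
      mem_coordSpan.2 fun p hp => ?_, by simp⟩
    rw [Pi.sub_apply, h p hp, sub_self]

theorem w0Mat_mulVec {n : ℕ} (v : Fin n → E) : (w0Mat E n).mulVec v = v ∘ Fin.rev := by
  ext i
  rw [Matrix.mulVec, dotProduct, Finset.sum_eq_single i.rev]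
  · have : (i : ℕ) + (i.rev : ℕ) + 1 = n := by rw [Fin.val_rev]; omega
    rw [w0Mat, Matrix.of_apply, if_pos this, one_mul, Function.comp_apply]
  · intro j _ hj
    have : ¬ (i : ℕ) + (j : ℕ) + 1 = n := fun h => hj (Fin.ext (by rw [Fin.val_rev]; omega))
    simp [w0Mat, this]
  · simp

theorem permMat_mulVec {n : ℕ} (u : Equiv.Perm (Fin n)) (v : Fin n → E) (i : Fin n) :
    (permMat E u).mulVec v (u i) = v i := by
  rw [Matrix.mulVec, dotProduct, Finset.sum_eq_single i]
  · simp [permMat]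
  · intro j _ hj
    simp [permMat, hj.symm]
  · simp

theorem IsUniUpper.isUnit {n : ℕ} {M : Matrix (Fin n) (Fin n) E} (hM : IsUniUpper M) :
    IsUnit M := by
  rw [Matrix.isUnit_iff_isUnit_det, Matrix.det_of_isUpperTriangular (fun i j h => hM.1 i j h)]
  simp [hM.2]

/-- The inverse of an invertible upper triangular matrix is upper triangular. -/
theorem inv_apply_eq_zero {n : ℕ} {b : Matrix (Fin n) (Fin n) E} (hb : IsUnit b)
    (h : ∀ i j : Fin n, j < i → b i j = 0) {i j : Fin n} (hij : j < i) : b⁻¹ i j = 0 := by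
  have : Invertible b := hb.invertible
  exact Matrix.blockTriangular_inv_of_blockTriangular (b := id) (fun i j h' => h i j h') hij

/-- A permutation in `W_n^{S₀}` moving a given stable set of positions to an initial segment. -/
theorem exists_wminRep {n : ℕ} (S0 : Set ℕ) (P : Finset (Fin n))
    (hP : ∀ i j : Fin n, (j : ℕ) = (i : ℕ) + 1 → (i : ℕ) ∈ S0 → j ∈ P → i ∈ P) :
    ∃ u : Equiv.Perm (Fin n), WminRep S0 u ∧ ∀ i ∈ P, (u i : ℕ) < P.card := by
  let f : Fin n → ℕ := fun i => if i ∈ P then i else n + i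
  let A : Fin n → Finset (Fin n) := fun i => Finset.univ.filter fun j => f j < f i
  have hA : ∀ i, i ∉ A i := fun i => by simp [A]
  have hlt : ∀ {i j}, f i < f j → (A i).card < (A j).card := by
    intro i j h
    refine Finset.card_lt_card (Finset.ssubset_iff_of_subset ?_ |>.2 ⟨i, by simpa [A] using h, hA i⟩)
    intro k hk
    simp only [A, Finset.mem_filter, Finset.mem_univ, true_and] at hk ⊢
    omega
  let g : Fin n → Fin n := fun i => ⟨(A i).card, by
    simpa using Finset.card_lt_card (Finset.ssubset_univ_iff.2 fun h : A i = Finset.univ =>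
      hA i (h ▸ Finset.mem_univ i))⟩
  have hg : Function.Injective g := by
    intro i j h
    have h' : (A i).card = (A j).card := congrArg Fin.val h
    have hf : f i = f j := by
      rcases lt_trichotomy (f i) (f j) with h1 | h1 | h1
      · have := hlt h1; omega
      · exact h1
      · have := hlt h1; omega
    simp only [f] at hf
    apply Fin.ext
    split_ifs at hf <;> omega
  refine ⟨Equiv.ofBijective g (Finite.injective_iff_bijective.1 hg), ?_, ?_⟩
  · intro i j hij hi
    have : f i < f j := by
      have := hP i j hij hi
      simp only [f]
      split_ifs <;> first | omega | tauto
    exact hlt this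
  · intro i hi
    change (A i).card < P.card
    refine Finset.card_lt_card (Finset.ssubset_iff_of_subset ?_ |>.2 ⟨i, hi, hA i⟩)
    intro k hk
    simp only [A, f, Finset.mem_filter, Finset.mem_univ, true_and, hi, if_true] at hk
    by_contra hk'
    rw [if_neg hk'] at hk
    omega

/-- The flag of a non-critical matrix is transverse to block-stable coordinate subspaces. -/
theorem eq_zero_of_mem_lastCols {n : ℕ} {S0 : Set ℕ} {M : Matrix (Fin n) (Fin n) E}
    (hMnc : ∀ u : Equiv.Perm (Fin n), WminRep S0 u →
      InBigCell (permMat E u * M * w0Mat E n))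
    {P : Finset (Fin n)}
    (hP : ∀ i j : Fin n, (j : ℕ) = (i : ℕ) + 1 → (i : ℕ) ∈ S0 → j ∈ P → i ∈ P)
    {k : ℕ} (hk : P.card + k ≤ n) {v : Fin n → E} (hv : v ∈ lastCols M k)
    (hvP : ∀ p ∉ P, v p = 0) : v = 0 := by
  obtain ⟨u, hu, huP⟩ := exists_wminRep S0 P hP
  obtain ⟨b, b', hb, hb', h⟩ := hMnc u hu
  obtain ⟨x, hx, rfl⟩ := mem_lastCols.1 hv
  set v := M.mulVec x with hv_def
  set z := (b'.mulVec (x ∘ Fin.rev)) ∘ Fin.rev with hz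
  have hbz : b.mulVec z = (permMat E u).mulVec v := by
    have h1 := congrArg (fun g => Matrix.mulVec g (x ∘ Fin.rev)) h
    simp only [← Matrix.mulVec_mulVec, w0Mat_mulVec] at h1
    rw [hz, ← h1, Function.comp_assoc, Fin.rev_involutive.comp_self, Function.comp_id]
  have hz_low : ∀ i : Fin n, (i : ℕ) + k < n → z i = 0 := by
    intro i hi
    rw [hz, Function.comp_apply, Matrix.mulVec, dotProduct]
    refine Finset.sum_eq_zero fun j _ => ?_
    by_cases hj : j < i.rev
    · rw [hb'.2 _ _ hj, zero_mul]
    · have : (x ∘ Fin.rev) j = 0 := hx _ (by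
        rw [Fin.lt_def, Fin.val_rev] at hj
        rw [Fin.val_rev]; omega)
      rw [this, mul_zero]
  have hz_high : ∀ i : Fin n, P.card ≤ (i : ℕ) → z i = 0 := by
    intro i hi
    have : z = b⁻¹.mulVec ((permMat E u).mulVec v) := by
      rw [← hbz, Matrix.mulVec_mulVec, Matrix.nonsing_inv_mul _
        ((Matrix.isUnit_iff_isUnit_det _).1 hb.1), Matrix.one_mulVec]
    rw [this, Matrix.mulVec, dotProduct]
    refine Finset.sum_eq_zero fun j _ => ?_
    by_cases hj : j < i
    · rw [inv_apply_eq_zero hb.1 hb.2 hj, zero_mul]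
    · obtain ⟨j, rfl⟩ := u.surjective j
      rw [permMat_mulVec, hvP, mul_zero]
      intro hjP
      have := huP j hjP
      rw [Fin.lt_def] at hj
      omega
  have hz0 : z = 0 := by
    ext i
    by_cases hi : (i : ℕ) + k < n
    · exact hz_low i hi
    · exact hz_high i (by omega)
  ext i
  rw [← permMat_mulVec u v, ← hbz, hz0, Matrix.mulVec_zero]
  rfl

/-- Transversality to a coordinate subspace supported on two intervals of positions. -/
theorem eq_zero_of_mem_lastCols_intervals {n : ℕ} {S0 : Set ℕ} {M : Matrix (Fin n) (Fin n) E}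
    (hMnc : ∀ u : Equiv.Perm (Fin n), WminRep S0 u →
      InBigCell (permMat E u * M * w0Mat E n))
    {b c t k : ℕ} (hc : ∀ i ∈ S0, i + 1 ≠ c) (hk : b + t + k ≤ n)
    {v : Fin n → E} (hv : v ∈ lastCols M k)
    (hvP : ∀ p : Fin n, ¬((p : ℕ) < b ∨ c ≤ (p : ℕ) ∧ (p : ℕ) < c + t) → v p = 0) : v = 0 := by
  refine eq_zero_of_mem_lastCols hMnc
    (P := Finset.univ.filter fun p : Fin n => (p : ℕ) < b ∨ c ≤ (p : ℕ) ∧ (p : ℕ) < c + t)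
    ?_ (k := k) ?_ hv ?_
  · intro i j hij hi
    have := hc i hi
    simp only [Finset.mem_filter, Finset.mem_univ, true_and]
    omega
  · have : (Finset.univ.filter fun p : Fin n =>
        (p : ℕ) < b ∨ c ≤ (p : ℕ) ∧ (p : ℕ) < c + t).card ≤
        (Finset.range b ∪ Finset.Ico c (c + t)).card := by
      refine Finset.card_le_card_of_injOn Fin.val ?_ Fin.val_injective.injOn
      intro p hp
      simpa using hp
    have h2 := Finset.card_union_le (Finset.range b) (Finset.Ico c (c + t))
    simp only [Finset.card_range, Nat.card_Ico] at h2
    omega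
  · intro p hp
    exact hvP p (by simpa using hp)

theorem partialSum_mono {k : ℕ} (m : Fin k → ℕ) : Monotone (partialSum m) := by
  intro x y hxy
  refine Finset.sum_le_sum_of_subset fun j hj => ?_
  simp only [Finset.mem_filter, Finset.mem_univ, true_and] at hj ⊢
  omega

theorem partialSum_lt {k : ℕ} (m : Fin k → ℕ) (hm : ∀ j, 0 < m j) {x y : ℕ} (hxy : x < y)
    (hy : y ≤ k) : partialSum m x < partialSum m y := by
  refine Finset.sum_lt_sum_of_subset (i := ⟨x, by omega⟩) (fun j hj => ?_) ?_ ?_ (hm _)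
    fun _ _ _ => Nat.zero_le _
  · simp only [Finset.mem_filter, Finset.mem_univ, true_and] at hj ⊢
    omega
  · simpa using hxy
  · simp

theorem partialSum_rev {s : ℕ} (l : Fin s → ℕ) {x : ℕ} (hx : x ≤ s) :
    partialSum (fun j => l j.rev) (s - x) + partialSum l x = partialSum l s := by
  have h1 : partialSum (fun j => l j.rev) (s - x) =
      ∑ j ∈ Finset.univ.filter (fun j : Fin s => ¬ (j : ℕ) < x), l j := by
    refine Finset.sum_bij' (fun j _ => j.rev) (fun j _ => j.rev) ?_ ?_ ?_ ?_ ?_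
    all_goals
      intro j hj
      simp only [Finset.mem_filter, Finset.mem_univ, true_and, Fin.val_rev, Fin.rev_rev] at hj ⊢
    all_goals omega
  have h2 : partialSum l s = ∑ j, l j := by
    refine Finset.sum_congr ?_ fun _ _ => rfl
    ext j
    simp
  rw [h1, h2, add_comm]
  exact Finset.sum_filter_add_sum_filter_not _ _ _

theorem exists_block {k : ℕ} (m : Fin k → ℕ) {r q i : ℕ}
    (hi : partialSum m (r - 1) ≤ i) (hi' : i < partialSum m q) :
    ∃ r', r ≤ r' ∧ r' ≤ q ∧ partialSum m (r' - 1) ≤ i ∧ i < partialSum m r' := by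
  have hex : ∃ r', i < partialSum m r' := ⟨q, hi'⟩
  have h0 : partialSum m 0 = 0 := by simp [partialSum]
  have hspec := Nat.find_spec hex
  have hle : ∀ r', partialSum m r' ≤ i → r' < Nat.find hex := by
    intro r' h
    by_contra h'
    have := partialSum_mono m (not_lt.1 h')
    omega
  refine ⟨Nat.find hex, ?_, Nat.find_min' hex hi', ?_, hspec⟩
  · have := hle _ hi; omega
  · have := hle 0 (by omega)
    exact not_lt.1 (Nat.find_min hex (m := Nat.find hex - 1) (by omega))

theorem mem_lastCols_dual {n : ℕ} {M : Matrix (Fin n) (Fin n) E} (hM : IsUniUpper M) {k : ℕ}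
    {y : Fin n → E} :
    y ∘ Fin.rev ∈ lastCols (w0Mat E n * (M⁻¹).transpose * w0Mat E n) k ↔
      ∀ j : Fin n, k ≤ (j : ℕ) → ∑ i, y i * M i j = 0 := by
  have hdet := (Matrix.isUnit_iff_isUnit_det _).1 hM.isUnit
  have h1 : M.transpose * (M⁻¹).transpose = 1 := by
    rw [← Matrix.transpose_mul, Matrix.nonsing_inv_mul _ hdet, Matrix.transpose_one]
  have h2 : (M⁻¹).transpose * M.transpose = 1 := by
    rw [← Matrix.transpose_mul, Matrix.mul_nonsing_inv _ hdet, Matrix.transpose_one]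
  have h3 : ∀ j, ∑ i, y i * M i j = (M.transpose.mulVec y) j := fun j => by
    simp [Matrix.mulVec, dotProduct, mul_comm]
  simp only [h3]
  rw [mem_lastCols]
  constructor
  · rintro ⟨x, hx, h⟩ j hj
    rw [← Matrix.mulVec_mulVec, ← Matrix.mulVec_mulVec, w0Mat_mulVec, w0Mat_mulVec] at h
    have h' : y = (M⁻¹).transpose.mulVec (x ∘ Fin.rev) := by
      ext i
      simpa using congrFun h i.rev
    rw [h', Matrix.mulVec_mulVec, h1, Matrix.one_mulVec]
    refine hx _ ?_
    rw [Fin.val_rev]; omega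
  · intro h
    refine ⟨(M.transpose.mulVec y) ∘ Fin.rev, fun j hj => h _ ?_, ?_⟩
    · rw [Fin.val_rev]; omega
    · rw [← Matrix.mulVec_mulVec, ← Matrix.mulVec_mulVec, w0Mat_mulVec, w0Mat_mulVec,
        Function.comp_assoc, Fin.rev_involutive.comp_self, Function.comp_id,
        Matrix.mulVec_mulVec, h2, Matrix.one_mulVec]

/-- A row of a unipotent matrix can be cleared to the right of column `c` using lower rows. -/
theorem exists_clearing_row {n : ℕ} {M : Matrix (Fin n) (Fin n) E} (hM : IsUniUpper M)
    {c : ℕ} {ρ : Fin n} (hρ : (ρ : ℕ) < c) :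
    ∃ y : Fin n → E, y ρ = 1 ∧ (∀ p, p ≠ ρ → (p : ℕ) < c → y p = 0) ∧
      ∀ j : Fin n, c ≤ (j : ℕ) → ∑ i, y i * M i j = 0 := by
  have hdet := (Matrix.isUnit_iff_isUnit_det _).1 hM.isUnit
  let x : Fin n → E := fun j => if c ≤ (j : ℕ) then M ρ j else 0
  have hlow : ∀ p : Fin n, (p : ℕ) < c → Matrix.vecMul x M⁻¹ p = 0 := by
    intro p hp
    rw [Matrix.vecMul, dotProduct]
    refine Finset.sum_eq_zero fun j _ => ?_
    by_cases hj : c ≤ (j : ℕ)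
    · rw [inv_apply_eq_zero hM.isUnit hM.1 (Fin.lt_def.2 (by omega)), mul_zero]
    · simp [x, hj]
  refine ⟨Pi.single ρ 1 - Matrix.vecMul x M⁻¹, ?_, ?_, ?_⟩
  · simp [hlow ρ hρ]
  · intro p hp hpc
    simp [hp, hlow p hpc]
  · intro j hj
    change Matrix.vecMul (Pi.single ρ 1 - Matrix.vecMul x M⁻¹) M j = 0
    rw [Matrix.sub_vecMul, Matrix.vecMul_vecMul, Matrix.nonsing_inv_mul _ hdet]
    simp [x, hj]

/-- There is a nonzero combination of the columns in `[e, e + (c - b)]` vanishing on the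
rows in `[b, c)`. -/
theorem exists_column_combination {n : ℕ} (M : Matrix (Fin n) (Fin n) E) {b c e : ℕ}
    (hbc : b ≤ c) (he : e + (c - b) < n) (hcn : c ≤ n) :
    ∃ x : Fin n → E, x ≠ 0 ∧ (∀ j : Fin n, ((j : ℕ) < e ∨ e + (c - b) < (j : ℕ)) → x j = 0) ∧
      ∀ p : Fin n, b ≤ (p : ℕ) → (p : ℕ) < c → M.mulVec x p = 0 := by
  let ι : Fin (c - b + 1) → Fin n := fun k => ⟨e + k, by omega⟩
  have hι : Function.Injective ι := fun i j h => Fin.ext (by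
    have := congrArg Fin.val h
    simp only [ι] at this
    omega)
  let κ : Fin (c - b) → Fin n := fun k => ⟨b + k, by omega⟩
  let L : (Fin (c - b + 1) → E) →ₗ[E] (Fin (c - b) → E) :=
    (LinearMap.funLeft E E κ).comp (M.mulVecLin.comp (Function.ExtendByZero.linearMap E ι))
  have hL : LinearMap.ker L ≠ ⊥ := LinearMap.ker_ne_bot_of_finrank_lt (by simp)
  obtain ⟨f, hf, hf0⟩ := Submodule.exists_mem_ne_zero_of_ne_bot hL
  refine ⟨Function.extend ι f 0, ?_, ?_, ?_⟩
  · intro h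
    apply hf0
    ext k
    rw [← hι.extend_apply f 0 k, h]
    rfl
  · intro j hj
    rw [Function.extend_apply' _ _ _ (by
      rintro ⟨k, rfl⟩
      simp only [ι] at hj
      omega)]
    rfl
  · intro p hp hpc
    have := congrFun (LinearMap.mem_ker.1 hf) ⟨p - b, by omega⟩
    have hκ : κ ⟨p - b, by omega⟩ = p := Fin.ext (by simp only [κ]; omega)
    change M.mulVec (Function.extend ι f 0) (κ ⟨p - b, by omega⟩) = 0 at this
    rwa [hκ] at this

/-- Fix `1 ≤ r < q ≤ s` with `q > r + 1` and `M, M' ∈ N` non-critical of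
type `S₀`.  If (a) the entries of `M` and `M'` agree on every block `(r',q')` with
`r ≤ r' ≤ q' ≤ q`, `(r',q') ≠ (r,q)`; (b) they agree at the lower-left entry
`(t_{r-1}+l_r, t_{q-1}+1)` of the `(r,q)` block; (c) the filtrations
`Fl_{r,q,t}( · ; (l₁,…,l_s))` agree for `1 ≤ t ≤ l_q`; and (d) the dual filtrations
`Fl_{s+1-q,s+1-r,t}( ·^∨ ; (l_s,…,l₁))` agree for `1 ≤ t ≤ l_r`, where
`M^∨ = w₀(M⁻¹)ᵀw₀`; then `M` and `M'` agree on the whole `(r,q)` block. -/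
theorem statement3
    {n s : ℕ} (S0 : Set ℕ) (l : Fin s → ℕ) (hl : ∀ j, 0 < l j)
    (hn : partialSum l s = n)
    (hS0 : ∀ i : ℕ, i ∈ S0 ↔ (i + 1 < n ∧ ∀ r ≤ s, partialSum l r ≠ i + 1))
    (r q : ℕ) (hr : 1 ≤ r) (hq : q ≤ s) (hrq : r + 1 < q)
    (M M' : Matrix (Fin n) (Fin n) E)
    (hM : IsUniUpper M) (hM' : IsUniUpper M')
    (hMnc : ∀ u : Equiv.Perm (Fin n), WminRep S0 u →
      InBigCell (permMat E u * M * w0Mat E n))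
    (hM'nc : ∀ u : Equiv.Perm (Fin n), WminRep S0 u →
      InBigCell (permMat E u * M' * w0Mat E n))
    (ha : ∀ r' q' : ℕ, r ≤ r' → r' ≤ q' → q' ≤ q → ¬(r' = r ∧ q' = q) →
      ∀ i j : Fin n, partialSum l (r' - 1) ≤ (i : ℕ) → (i : ℕ) < partialSum l r' →
        partialSum l (q' - 1) ≤ (j : ℕ) → (j : ℕ) < partialSum l q' → M i j = M' i j)
    (hb : ∀ i j : Fin n, (i : ℕ) + 1 = partialSum l r → (j : ℕ) = partialSum l (q - 1) →
      M i j = M' i j)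
    (hc : ∀ t : ℕ, 1 ≤ t → t ≤ partialSum l q - partialSum l (q - 1) →
      ∀ i : ℕ, inducedFl M s l r q t i = inducedFl M' s l r q t i)
    (hd : ∀ t : ℕ, 1 ≤ t → t ≤ partialSum l r - partialSum l (r - 1) →
      ∀ i : ℕ,
        inducedFl (w0Mat E n * (M⁻¹).transpose * w0Mat E n) s (fun j => l j.rev)
            (s + 1 - q) (s + 1 - r) t i =
          inducedFl (w0Mat E n * (M'⁻¹).transpose * w0Mat E n) s (fun j => l j.rev)
            (s + 1 - q) (s + 1 - r) t i) :
    ∀ i j : Fin n, partialSum l (r - 1) ≤ (i : ℕ) → (i : ℕ) < partialSum l r →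
      partialSum l (q - 1) ≤ (j : ℕ) → (j : ℕ) < partialSum l q → M i j = M' i j := by
  set a := partialSum l (r - 1) with ha_def
  set b := partialSum l r
  set c := partialSum l (q - 1)
  set d := partialSum l q
  have hab : a < b := partialSum_lt l hl (by omega) (by omega)
  have hbc : b < c := partialSum_lt l hl (by omega) (by omega)
  have hcd : c < d := partialSum_lt l hl (by omega) (by omega)
  have hdn : d ≤ n := hn ▸ partialSum_mono l hq
  have hSb : ∀ i ∈ S0, i + 1 ≠ b := fun i hi h => ((hS0 i).1 hi).2 r (by omega) h.symm
  have hSc : ∀ i ∈ S0, i + 1 ≠ c := fun i hi h => ((hS0 i).1 hi).2 (q - 1) (by omega) h.symm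
  have hagree : ∀ i j : Fin n, a ≤ (i : ℕ) → (j : ℕ) < d → (b ≤ (i : ℕ) ∨ (j : ℕ) < c) →
      M i j = M' i j := by
    intro i j hi hj hij
    rcases lt_or_ge j i with h | h
    · rw [hM.1 i j h, hM'.1 i j h]
    · have h' : (i : ℕ) ≤ j := h
      obtain ⟨r', h1, h2, h3, h4⟩ := exists_block l hi (lt_of_le_of_lt h' hj)
      obtain ⟨q', h5, h6, h7, h8⟩ := exists_block l (h3.trans h') hj
      refine ha r' q' h1 h5 h6 ?_ i j h3 h4 h7 h8
      rintro ⟨rfl, rfl⟩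
      omega
  let ρ : Fin n := ⟨b - 1, by omega⟩
  let γ : Fin n := ⟨c, by omega⟩
  have hρ : (ρ : ℕ) = b - 1 := rfl
  have hγ : (γ : ℕ) = c := rfl
  have hcorner : M ρ γ ≠ 0 := by
    intro h0
    have hz : (fun k => M k γ) = 0 := by
      refine eq_zero_of_mem_lastCols_intervals hMnc (b := b - 1) (c := b) (t := c + 1 - b)
        (k := n - c) hSb (by omega) (Submodule.subset_span ⟨γ, by omega, rfl⟩) fun p hp => ?_
      by_cases hpc : (p : ℕ) ≤ c
      · have : p = ρ := Fin.ext (by omega)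
        rw [this, h0]
      · exact hM.1 p γ (Fin.lt_def.2 (by omega))
    have := congrFun hz γ
    simp [hM.2] at this
  -- The dual flag determines the last row of block `r`.
  have hrow : ∀ j : Fin n, c ≤ (j : ℕ) → (j : ℕ) < d → M ρ j = M' ρ j := by
    have e1 : partialSum (fun j => l j.rev) (s + 1 - q - 1) = n - d := by
      have := partialSum_rev l hq
      rw [show s + 1 - q - 1 = s - q by omega]; omega
    have e2 : partialSum (fun j => l j.rev) (s + 1 - q) = n - c := by
      have := partialSum_rev l (x := q - 1) (by omega)
      rw [show s + 1 - q = s - (q - 1) by omega]; omega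
    have e3 : partialSum (fun j => l j.rev) (s + 1 - r - 1) = n - b := by
      have := partialSum_rev l (x := r) (by omega)
      rw [show s + 1 - r - 1 = s - r by omega]; omega
    obtain ⟨y, hyρ, hy0, hy⟩ := exists_clearing_row hM (c := c) (ρ := ρ) (by omega)
    have hymem : y ∘ Fin.rev ∈ inducedFl (w0Mat E n * (M⁻¹).transpose * w0Mat E n) s
        (fun j => l j.rev) (s + 1 - q) (s + 1 - r) 1 c := by
      refine (mem_inducedFl e1 e2 e3).2 ⟨⟨_, (mem_lastCols_dual hM).2 hy, ?_, fun _ _ => rfl⟩, ?_⟩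
      · intro p hp
        refine hy0 _ (fun h => ?_) ?_
        · have := congrArg Fin.val h
          rw [Fin.val_rev] at this; omega
        · rw [Fin.val_rev]; omega
      · intro p hp
        refine hy0 _ (fun h => ?_) ?_
        · have := congrArg Fin.val h
          rw [Fin.val_rev] at this; omega
        · rw [Fin.val_rev]; omega
    rw [hd 1 le_rfl (by omega) c] at hymem
    obtain ⟨⟨w, hw, hwA, hyw⟩, -⟩ := (mem_inducedFl e1 e2 e3).1 hymem
    obtain ⟨w, rfl⟩ : ∃ w', w = w' ∘ Fin.rev := ⟨w ∘ Fin.rev, by ext; simp⟩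
    rw [mem_lastCols_dual hM'] at hw
    have hprop : ∀ j : Fin n, c ≤ (j : ℕ) → (j : ℕ) < d → M ρ j = w ρ * M' ρ j := by
      intro j hj hjd
      have h0 : ∑ i, (y i * M i j - w i * M' i j) = 0 := by
        rw [Finset.sum_sub_distrib, hy j hj, hw j hj, sub_self]
      rw [Finset.sum_eq_single ρ, hyρ, one_mul] at h0
      · exact sub_eq_zero.1 h0
      · intro i _ hi
        have hi' : (i : ℕ) ≠ b - 1 := fun h => hi (Fin.ext h)
        by_cases hib : (i : ℕ) < b
        · have h1 := hwA i.rev (by rw [Fin.val_rev]; omega)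
          simp only [Function.comp_apply, Fin.rev_rev] at h1
          rw [h1, hy0 i hi (by omega)]; ring
        by_cases hid : (i : ℕ) < d
        · have h1 := hyw i.rev (by rw [Fin.val_rev]; omega)
          simp only [Function.comp_apply, Fin.rev_rev] at h1
          rw [h1, hagree i j (by omega) hjd (by omega), sub_self]
        · have : j < i := Fin.lt_def.2 (by omega)
          rw [hM.1 i j this, hM'.1 i j this]; ring
      · simp
    have hγγ := hprop γ le_rfl hcd
    rw [← hb ρ γ (by omega) rfl] at hγγ
    have hw1 : w ρ = 1 := by
      have : (w ρ - 1) * M ρ γ = 0 := by rw [sub_mul, ← hγγ]; ring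
      rcases mul_eq_zero.1 this with h | h
      · exact sub_eq_zero.1 h
      · exact absurd h hcorner
    intro j hj hjd
    rw [hprop j hj hjd, hw1, one_mul]
  -- The columns of block `q` are determined one after the other.
  have hcol : ∀ t : ℕ, ∀ i j : Fin n, a ≤ (i : ℕ) → (i : ℕ) < b → (j : ℕ) = c + t →
      (j : ℕ) < d → M i j = M' i j := by
    intro t
    induction t using Nat.strong_induction_on with
    | _ t ih =>
    intro i j hi hib hj hjd
    obtain ⟨x, hx0, hxs, hxm⟩ := exists_column_combination M (b := b) (c := c) (e := b + t)
      hbc.le (by omega) (by omega)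
    have hxs' : ∀ j' : Fin n, (j' : ℕ) < b + t ∨ c + t < (j' : ℕ) → x j' = 0 :=
      fun j' h => hxs j' (by omega)
    have hv0 : M.mulVec x ≠ 0 := fun h => hx0 (by
      rw [← Matrix.one_mulVec x, ← Matrix.nonsing_inv_mul M
        ((Matrix.isUnit_iff_isUnit_det _).1 hM.isUnit), ← Matrix.mulVec_mulVec, h,
        Matrix.mulVec_zero])
    have hmem : ∀ M₀ : Matrix (Fin n) (Fin n) E, M₀.mulVec x ∈ lastCols M₀ (n - (b + t)) :=
      fun M₀ => mem_lastCols.2 ⟨x, fun j' h => hxs' j' (by omega), rfl⟩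
    have hhigh : ∀ M₀ : Matrix (Fin n) (Fin n) E, IsUniUpper M₀ →
        ∀ p : Fin n, c + t < (p : ℕ) → M₀.mulVec x p = 0 := by
      intro M₀ h₀ p hp
      rw [Matrix.mulVec, dotProduct]
      refine Finset.sum_eq_zero fun j' _ => ?_
      by_cases h : j' < p
      · rw [h₀.1 p j' h, zero_mul]
      · rw [Fin.lt_def] at h
        rw [hxs' j' (by omega), mul_zero]
    have hxj : x j ≠ 0 := by
      intro h0
      refine hv0 (eq_zero_of_mem_lastCols_intervals hMnc (b := b) (c := c) (t := t)
        hSc (by omega) (hmem M) fun p hp => ?_)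
      by_cases hpc : (p : ℕ) < c
      · exact hxm p (by omega) hpc
      by_cases hpj : p = j
      · subst hpj
        rw [Matrix.mulVec, dotProduct]
        refine Finset.sum_eq_zero fun j' _ => ?_
        rcases lt_trichotomy j' p with h | h | h
        · rw [hM.1 p j' h, zero_mul]
        · rw [h, h0, mul_zero]
        · rw [Fin.lt_def] at h
          rw [hxs' j' (by omega), mul_zero]
      · have : (p : ℕ) ≠ j := fun h => hpj (Fin.ext h)
        exact hhigh M hM p (by omega)
    have hsame : ∀ p : Fin n, a ≤ (p : ℕ) → (∀ j' : Fin n, c ≤ (j' : ℕ) → (j' : ℕ) ≤ c + t →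
        M p j' = M' p j') → M.mulVec x p = M'.mulVec x p := by
      intro p hp h
      rw [Matrix.mulVec, Matrix.mulVec, dotProduct, dotProduct]
      refine Finset.sum_congr rfl fun j' _ => ?_
      by_cases h1 : (j' : ℕ) < c
      · rw [hagree p j' hp (by omega) (by omega)]
      by_cases h2 : (j' : ℕ) ≤ c + t
      · rw [h j' (by omega) h2]
      · rw [hxs' j' (by omega), mul_zero, mul_zero]
    have hxm' : ∀ p : Fin n, b ≤ (p : ℕ) → (p : ℕ) < c → M'.mulVec x p = 0 := by
      intro p hp hpc
      rw [← hsame p (by omega) fun j' _ h2 => hagree p j' (by omega) (by omega) (by omega)]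
      exact hxm p hp hpc
    have hvρ : M.mulVec x ρ = M'.mulVec x ρ :=
      hsame ρ (by omega) fun j' h1 h2 => hrow j' h1 (by omega)
    have hvρ0 : M.mulVec x ρ ≠ 0 := by
      intro h0
      refine hv0 (eq_zero_of_mem_lastCols_intervals hMnc (b := b - 1) (c := c) (t := t + 1)
        hSc (by omega) (hmem M) fun p hp => ?_)
      by_cases hpb : (p : ℕ) < b
      · have : p = ρ := Fin.ext (by omega)
        rw [this, h0]
      by_cases hpc : (p : ℕ) < c
      · exact hxm p (by omega) hpc
      · exact hhigh M hM p (by omega)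
    have hfl : M.mulVec x ∈ inducedFl M s l r q (t + 1) (n - (b + t)) := by
      refine (mem_inducedFl rfl rfl rfl).2 ⟨⟨_, hmem M, fun p hp => hhigh M hM p (by omega),
        fun _ _ => rfl⟩, fun p hp => ?_⟩
      by_cases hpc : (p : ℕ) < c
      · exact hxm p (by omega) hpc
      · exact hhigh M hM p (by omega)
    rw [hc (t + 1) (by omega) (by omega)] at hfl
    obtain ⟨⟨w, hw, hwA, hyw⟩, -⟩ := (mem_inducedFl rfl rfl rfl).1 hfl
    have hwv : w - M'.mulVec x = 0 := by
      refine eq_zero_of_mem_lastCols_intervals hM'nc (b := b - 1) (c := c) (t := t + 1)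
        hSc (by omega) (Submodule.sub_mem _ hw (hmem M')) fun p hp => ?_
      rw [Pi.sub_apply, sub_eq_zero]
      by_cases hpb : (p : ℕ) < b
      · have : p = ρ := Fin.ext (by omega)
        rw [this, ← hvρ]
        exact (hyw ρ (by omega)).symm
      by_cases hpc : (p : ℕ) < c
      · rw [hxm' p (by omega) hpc, ← hyw p (by omega), hxm p (by omega) hpc]
      · rw [hwA p (by omega), hhigh M' hM' p (by omega)]
    have hvi : M.mulVec x i = M'.mulVec x i := by
      rw [← sub_eq_zero.1 hwv]
      exact hyw i (by omega)
    have h0 : ∑ j', (M i j' * x j' - M' i j' * x j') = 0 := by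
      rw [Finset.sum_sub_distrib]
      exact sub_eq_zero.2 hvi
    rw [Finset.sum_eq_single j, ← sub_mul] at h0
    · rcases mul_eq_zero.1 h0 with h | h
      · exact sub_eq_zero.1 h
      · exact absurd h hxj
    · intro j' _ hj'
      have hne : (j' : ℕ) ≠ j := fun h => hj' (Fin.ext h)
      by_cases h1 : (j' : ℕ) < c
      · rw [hagree i j' hi (by omega) (by omega), sub_self]
      by_cases h2 : (j' : ℕ) ≤ c + t
      · rw [ih (j' - c) (by omega) i j' hi hib (by omega) (by omega), sub_self]
      · rw [hxs' j' (by omega), mul_zero, mul_zero, sub_self]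
    · simp
  intro i j hi hib hj hjd
  exact hcol (j - c) i j hi hib (by omega) hjd

end Stmt3
end
end
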